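/- For every Lebesgue-measurable function μ : ℂ → ℂ with ess sup |μ| < 1 there exists a unique homeomorphism Φ : ℂ → ℂ with Φ(0) = 0 and Φ(1) = 1 such that Φ has locally L² distributional derivatives and satisfies the Beltrami equation ∂Φ/∂z̄ = μ·∂Φ/∂z almost everywhere on ℂ. -/

import Mathlib

open MeasureTheory

/-- The Wirtinger derivative `∂f/∂z = (1/2)(∂f/∂x − i ∂f/∂y)` of `f` at `z`,
where `∂f/∂x`, `∂f/∂y` are the directional derivatives in directions `1`, `i`. -/
noncomputable def wderiv (f : ℂ → ℂ) (z : ℂ) : ℂ :=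
  (fderiv ℝ f z 1 - Complex.I * fderiv ℝ f z Complex.I) / 2

/-- The Wirtinger derivative `∂f/∂z̄ = (1/2)(∂f/∂x + i ∂f/∂y)` of `f` at `z`. -/
noncomputable def wderivBar (f : ℂ → ℂ) (z : ℂ) : ℂ :=
  (fderiv ℝ f z 1 + Complex.I * fderiv ℝ f z Complex.I) / 2

/-- `g` is locally square-integrable on `U`. -/
def LocallyL2On (U : Set ℂ) (g : ℂ → ℂ) : Prop :=
  ∀ K : Set ℂ, K ⊆ U → IsCompact K → IntegrableOn (fun z => ‖g z‖ ^ 2) K volume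

/-- `Φ` has locally `L²` distributional derivatives `g` (in direction `1`) and `h`
(in direction `i`) on the open set `U`: for every `C^∞` compactly supported test
function `φ` with support in `U`, `∫ Φ ∂φ/∂x = −∫ g φ` and `∫ Φ ∂φ/∂y = −∫ h φ`.
The distributional Wirtinger derivatives are then `∂Φ/∂z = (g − i h)/2` and
`∂Φ/∂z̄ = (g + i h)/2`. -/
def HasWeakDerivsOn (U : Set ℂ) (Φ g h : ℂ → ℂ) : Prop :=
  LocallyL2On U g ∧ LocallyL2On U h ∧
    ∀ φ : ℂ → ℂ, ContDiff ℝ (⊤ : ℕ∞) φ → HasCompactSupport φ → tsupport φ ⊆ U →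
      ((∫ z in U, Φ z * fderiv ℝ φ z 1 ∂volume) = -∫ z in U, g z * φ z ∂volume) ∧
      ((∫ z in U, Φ z * fderiv ℝ φ z Complex.I ∂volume) = -∫ z in U, h z * φ z ∂volume)

namespace MRM
open Set Filter Topology

lemma homeo_of_local {f : ℂ → ℂ} (hf : IsLocalHomeomorph f)
    (hp : Tendsto f (cocompact ℂ) (cocompact ℂ)) : IsHomeomorph f := by
  have hc : Continuous f := hf.continuous
  have hcl : IsClosedMap f := (isProperMap_iff_tendsto_cocompact.2 ⟨hc, hp⟩).isClosedMap
  have hpr := isProperMap_iff_tendsto_cocompact.2 ⟨hc, hp⟩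
  have hcov : IsCoveringMap f := by
    rw [isCoveringMap_iff_isCoveringMapOn_univ]
    refine hcl.isCoveringMapOn_of_isLocalHomeomorphOn (fun x _ => ?_) ?_
    · refine (hpr.isCompact_preimage isCompact_singleton).finite ?_
      exact .of_openPartialHomeomorph f subset_rfl (fun e _ => by
        obtain ⟨φ, hφ, h⟩ := hf e
        exact ⟨φ, hφ, h.symm⟩)
    · exact fun x _ => hf x
  have key : ∀ e0 : ℂ, ∃ F : C(ℂ, ℂ), f ∘ F = id ∧ F ∘ f = id := by
    intro e0
    obtain ⟨F, ⟨h1, h2⟩, -⟩ := hcov.existsUnique_continuousMap_lifts (ContinuousMap.id ℂ) (f e0) e0 rfl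
    refine ⟨F, h2, ?_⟩
    refine hcov.eq_of_comp_eq (F.continuous.comp hc) continuous_id ?_ e0 (by simpa using h1)
    rw [← Function.comp_assoc, h2]; rfl
  obtain ⟨F, h1, h2⟩ := key 0
  refine ⟨hc, hf.isOpenMap, ?_, ?_⟩
  · exact fun x y h => by simpa using (congrFun h2 x).symm.trans ((congrArg F h).trans (congrFun h2 y))
  · exact fun y => ⟨F y, congrFun h1 y⟩

/-- weak quasisymmetry -/
def WQS (C : ℝ) (f : ℂ → ℂ) : Prop :=
  ∀ c x y : ℂ, ‖x - c‖ ≤ ‖y - c‖ → ‖f x - f c‖ ≤ C * ‖f y - f c‖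

lemma WQS.doubling {C : ℝ} {f : ℂ → ℂ} (h : WQS C f) (hC : 0 ≤ C) (n : ℕ) (x y : ℂ) :
    ∀ z, ‖z - x‖ ≤ 2 ^ n * ‖y - x‖ → ‖f z - f x‖ ≤ C * (1 + C) ^ n * ‖f y - f x‖ := by
  induction n with
  | zero => intro z hz; simpa using h x z y (by simpa using hz)
  | succ n ih =>
    intro z hz
    set m := (z + x) / 2 with hm
    have h1 : ‖m - x‖ ≤ 2 ^ n * ‖y - x‖ := by
      have : m - x = (z - x) / 2 := by rw [hm]; ring
      rw [this, norm_div, Complex.norm_ofNat, div_le_iff₀ (by norm_num)]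
      calc _ ≤ _ := hz
        _ = _ := by ring
    have h2 := h m z x (by
      have e1 : z - m = (z - x) / 2 := by rw [hm]; ring
      have e2 : x - m = - ((z - x) / 2) := by rw [hm]; ring
      rw [e1, e2, norm_neg])
    have h3 := ih m h1
    rw [norm_sub_rev (f x)] at h2
    calc ‖f z - f x‖ = ‖(f z - f m) + (f m - f x)‖ := by congr 1; ring
      _ ≤ ‖f z - f m‖ + ‖f m - f x‖ := norm_add_le _ _
      _ ≤ (1 + C) * ‖f m - f x‖ := by linarith
      _ ≤ (1 + C) * (C * (1 + C) ^ n * ‖f y - f x‖) := by gcongr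
      _ = _ := by ring

lemma wqs_upper (C : ℝ) (hC : 0 ≤ C) (R : ℝ) : ∃ M, 0 < M ∧ ∀ f, WQS C f → f 0 = 0 → f 1 = 1 →
    ∀ z, ‖z‖ ≤ R → ‖f z‖ ≤ M := by
  obtain ⟨n, hn⟩ := pow_unbounded_of_one_lt R (one_lt_two)
  refine ⟨C * (1 + C) ^ n + 1, by positivity, fun f hf h0 h1 z hz => ?_⟩
  have := hf.doubling hC n 0 1 z (by simpa using hz.trans hn.le)
  simp only [h0, h1, sub_zero, norm_one, mul_one] at this
  linarith

lemma wqs_lower (C : ℝ) (hC : 0 ≤ C) (R ε : ℝ) (hε : 0 < ε) : ∃ δ, 0 < δ ∧ ∀ f, WQS C f → f 0 = 0 →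
    f 1 = 1 → ∀ x y, ‖x‖ ≤ R → ε ≤ ‖y - x‖ → δ ≤ ‖f y - f x‖ := by
  obtain ⟨n, hn⟩ := pow_unbounded_of_one_lt ((R + 1) / ε) (one_lt_two)
  rw [div_lt_iff₀ hε] at hn
  refine ⟨1 / (2 * (C + 1) * (1 + C) ^ n), by positivity, fun f hf h0 h1 x y hx hxy => ?_⟩
  have key : ∀ z, ‖z‖ ≤ 1 → ‖f z - f x‖ ≤ C * (1 + C) ^ n * ‖f y - f x‖ := by
    intro z hz
    refine hf.doubling hC n x y z ?_
    calc ‖z - x‖ ≤ ‖z‖ + ‖x‖ := norm_sub_le _ _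
      _ ≤ R + 1 := by linarith
      _ ≤ 2 ^ n * ε := hn.le
      _ ≤ _ := by gcongr
  have k0 := key 0 (by simp)
  have k1 := key 1 (by simp)
  have : (1 : ℝ) ≤ ‖f 1 - f x‖ + ‖f 0 - f x‖ := by
    calc (1 : ℝ) = ‖(f 1 - f x) - (f 0 - f x)‖ := by rw [h0, h1]; simp
      _ ≤ _ := norm_sub_le _ _
  rw [div_le_iff₀ (by positivity)]
  have hh : 0 ≤ (1 + C) ^ n * ‖f y - f x‖ := by positivity
  nlinarith

/-- pigeonhole -/
lemma pigeon (M δ : ℝ) (hδ : 0 < δ) : ∃ N : ℕ, ∀ x : ℕ → ℂ, (∀ i ≤ N, ‖x i‖ ≤ M) →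
    ∃ i j, i < j ∧ j ≤ N ∧ ‖x i - x j‖ < δ := by
  obtain ⟨t, -, ht, hcov⟩ := finite_cover_balls_of_compact (isCompact_closedBall (0:ℂ) M) (half_pos hδ)
  lift t to Finset ℂ using ht
  refine ⟨t.card, fun x hx => ?_⟩
  have : ∀ i ∈ Finset.range (t.card + 1), ∃ c ∈ t, x i ∈ Metric.ball c (δ / 2) := by
    intro i hi
    have := hcov (show x i ∈ Metric.closedBall (0:ℂ) M by
      simpa using hx i (by simpa [Nat.lt_succ_iff] using hi))
    simpa using this
  choose! c hc1 hc2 using this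
  obtain ⟨i, hi, j, hj, hij, h⟩ := Finset.exists_ne_map_eq_of_card_lt_of_maps_to (by simp) hc1
  have main : ‖x i - x j‖ < δ := by
    have a := hc2 i hi
    have b := hc2 j hj
    rw [← h] at b
    rw [Metric.mem_ball] at a b
    rw [← dist_eq_norm]
    calc _ ≤ dist (x i) (c i) + dist (x j) (c i) := dist_triangle_right _ _ _
      _ < _ := by linarith
  simp only [Finset.mem_range, Nat.lt_succ_iff] at hi hj
  rcases lt_or_gt_of_ne hij with h' | h'
  · exact ⟨i, j, h', hj, main⟩
  · exact ⟨j, i, h', hi, by rwa [norm_sub_rev]⟩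

lemma wqs_equicont (C : ℝ) (hC : 0 < C) (R ε : ℝ) (hε : 0 < ε) : ∃ δ, 0 < δ ∧ ∀ f, WQS C f → f 0 = 0 →
    f 1 = 1 → ∀ x y, ‖x‖ ≤ R → ‖y - x‖ ≤ δ → ‖f y - f x‖ < ε := by
  obtain ⟨M, -, hM⟩ := wqs_upper C hC.le (R + 1)
  obtain ⟨N, hN⟩ := pigeon M (ε / C ^ 2) (by positivity)
  refine ⟨(1 / 2) ^ N, by positivity, fun f hf h0 h1 x z hx hz => ?_⟩
  set w : ℕ → ℂ := fun j => x + (((1 / 2 : ℝ) ^ j : ℝ) : ℂ) with hw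
  have hwx : ∀ j, ‖w j - x‖ = (1 / 2 : ℝ) ^ j := by
    intro j
    simp only [hw, add_sub_cancel_left, Complex.norm_real, Real.norm_eq_abs]
    exact abs_of_pos (by positivity)
  obtain ⟨i, j, hij, hj, h⟩ := hN (fun j => f (w j)) (fun i _ => hM f hf h0 h1 _ (by
    calc ‖w i‖ = ‖x + (w i - x)‖ := by congr 1; ring
      _ ≤ ‖x‖ + ‖w i - x‖ := norm_add_le _ _
      _ ≤ R + 1 := by rw [hwx]; gcongr; exact pow_le_one₀ (by norm_num) (by norm_num)))
  have a1 : ‖f x - f (w j)‖ ≤ C * ‖f (w i) - f (w j)‖ := by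
    apply hf
    rw [norm_sub_rev, hwx]
    have : w i - w j = (((1 / 2 : ℝ) ^ i - (1 / 2 : ℝ) ^ j : ℝ) : ℂ) := by simp [hw]
    rw [this, Complex.norm_real, Real.norm_eq_abs]
    refine le_trans ?_ (le_abs_self _)
    have : (1 / 2 : ℝ) ^ j ≤ (1 / 2) ^ (i + 1) := pow_le_pow_of_le_one (by norm_num) (by norm_num) hij
    rw [pow_succ] at this
    linarith
  have a2 : ‖f z - f x‖ ≤ C * ‖f (w j) - f x‖ := by
    apply hf
    rw [hwx]
    exact hz.trans (pow_le_pow_of_le_one (by norm_num) (by norm_num) hj)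
  rw [norm_sub_rev] at a1
  rw [lt_div_iff₀ (by positivity)] at h
  nlinarith

lemma wqs_proper (C : ℝ) (hC : 0 < C) (M : ℝ) : ∃ R, ∀ f, WQS C f → f 0 = 0 →
    f 1 = 1 → ∀ z, ‖f z‖ ≤ M → ‖z‖ ≤ R := by
  obtain ⟨N, hN⟩ := pigeon (C * M) (1 / C ^ 2) (by positivity)
  refine ⟨2 ^ N, fun f hf h0 h1 z hz => ?_⟩
  by_contra! hcon
  set w : ℕ → ℂ := fun j => (((2 : ℝ) ^ j : ℝ) : ℂ) with hw
  have hwx : ∀ j, ‖w j‖ = (2 : ℝ) ^ j := by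
    intro j
    simp only [hw, Complex.norm_real, Real.norm_eq_abs]
    exact abs_of_pos (by positivity)
  obtain ⟨i, j, hij, hj, h⟩ := hN (fun j => f (w j)) (fun i hi => by
    have := hf 0 (w i) z (by
      rw [sub_zero, sub_zero, hwx]
      exact (pow_le_pow_right₀ (by norm_num) hi).trans hcon.le)
    rw [h0, sub_zero, sub_zero] at this
    exact this.trans (by gcongr))
  have a1 : ‖f 0 - f (w i)‖ ≤ C * ‖f (w j) - f (w i)‖ := by
    apply hf
    rw [zero_sub, norm_neg, hwx]
    have : w j - w i = (((2 : ℝ) ^ j - (2 : ℝ) ^ i : ℝ) : ℂ) := by simp [hw]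
    rw [this, Complex.norm_real, Real.norm_eq_abs]
    refine le_trans ?_ (le_abs_self _)
    have : (2 : ℝ) ^ (i + 1) ≤ 2 ^ j := pow_le_pow_right₀ (by norm_num) hij
    rw [pow_succ] at this
    linarith
  have a2 := hf 0 1 (w i) (by
    rw [sub_zero, sub_zero, hwx, norm_one]; exact one_le_pow₀ (by norm_num))
  rw [h0, h1, sub_zero, sub_zero, norm_one] at a2
  rw [h0, zero_sub, norm_neg, norm_sub_rev] at a1
  rw [lt_div_iff₀ (by positivity)] at h
  nlinarith

end MRM

namespace MRM
open Set Filter Topology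

structure NQS (C : ℝ) (f : ℂ → ℂ) : Prop where
  wqs : WQS C f
  zero : f 0 = 0
  one : f 1 = 1

lemma wqs_limit (C : ℝ) (hC : 0 < C) (f : ℕ → ℂ → ℂ) (hf : ∀ n, NQS C (f n))
    (hs : ∀ n, Function.Surjective (f n)) (𝒰 : Ultrafilter ℕ) :
    ∃ Φ : ℂ → ℂ, NQS C Φ ∧ IsHomeomorph Φ ∧
      (∀ R ε, 0 < ε → ∀ᶠ n in (𝒰 : Filter ℕ), ∀ z, ‖z‖ ≤ R → ‖f n z - Φ z‖ < ε) ∧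
      (∀ M ε, 0 < ε → ∀ᶠ n in (𝒰 : Filter ℕ), ∀ x y, ‖Φ x‖ ≤ M → f n y = Φ x → ‖y - x‖ < ε) := by
  have hlim : ∀ u : ℕ → ℂ, (∃ M, ∀ n, ‖u n‖ ≤ M) → ∃ a, Tendsto u 𝒰 (𝓝 a) := by
    rintro u ⟨M, hM⟩
    obtain ⟨a, -, ha⟩ := (isCompact_closedBall (0:ℂ) M).ultrafilter_le_nhds (𝒰.map u) (by
      rw [le_principal_iff]
      exact Filter.mem_map.2 (Filter.mem_of_superset univ_mem (fun n _ => by simpa using hM n)))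
    exact ⟨a, ha⟩
  have h1 : ∀ z, ∃ a, Tendsto (fun n => f n z) 𝒰 (𝓝 a) := by
    intro z
    obtain ⟨M, -, hM⟩ := wqs_upper C hC.le ‖z‖
    exact hlim _ ⟨M, fun n => hM _ (hf n).wqs (hf n).zero (hf n).one z le_rfl⟩
  choose Φ hΦ using h1
  have hN : NQS C Φ := by
    refine ⟨fun c x y h => ?_, ?_, ?_⟩
    · exact le_of_tendsto_of_tendsto' ((hΦ x).sub (hΦ c)).norm (((hΦ y).sub (hΦ c)).norm.const_mul C)
        (fun n => (hf n).wqs c x y h)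
    · exact tendsto_nhds_unique (hΦ 0) (by simp [(hf _).zero])
    · exact tendsto_nhds_unique (hΦ 1) (by simp [(hf _).one])
  have hcont : Continuous Φ := by
    rw [continuous_iff_continuousAt]
    intro x
    rw [Metric.continuousAt_iff]
    intro ε hε
    obtain ⟨δ, hδ, h⟩ := wqs_equicont C hC ‖x‖ ε hε
    exact ⟨δ, hδ, fun {y} hy => by
      rw [dist_eq_norm] at hy ⊢
      exact h Φ hN.wqs hN.zero hN.one x y le_rfl hy.le⟩
  have hinj : Function.Injective Φ := by
    intro x y h
    by_contra hne
    obtain ⟨δ, hδ, h'⟩ := wqs_lower C hC.le ‖x‖ ‖y - x‖ (norm_pos_iff.2 (sub_ne_zero.2 (Ne.symm hne)))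
    have := h' Φ hN.wqs hN.zero hN.one x y le_rfl le_rfl
    rw [h, sub_self, norm_zero] at this
    linarith
  have hunif : ∀ R ε, 0 < ε → ∀ᶠ n in (𝒰 : Filter ℕ), ∀ z, ‖z‖ ≤ R → ‖f n z - Φ z‖ < ε := by
    intro R ε hε
    obtain ⟨δ, hδ, h⟩ := wqs_equicont C hC R (ε / 3) (by positivity)
    obtain ⟨t, hts, ht, hcov⟩ := finite_cover_balls_of_compact (isCompact_closedBall (0:ℂ) R) hδ
    have : ∀ᶠ n in (𝒰 : Filter ℕ), ∀ c ∈ t, ‖f n c - Φ c‖ < ε / 3 := by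
      rw [eventually_all_finite ht]
      intro c _
      have := (Metric.tendsto_nhds.1 (hΦ c)) (ε / 3) (by positivity)
      simpa [dist_eq_norm] using this
    filter_upwards [this] with n hn z hz
    have hz' := hcov (show z ∈ Metric.closedBall (0:ℂ) R by simpa using hz)
    simp only [mem_iUnion, Metric.mem_ball, exists_prop] at hz'
    obtain ⟨c, hc, hzc⟩ := hz'
    have hcR : ‖c‖ ≤ R := by simpa using hts hc
    rw [dist_eq_norm] at hzc
    have a := h (f n) (hf n).wqs (hf n).zero (hf n).one c z hcR hzc.le
    have b := h Φ hN.wqs hN.zero hN.one c z hcR hzc.le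
    have c' := hn c hc
    calc ‖f n z - Φ z‖ = ‖(f n z - f n c) + (f n c - Φ c) - (Φ z - Φ c)‖ := by congr 1; ring
      _ ≤ ‖(f n z - f n c) + (f n c - Φ c)‖ + ‖Φ z - Φ c‖ := norm_sub_le _ _
      _ ≤ ‖f n z - f n c‖ + ‖f n c - Φ c‖ + ‖Φ z - Φ c‖ := by gcongr; exact norm_add_le _ _
      _ < ε := by linarith
  have hsurj : Function.Surjective Φ := by
    intro w
    choose y hy using fun n => hs n w
    obtain ⟨R, hR⟩ := wqs_proper C hC ‖w‖
    have hyR : ∀ n, ‖y n‖ ≤ R := fun n => hR _ (hf n).wqs (hf n).zero (hf n).one _ (by rw [hy])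
    obtain ⟨a, ha⟩ := hlim y ⟨R, hyR⟩
    refine ⟨a, ?_⟩
    have h2 : Tendsto (fun n => Φ (y n)) 𝒰 (𝓝 (Φ a)) := (hcont.tendsto a).comp ha
    refine tendsto_nhds_unique h2 ?_
    rw [Metric.tendsto_nhds]
    intro ε hε
    filter_upwards [hunif R ε hε] with n hn
    have := hn (y n) (hyR n)
    rwa [hy, norm_sub_rev, ← dist_eq_norm] at this
  refine ⟨Φ, hN, ?_, hunif, ?_⟩
  · have hp : IsProperMap Φ := by
      rw [isProperMap_iff_tendsto_cocompact]
      refine ⟨hcont, ?_⟩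
      rw [← Metric.cobounded_eq_cocompact, ← tendsto_norm_atTop_iff_cobounded, tendsto_atTop]
      intro M
      obtain ⟨R, hR⟩ := wqs_proper C hC M
      have : ∀ᶠ z in Bornology.cobounded ℂ, R < ‖z‖ := tendsto_norm_cobounded_atTop.eventually_gt_atTop R
      filter_upwards [this] with z hz
      by_contra! hcon
      exact absurd (hR Φ hN.wqs hN.zero hN.one z hcon.le) (not_le.2 hz)
    rw [isHomeomorph_iff_continuous_isClosedMap_bijective]
    exact ⟨hcont, hp.isClosedMap, hinj, hsurj⟩
  · intro M ε hε
    obtain ⟨R, hR⟩ := wqs_proper C hC M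
    obtain ⟨δ, hδ, h⟩ := wqs_lower C hC.le R ε hε
    filter_upwards [hunif R δ hδ] with n hn x y hx hxy
    by_contra! hcon
    have hxR := hR Φ hN.wqs hN.zero hN.one x hx
    have a := h (f n) (hf n).wqs (hf n).zero (hf n).one x y hxR hcon
    have b := hn x hxR
    rw [hxy, norm_sub_rev] at a
    linarith

end MRM

namespace MRM
open Set Filter Topology ComplexConjugate

noncomputable def la (D : ℂ →L[ℝ] ℂ) : ℂ := (D 1 - Complex.I * D Complex.I) / 2
noncomputable def lb (D : ℂ →L[ℝ] ℂ) : ℂ := (D 1 + Complex.I * D Complex.I) / 2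

lemma clm_apply (D : ℂ →L[ℝ] ℂ) (v : ℂ) : D v = la D * v + lb D * conj v := by
  have h : D v = (v.re : ℂ) * D 1 + v.im * D Complex.I := by
    have : v = v.re • (1 : ℂ) + v.im • Complex.I := by simp
    conv_lhs => rw [this, map_add, map_smul, map_smul]
    simp only [Complex.real_smul]
  have h2 : conj v = v.re - v.im * Complex.I := by
    apply Complex.ext <;> simp
  have h3 : v = v.re + v.im * Complex.I := (Complex.re_add_im v).symm
  rw [h, h2, la, lb]
  conv_rhs => enter [1, 2]; rw [h3]
  have := Complex.I_sq
  linear_combination (v.im * D Complex.I) * this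

lemma clm_one (D : ℂ →L[ℝ] ℂ) : D 1 = la D + lb D := by simp [clm_apply D 1]
lemma clm_I (D : ℂ →L[ℝ] ℂ) : D Complex.I = Complex.I * (la D - lb D) := by
  rw [clm_apply D Complex.I, Complex.conj_I]; ring

lemma clm_det (D : ℂ →L[ℝ] ℂ) : D.det = ‖la D‖ ^ 2 - ‖lb D‖ ^ 2 := by
  rw [ContinuousLinearMap.det, ← LinearMap.det_toMatrix Complex.basisOneI, Matrix.det_fin_two]
  simp only [LinearMap.toMatrix_apply, Complex.coe_basisOneI, Complex.coe_basisOneI_repr]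
  simp only [Matrix.cons_val_zero, Matrix.cons_val_one, ContinuousLinearMap.coe_coe]
  rw [clm_one, clm_I, ← Complex.normSq_eq_norm_sq, ← Complex.normSq_eq_norm_sq]
  simp [Complex.normSq_apply]
  ring

lemma clm_norm_le (D : ℂ →L[ℝ] ℂ) : ‖D‖ ≤ ‖la D‖ + ‖lb D‖ := by
  refine ContinuousLinearMap.opNorm_le_bound _ (by positivity) (fun v => ?_)
  rw [clm_apply]
  refine (norm_add_le _ _).trans ?_
  rw [norm_mul, norm_mul, RCLike.norm_conj]
  exact le_of_eq (by ring)

lemma clm_dist {D : ℂ →L[ℝ] ℂ} {k : ℝ} (hk0 : 0 ≤ k) (hk : k < 1) (h : ‖lb D‖ ≤ k * ‖la D‖) :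
    0 ≤ D.det ∧ ‖D‖ ^ 2 ≤ (1 + k) / (1 - k) * D.det ∧ (1 - k ^ 2) * ‖la D‖ ^ 2 ≤ D.det := by
  have h1 := clm_norm_le D
  have h2 : 0 ≤ ‖la D‖ := norm_nonneg _
  have h3 : 0 ≤ ‖lb D‖ := norm_nonneg _
  have h4 : (1 - k ^ 2) * ‖la D‖ ^ 2 ≤ D.det := by
    rw [clm_det]
    have : ‖lb D‖ ^ 2 ≤ (k * ‖la D‖) ^ 2 := by gcongr
    nlinarith
  refine ⟨le_trans (by have : 0 ≤ 1 - k ^ 2 := by nlinarith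
                       positivity) h4, ?_, h4⟩
  rw [div_mul_eq_mul_div, le_div_iff₀ (by linarith)]
  have h5 : ‖D‖ ^ 2 ≤ ((1 + k) * ‖la D‖) ^ 2 := by gcongr; linarith
  have h6 : (1 + k) * ((1 - k ^ 2) * ‖la D‖ ^ 2) ≤ (1 + k) * D.det := by gcongr
  nlinarith

lemma wderiv_eq (f : ℂ → ℂ) (z : ℂ) : wderiv f z = la (fderiv ℝ f z) := rfl
lemma wderivBar_eq (f : ℂ → ℂ) (z : ℂ) : wderivBar f z = lb (fderiv ℝ f z) := rfl

lemma norm_la_le (D : ℂ →L[ℝ] ℂ) : ‖la D‖ ≤ ‖D‖ := by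
  have h1 : ‖D 1‖ ≤ ‖D‖ := by simpa using D.le_opNorm 1
  have h2 : ‖D Complex.I‖ ≤ ‖D‖ := by simpa using D.le_opNorm Complex.I
  rw [la, norm_div, Complex.norm_ofNat, div_le_iff₀ (by norm_num)]
  refine (norm_sub_le _ _).trans ?_
  rw [norm_mul, Complex.norm_I]; linarith

end MRM

namespace MRM
open Set Filter Topology ComplexConjugate

lemma sq_integral_le {g : ℝ → ℝ} (hg : Continuous g) (a b : ℝ) (hab : a < b) :
    (∫ x in a..b, g x) ^ 2 ≤ (b - a) * ∫ x in a..b, g x ^ 2 := by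
  set m := (∫ x in a..b, g x) / (b - a) with hm
  have h0 : 0 ≤ ∫ x in a..b, (g x - m) ^ 2 :=
    intervalIntegral.integral_nonneg hab.le (fun x _ => sq_nonneg _)
  have h1 : ∫ x in a..b, (g x - m) ^ 2 = (∫ x in a..b, g x ^ 2) - 2 * m * (∫ x in a..b, g x) + m ^ 2 * (b - a) := by
    have : ∀ x, (g x - m) ^ 2 = g x ^ 2 - 2 * m * g x + m ^ 2 := fun x => by ring
    simp_rw [this]
    rw [intervalIntegral.integral_add, intervalIntegral.integral_sub, intervalIntegral.integral_const_mul,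
      intervalIntegral.integral_const, smul_eq_mul]
    · ring
    all_goals exact Continuous.intervalIntegrable (by fun_prop) _ _
  rw [h1] at h0
  have hba : 0 < b - a := sub_pos.2 hab
  have hm' : (∫ x in a..b, g x) = m * (b - a) := by rw [hm]; field_simp
  rw [hm'] at h0 ⊢
  nlinarith

lemma circle_osc {U : ℂ → ℝ} (hU : ContDiff ℝ 1 U) (p : ℂ) {t : ℝ} (ht : 0 < t) {z w : ℂ}
    (hz : ‖z - p‖ = t) (hw : ‖w - p‖ = t) {D : ℝ} (hD0 : 0 ≤ D) (hD : D ≤ U z - U w) :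
    D ^ 2 / t ≤ 2 * Real.pi * (t * ∫ θ in (-Real.pi)..Real.pi,
      ‖fderiv ℝ U (p + t * Complex.exp (θ * Complex.I))‖ ^ 2) := by
  set γ : ℝ → ℂ := fun θ => p + t * Complex.exp (θ * Complex.I) with hγ
  have hγd : ∀ θ : ℝ, HasDerivAt γ (t * (Complex.exp (θ * Complex.I) * Complex.I)) θ := by
    intro θ
    have h1 : HasDerivAt (fun θ : ℝ => (θ : ℂ) * Complex.I) Complex.I θ := by
      simpa using (Complex.ofRealCLM.hasDerivAt (x := θ)).mul_const (Complex.I)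
    exact (h1.cexp.const_mul (t : ℂ)).const_add p
  have hγc : Continuous γ := by fun_prop
  have hsurj : ∀ z : ℂ, ‖z - p‖ = t → ∃ θ ∈ Icc (-Real.pi) Real.pi, γ θ = z := by
    intro z hz
    refine ⟨(z - p).arg, ⟨(Complex.neg_pi_lt_arg _).le, Complex.arg_le_pi _⟩, ?_⟩
    have := Complex.norm_mul_exp_arg_mul_I (z - p)
    rw [hz] at this
    simp only [hγ, this]; ring
  obtain ⟨a, ha, rfl⟩ := hsurj z hz
  obtain ⟨b, hb, rfl⟩ := hsurj w hw
  have hfc : Continuous (fderiv ℝ U) := hU.continuous_fderiv one_ne_zero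
  set g : ℝ → ℝ := fun θ => ‖fderiv ℝ U (γ θ)‖ with hg
  have hgc : Continuous g := by fun_prop
  have hder : ∀ θ : ℝ, HasDerivAt (fun θ => U (γ θ)) (fderiv ℝ U (γ θ) (t * (Complex.exp (θ * Complex.I) * Complex.I))) θ := by
    intro θ
    exact ((hU.differentiable one_ne_zero).differentiableAt.hasFDerivAt).comp_hasDerivAt θ (hγd θ)
  have hftc : ∫ θ in b..a, fderiv ℝ U (γ θ) (t * (Complex.exp (θ * Complex.I) * Complex.I)) = U (γ a) - U (γ b) := by
    refine intervalIntegral.integral_eq_sub_of_hasDerivAt (fun θ _ => hder θ) ?_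
    apply Continuous.intervalIntegrable
    exact (hfc.comp hγc).clm_apply (by fun_prop)
  have hpi := Real.pi_pos
  have hbound : U (γ a) - U (γ b) ≤ t * ∫ θ in (-Real.pi)..Real.pi, g θ := by
    rw [← hftc]
    refine (le_abs_self _).trans ?_
    rw [← Real.norm_eq_abs]
    refine (intervalIntegral.norm_integral_le_integral_norm_uIoc).trans ?_
    rw [← intervalIntegral.integral_const_mul, intervalIntegral.integral_of_le (by linarith)]
    have hsub : uIoc b a ⊆ Ioc (-Real.pi) Real.pi := by
      rw [uIoc]
      exact Ioc_subset_Ioc (le_min hb.1 ha.1) (max_le hb.2 ha.2)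
    have hint : IntegrableOn (fun θ => t * g θ) (Ioc (-Real.pi) Real.pi) :=
      ((continuous_const.mul hgc).integrableOn_Icc).mono_set Ioc_subset_Icc_self
    calc _ ≤ ∫ θ in uIoc b a, t * g θ := by
          refine setIntegral_mono_on ?_ (hint.mono_set hsub) measurableSet_uIoc (fun θ _ => ?_)
          · have : Continuous fun θ : ℝ => ‖fderiv ℝ U (γ θ) (t * (Complex.exp (θ * Complex.I) * Complex.I))‖ :=
              ((hfc.comp hγc).clm_apply (by fun_prop)).norm
            exact (this.integrableOn_Icc (a := -Real.pi) (b := Real.pi)).mono_set (hsub.trans Ioc_subset_Icc_self)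
          · refine (ContinuousLinearMap.le_opNorm _ _).trans ?_
            rw [norm_mul, norm_mul, Complex.norm_exp_ofReal_mul_I, Complex.norm_I, Complex.norm_real,
              Real.norm_of_nonneg ht.le]
            simp only [hg]
            exact le_of_eq (by ring)
      _ ≤ _ := by
          refine setIntegral_mono_set hint ?_ hsub.eventuallyLE
          exact Eventually.of_forall (fun θ => by positivity)
  have hsq := sq_integral_le hgc (-Real.pi) Real.pi (by linarith)
  have h1 : D ^ 2 ≤ (t * ∫ θ in (-Real.pi)..Real.pi, g θ) ^ 2 := by gcongr; linarith
  rw [div_le_iff₀ ht]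
  calc D ^ 2 ≤ t ^ 2 * (∫ θ in (-Real.pi)..Real.pi, g θ) ^ 2 := by rw [← mul_pow]; exact h1
    _ ≤ t ^ 2 * ((Real.pi - -Real.pi) * ∫ θ in (-Real.pi)..Real.pi, g θ ^ 2) := by gcongr
    _ = _ := by ring

lemma length_area {U : ℂ → ℝ} (hU : ContDiff ℝ 1 U) (p : ℂ) {t₁ t₂ : ℝ} (h1 : 0 < t₁) (h2 : t₁ < t₂)
    {D : ℝ} (hD0 : 0 ≤ D)
    (h : ∀ t ∈ Ioc t₁ t₂, ∃ z w : ℂ, ‖z - p‖ = t ∧ ‖w - p‖ = t ∧ D ≤ U z - U w) :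
    ENNReal.ofReal (D ^ 2 * Real.log (t₂ / t₁)) ≤
      ENNReal.ofReal (2 * Real.pi) * ∫⁻ z, ENNReal.ofReal (‖fderiv ℝ U z‖ ^ 2) := by
  have hfc : Continuous (fderiv ℝ U) := hU.continuous_fderiv one_ne_zero
  have e1 : ENNReal.ofReal (D ^ 2 * Real.log (t₂ / t₁)) = ∫⁻ t in Ioc t₁ t₂, ENNReal.ofReal (D ^ 2 / t) := by
    rw [← integral_one_div_of_pos h1 (h1.trans h2), ← intervalIntegral.integral_const_mul,
      intervalIntegral.integral_of_le h2.le]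
    rw [ofReal_integral_eq_lintegral_ofReal]
    · simp only [mul_one_div]
    · refine IntegrableOn.mono_set (t := Icc t₁ t₂) ?_ Ioc_subset_Icc_self
      refine ContinuousOn.integrableOn_Icc ?_
      refine continuousOn_const.mul (continuousOn_const.div continuousOn_id (fun x hx => ?_))
      exact (h1.trans_le hx.1).ne'
    · filter_upwards [ae_restrict_mem measurableSet_Ioc] with t ht
      have : 0 < t := h1.trans ht.1
      positivity
  rw [e1]
  have e2 : ∫⁻ z, ENNReal.ofReal (‖fderiv ℝ U z‖ ^ 2) = ∫⁻ z, ENNReal.ofReal (‖fderiv ℝ U (p + z)‖ ^ 2) :=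
    (lintegral_add_left_eq_self (fun z => ENNReal.ofReal (‖fderiv ℝ U z‖ ^ 2)) p).symm
  rw [e2, ← Complex.lintegral_comp_polarCoord_symm]
  have e3 : polarCoord.target = Ioi (0:ℝ) ×ˢ Ioo (-Real.pi) Real.pi := rfl
  rw [e3, Measure.volume_eq_prod, ← Measure.prod_restrict, lintegral_prod]
  swap
  · apply Measurable.aemeasurable
    simp only [Complex.polarCoord_symm_apply, smul_eq_mul]
    fun_prop
  have hpi := Real.pi_pos
  rw [← lintegral_const_mul']
  swap
  · exact ENNReal.ofReal_ne_top
  refine le_trans ?_ (lintegral_mono_set (s := Ioc t₁ t₂) (fun t ht => h1.trans ht.1))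
  refine setLIntegral_mono' measurableSet_Ioc (fun t ht => ?_)
  have ht0 : 0 < t := h1.trans ht.1
  obtain ⟨z, w, hz, hw, hzw⟩ := h t ht
  have := circle_osc hU p ht0 hz hw hD0 hzw
  refine (ENNReal.ofReal_le_ofReal this).trans ?_
  rw [ENNReal.ofReal_mul (by positivity), ENNReal.ofReal_mul ht0.le]
  gcongr
  simp only [smul_eq_mul, Complex.polarCoord_symm_apply]
  rw [lintegral_const_mul' _ _ ENNReal.ofReal_ne_top]
  gcongr
  rw [intervalIntegral.integral_of_le (by linarith), integral_Ioc_eq_integral_Ioo]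
  rw [ofReal_integral_eq_lintegral_ofReal]
  · refine le_of_eq ?_
    congr 1
    ext θ
    rw [Complex.exp_mul_I, Complex.ofReal_cos, Complex.ofReal_sin]
  · refine IntegrableOn.mono_set (t := Icc (-Real.pi) Real.pi) ?_ Ioo_subset_Icc_self
    apply Continuous.integrableOn_Icc
    fun_prop
  · exact Eventually.of_forall (fun θ => by positivity)
end MRM

namespace MRM
open Set Filter Topology ComplexConjugate

lemma annulus_preconn (M : ℝ) (hM : 0 < M) : IsPreconnected {w : ℂ | M ≤ ‖w‖} := by
  have : {w : ℂ | M ≤ ‖w‖} = (fun p : ℝ × ℝ => (p.1 : ℂ) * Complex.exp (p.2 * Complex.I)) '' (Ici M ×ˢ univ) := by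
    ext w
    simp only [mem_ofPred_eq, mem_image, mem_prod, mem_Ici, mem_univ, and_true, Prod.exists]
    constructor
    · intro h
      exact ⟨‖w‖, w.arg, h, Complex.norm_mul_exp_arg_mul_I w⟩
    · rintro ⟨a, b, h, rfl⟩
      rw [norm_mul, Complex.norm_exp_ofReal_mul_I, Complex.norm_real, Real.norm_of_nonneg (hM.le.trans h)]
      simpa using h
  rw [this]
  refine IsPreconnected.image (isPreconnected_Ici.prod isPreconnected_univ) _ ?_
  exact Continuous.continuousOn (by fun_prop)

lemma circle_hit {E : Set ℂ} (hE : IsPreconnected E) {a b p : ℂ} (ha : a ∈ E) (hb : b ∈ E) {t : ℝ}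
    (h1 : ‖a - p‖ ≤ t) (h2 : t ≤ ‖b - p‖) : ∃ z ∈ E, ‖z - p‖ = t := by
  have := hE.intermediate_value ha hb (f := fun z => ‖z - p‖) (Continuous.continuousOn (by fun_prop))
  obtain ⟨z, hz, h⟩ := this ⟨h1, h2⟩
  exact ⟨z, hz, h⟩

noncomputable def GG (l M ρ : ℝ) : ℝ := 2 * ρ / (l ^ 2 + ρ ^ 2) - 2 * ρ / (M ^ 2 + ρ ^ 2)

lemma GG_hasDeriv {l M : ℝ} (hl : 0 < l) (hM : 0 < M) (ρ : ℝ) :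
    HasDerivAt (fun ρ => Real.log (l ^ 2 + ρ ^ 2) - Real.log (M ^ 2 + ρ ^ 2)) (GG l M ρ) ρ := by
  have h1 : ∀ a : ℝ, 0 < a → HasDerivAt (fun ρ : ℝ => Real.log (a ^ 2 + ρ ^ 2)) (2 * ρ / (a ^ 2 + ρ ^ 2)) ρ := by
    intro a ha
    have : HasDerivAt (fun ρ : ℝ => a ^ 2 + ρ ^ 2) (2 * ρ) ρ := by
      simpa using (hasDerivAt_pow 2 ρ).const_add (a ^ 2)
    exact this.log (by positivity)
  exact (h1 l hl).sub (h1 M hM)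

lemma GG_eq {l M ρ : ℝ} (hl : 0 < l) (hM : 0 < M) :
    GG l M ρ = ρ * (2 * (M ^ 2 - l ^ 2) / ((l ^ 2 + ρ ^ 2) * (M ^ 2 + ρ ^ 2))) := by
  rw [GG]
  have h1 : l ^ 2 + ρ ^ 2 ≠ 0 := by positivity
  have h2 : M ^ 2 + ρ ^ 2 ≠ 0 := by positivity
  field_simp; ring

lemma GG_nonneg {l M ρ : ℝ} (hl : 0 < l) (hM : l < M) (hρ : 0 ≤ ρ) : 0 ≤ GG l M ρ := by
  rw [GG_eq hl (hl.trans hM)]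
  have : 0 < M ^ 2 - l ^ 2 := by nlinarith
  positivity

lemma GG_mul_le {l M ρ : ℝ} (hl : 0 < l) (hM : l < M) (hρ : 0 ≤ ρ) : ρ * GG l M ρ ≤ 2 := by
  rw [GG, mul_sub]
  have h0 : 0 < M := hl.trans hM
  have h1 : ρ * (2 * ρ / (l ^ 2 + ρ ^ 2)) ≤ 2 := by
    rw [← mul_div_assoc, div_le_iff₀ (by positivity)]
    nlinarith [sq_nonneg l]
  have h2 : 0 ≤ ρ * (2 * ρ / (M ^ 2 + ρ ^ 2)) := by positivity
  linarith

lemma W_mono {l M : ℝ} (hl : 0 < l) (hM : l < M) :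
    MonotoneOn (fun ρ => Real.log (l ^ 2 + ρ ^ 2) - Real.log (M ^ 2 + ρ ^ 2)) (Ici 0) := by
  refine monotoneOn_of_deriv_nonneg (convex_Ici 0) ?_ ?_ ?_
  · exact fun x _ => (GG_hasDeriv hl (hl.trans hM) x).continuousAt.continuousWithinAt
  · exact fun x _ => (GG_hasDeriv hl (hl.trans hM) x).differentiableAt.differentiableWithinAt
  · intro x hx
    rw [interior_Ici] at hx
    rw [(GG_hasDeriv hl (hl.trans hM) x).deriv]
    exact GG_nonneg hl hM (le_of_lt hx)

lemma W_fderiv {l M : ℝ} (hl : 0 < l) (hM : l < M) :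
    ContDiff ℝ 1 (fun w : ℂ => Real.log (l ^ 2 + ‖w‖ ^ 2) - Real.log (M ^ 2 + ‖w‖ ^ 2)) ∧
    ∀ w : ℂ, ‖fderiv ℝ (fun w : ℂ => Real.log (l ^ 2 + ‖w‖ ^ 2) - Real.log (M ^ 2 + ‖w‖ ^ 2)) w‖ ≤ GG l M ‖w‖ := by
  have h0 : 0 < M := hl.trans hM
  have hn : ContDiff ℝ 1 (fun w : ℂ => ‖w‖ ^ 2) := contDiff_norm_sq ℝ
  constructor
  · exact ((contDiff_const.add hn).log (fun w => by positivity)).sub ((contDiff_const.add hn).log (fun w => by positivity))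
  intro w
  have h1 : ∀ a : ℝ, 0 < a → HasFDerivAt (fun w : ℂ => Real.log (a ^ 2 + ‖w‖ ^ 2))
      ((a ^ 2 + ‖w‖ ^ 2)⁻¹ • (2 • innerSL ℝ w)) w := by
    intro a ha
    have : HasFDerivAt (fun w : ℂ => a ^ 2 + ‖w‖ ^ 2) (2 • innerSL ℝ w) w :=
      (hasStrictFDerivAt_norm_sq w).hasFDerivAt.const_add _
    exact this.log (by positivity)
  rw [((h1 l hl).fun_sub (h1 M h0)).fderiv, ← sub_smul, norm_smul]
  have : ‖(2 • innerSL ℝ w : ℂ →L[ℝ] ℝ)‖ ≤ 2 * ‖w‖ := by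
    rw [two_nsmul, two_mul]
    refine (norm_add_le _ _).trans ?_
    rw [innerSL_apply_norm]
  have h2 : 0 ≤ (l ^ 2 + ‖w‖ ^ 2)⁻¹ - (M ^ 2 + ‖w‖ ^ 2)⁻¹ := by
    rw [sub_nonneg]; gcongr
  rw [Real.norm_of_nonneg h2]
  calc _ ≤ ((l ^ 2 + ‖w‖ ^ 2)⁻¹ - (M ^ 2 + ‖w‖ ^ 2)⁻¹) * (2 * ‖w‖) := by gcongr
    _ = _ := by rw [GG]; ring

lemma GG_energy {l M : ℝ} (hl : 0 < l) (hM : l < M) :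
    ∫⁻ w : ℂ, ENNReal.ofReal (GG l M ‖w‖ ^ 2) ≤ ENNReal.ofReal (8 * Real.pi * Real.log (M / l)) := by
  have h0 : 0 < M := hl.trans hM
  have hpi := Real.pi_pos
  have hGc : Continuous (GG l M) := by
    have : GG l M = fun ρ => ρ * (2 * (M ^ 2 - l ^ 2) / ((l ^ 2 + ρ ^ 2) * (M ^ 2 + ρ ^ 2))) := by
      ext ρ; exact GG_eq hl h0
    rw [this]
    exact continuous_id.mul (continuous_const.div (by fun_prop) (fun ρ => by positivity))
  have hlim : Tendsto (fun ρ => Real.log (l ^ 2 + ρ ^ 2) - Real.log (M ^ 2 + ρ ^ 2)) atTop (𝓝 0) := by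
    have h1 : ∀ a : ℝ, Tendsto (fun ρ : ℝ => a ^ 2 * (ρ ^ 2)⁻¹ + 1) atTop (𝓝 (a ^ 2 * 0 + 1)) := fun a =>
      ((tendsto_inv_atTop_zero.comp (tendsto_pow_atTop two_ne_zero)).const_mul _).add_const _
    have h2 : ∀ a : ℝ, Tendsto (fun ρ : ℝ => Real.log (a ^ 2 * (ρ ^ 2)⁻¹ + 1)) atTop (𝓝 0) := fun a => by
      have := (h1 a).log (by norm_num)
      simpa using this
    have h3 := (h2 l).sub (h2 M)
    rw [sub_zero] at h3
    refine h3.congr' ?_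
    filter_upwards [eventually_gt_atTop 0] with ρ hρ
    have e : ∀ a : ℝ, Real.log (a ^ 2 + ρ ^ 2) = Real.log (a ^ 2 * (ρ ^ 2)⁻¹ + 1) + Real.log (ρ ^ 2) := by
      intro a
      rw [← Real.log_mul (by positivity) (by positivity)]
      congr 1; field_simp
    rw [e, e]; ring
  have hint : IntegrableOn (GG l M) (Ioi 0) :=
    integrableOn_Ioi_deriv_of_nonneg' (fun x _ => GG_hasDeriv hl h0 x) (fun x hx => GG_nonneg hl hM (le_of_lt hx)) hlim
  have hval := integral_Ioi_of_hasDerivAt_of_nonneg' (fun x _ => GG_hasDeriv hl h0 x)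
    (fun x hx => GG_nonneg hl hM (le_of_lt hx)) hlim
  have hval2 : ∫ x in Ioi 0, GG l M x = 2 * Real.log (M / l) := by
    rw [hval, Real.log_div h0.ne' hl.ne']
    simp [Real.log_pow]; ring
  rw [← Complex.lintegral_comp_polarCoord_symm]
  have e3 : polarCoord.target = Ioi (0:ℝ) ×ˢ Ioo (-Real.pi) Real.pi := rfl
  rw [e3, Measure.volume_eq_prod, ← Measure.prod_restrict, lintegral_prod]
  swap
  · apply Measurable.aemeasurable
    simp only [Complex.polarCoord_symm_apply, smul_eq_mul]
    have := hGc.measurable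
    fun_prop
  calc _ ≤ ∫⁻ t in Ioi (0:ℝ), ∫⁻ θ in Ioo (-Real.pi) Real.pi, ENNReal.ofReal (2 * GG l M t) := by
        refine setLIntegral_mono' measurableSet_Ioi (fun t ht => ?_)
        refine lintegral_mono (fun θ => ?_)
        have ht0 : (0:ℝ) < t := ht
        have : ‖Complex.polarCoord.symm (t, θ)‖ = t := by
          simp [abs_of_pos ht0]
        simp only [this, smul_eq_mul]
        rw [← ENNReal.ofReal_mul ht0.le]
        apply ENNReal.ofReal_le_ofReal
        have h1 := GG_mul_le hl hM ht0.le
        have h2 := GG_nonneg hl hM ht0.le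
        nlinarith
    _ = ∫⁻ t in Ioi (0:ℝ), ENNReal.ofReal (4 * Real.pi * GG l M t) := by
        refine setLIntegral_congr_fun measurableSet_Ioi (fun t ht => ?_)
        simp only [lintegral_const, Measure.restrict_apply MeasurableSet.univ, univ_inter, Real.volume_Ioo]
        rw [← ENNReal.ofReal_mul (by have := GG_nonneg hl hM (le_of_lt ht); positivity)]
        congr 1; ring
    _ = ENNReal.ofReal (∫ t in Ioi (0:ℝ), 4 * Real.pi * GG l M t) := by
        rw [ofReal_integral_eq_lintegral_ofReal (hint.const_mul _)]
        filter_upwards [ae_restrict_mem measurableSet_Ioi] with t ht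
        have := GG_nonneg hl hM (le_of_lt ht)
        simp only [Pi.zero_apply]
        positivity
    _ = _ := by
        rw [integral_const_mul, hval2]; congr 1; ring
    _ ≤ _ := le_rfl

lemma wqs_aux {f : ℂ → ℂ} (hf : ContDiff ℝ 1 f) (hh : IsHomeomorph f) {K : ℝ} (hK : 0 ≤ K)
    (hD : ∀ z, ‖fderiv ℝ f z‖ ^ 2 ≤ K * (fderiv ℝ f z).det) (hd0 : ∀ z, 0 ≤ (fderiv ℝ f z).det)
    (h0 : f 0 = 0) {x y : ℂ} (hxy : ‖x‖ ≤ ‖y‖) (hl : 0 < ‖f y‖) (hM : ‖f y‖ < ‖f x‖) :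
    (Real.log ((‖f y‖ ^ 2 + ‖f x‖ ^ 2) ^ 2 / (4 * ‖f y‖ ^ 2 * ‖f x‖ ^ 2))) ^ 2 * Real.log (100 / 97) ≤
      16 * Real.pi ^ 2 * K * Real.log (‖f x‖ / ‖f y‖) := by
  set l := ‖f y‖ with hl'
  set M := ‖f x‖ with hM'
  have hM0 : 0 < M := hl.trans hM
  have hpi := Real.pi_pos
  obtain ⟨hW, hWd⟩ := W_fderiv hl hM
  set W : ℂ → ℝ := fun w => Real.log (l ^ 2 + ‖w‖ ^ 2) - Real.log (M ^ 2 + ‖w‖ ^ 2) with hWdef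
  have hlog : 0 < Real.log (M / l) := Real.log_pos (by rwa [one_lt_div hl])
  -- energy
  have hen : ∫⁻ z, ENNReal.ofReal (‖fderiv ℝ (W ∘ f) z‖ ^ 2) ≤
      ENNReal.ofReal K * ENNReal.ofReal (8 * Real.pi * Real.log (M / l)) := by
    have hcv := lintegral_image_eq_lintegral_abs_det_fderiv_mul (volume : Measure ℂ) MeasurableSet.univ
      (f := f) (f' := fderiv ℝ f)
      (fun z _ => ((hf.differentiable one_ne_zero) z).hasFDerivAt.hasFDerivWithinAt)
      hh.injective.injOn (fun w => ENNReal.ofReal (GG l M ‖w‖ ^ 2))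
    rw [image_univ, hh.surjective.range_eq] at hcv
    simp only [Measure.restrict_univ] at hcv
    refine le_trans ?_ (mul_le_mul_right (GG_energy hl hM) _)
    rw [hcv, ← lintegral_const_mul' _ _ ENNReal.ofReal_ne_top]
    refine lintegral_mono (fun z => ?_)
    rw [← ENNReal.ofReal_mul (abs_nonneg _), ← ENNReal.ofReal_mul hK]
    apply ENNReal.ofReal_le_ofReal
    rw [fderiv_comp z ((hW.differentiable one_ne_zero) _) ((hf.differentiable one_ne_zero) z)]
    have h1 := ContinuousLinearMap.opNorm_comp_le (fderiv ℝ W (f z)) (fderiv ℝ f z)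
    have h2 := hWd (f z)
    calc _ ≤ (‖fderiv ℝ W (f z)‖ * ‖fderiv ℝ f z‖) ^ 2 := by gcongr
      _ ≤ (GG l M ‖f z‖ * ‖fderiv ℝ f z‖) ^ 2 := by gcongr
      _ = GG l M ‖f z‖ ^ 2 * ‖fderiv ℝ f z‖ ^ 2 := by ring
      _ ≤ GG l M ‖f z‖ ^ 2 * (K * (fderiv ℝ f z).det) := by gcongr; exact hD z
      _ = _ := by rw [abs_of_nonneg (hd0 z)]; ring
  set D := Real.log ((l ^ 2 + M ^ 2) ^ 2 / (4 * l ^ 2 * M ^ 2)) with hDdef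
  have hD0 : 0 ≤ D := by
    apply Real.log_nonneg
    rw [one_le_div (by positivity)]
    nlinarith [sq_nonneg (l ^ 2 - M ^ 2)]
  have hDle : ∀ z w, M ≤ ‖f z‖ → ‖f w‖ ≤ l → D ≤ W (f z) - W (f w) := by
    intro z w hz hw
    have m1 := W_mono hl hM (mem_Ici.2 hM0.le) (mem_Ici.2 (norm_nonneg (f z))) hz
    have m2 := W_mono hl hM (mem_Ici.2 (norm_nonneg (f w))) (mem_Ici.2 hl.le) hw
    simp only at m1 m2
    have : D = (Real.log (l ^ 2 + M ^ 2) - Real.log (M ^ 2 + M ^ 2)) -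
        (Real.log (l ^ 2 + l ^ 2) - Real.log (M ^ 2 + l ^ 2)) := by
      rw [hDdef, ← two_mul, ← two_mul, Real.log_div (by positivity) (by positivity), Real.log_pow,
        Real.log_mul (by positivity) (by positivity), Real.log_mul (by positivity) (by positivity),
        Real.log_mul (by positivity) (by positivity), Real.log_mul (by positivity) (by positivity), add_comm (M ^ 2) (l ^ 2)]
      have : Real.log 4 = 2 * Real.log 2 := by
        rw [show (4:ℝ) = 2 ^ 2 by norm_num, Real.log_pow]; norm_num
      rw [this]; push_cast; ring
    rw [this, hWdef]; simp only; linarith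
  -- connected sets
  have hEc : IsPreconnected (f ⁻¹' (Metric.closedBall 0 l)) := by
    have := (convex_closedBall (0:ℂ) l).isPreconnected
    rw [← (hh.homeomorph f).isPreconnected_preimage] at this
    exact this
  have hFc : IsPreconnected (f ⁻¹' {w | M ≤ ‖w‖}) := by
    have := annulus_preconn M hM0
    rw [← (hh.homeomorph f).isPreconnected_preimage] at this
    exact this
  have hFu : ∀ p : ℂ, ∀ t, ∃ z ∈ f ⁻¹' {w | M ≤ ‖w‖}, t ≤ ‖z - p‖ := by
    intro p t
    obtain ⟨B, hB⟩ := ((isCompact_closedBall p t).image hf.continuous).isBounded.exists_norm_le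
    obtain ⟨z, hz⟩ := hh.surjective ((max B M + 1 : ℝ) : ℂ)
    have hn : ‖f z‖ = max B M + 1 := by
      rw [hz, Complex.norm_real, Real.norm_of_nonneg]
      have := le_max_right B M; linarith
    refine ⟨z, ?_, ?_⟩
    · simp only [mem_preimage, mem_ofPred_eq, hn]
      have := le_max_right B M; linarith
    · by_contra hc
      push Not at hc
      have := hB (f z) ⟨z, by simpa [dist_eq_norm] using hc.le, rfl⟩
      rw [hn] at this
      have := le_max_left B M; linarith
  have h0E : (0:ℂ) ∈ f ⁻¹' (Metric.closedBall 0 l) := by simp [h0, hl.le]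
  have hyE : y ∈ f ⁻¹' (Metric.closedBall 0 l) := by simp [hl']
  have hxF : x ∈ f ⁻¹' {w | M ≤ ‖w‖} := by simp [hM']
  have hy0 : 0 < ‖y‖ := by
    rw [norm_pos_iff]; rintro rfl; rw [hl', h0] at hl; simp at hl
  have main : ∀ (p : ℂ) (t₁ t₂ : ℝ), 0 < t₁ → t₁ < t₂ → (100/97 : ℝ) ≤ t₂ / t₁ →
      (∀ t ∈ Ioc t₁ t₂, (∃ z ∈ f ⁻¹' (Metric.closedBall 0 l), ‖z - p‖ = t)) → ‖x - p‖ ≤ t₁ →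
      D ^ 2 * Real.log (100 / 97) ≤ 16 * Real.pi ^ 2 * K * Real.log (M / l) := by
    intro p t₁ t₂ ht1 ht2 hq hE hx
    have hla := length_area (U := W ∘ f) (hW.comp hf) p ht1 ht2 hD0 (by
      intro t ht
      obtain ⟨w, hw, hwt⟩ := hE t ht
      obtain ⟨b, hb, hbt⟩ := hFu p t
      obtain ⟨z, hz, hzt⟩ := circle_hit hFc hxF hb (hx.trans ht.1.le) hbt
      exact ⟨z, w, hzt, hwt, hDle z w hz (by simpa using hw)⟩)
    have h3 := hla.trans (mul_le_mul_right hen _)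
    rw [← ENNReal.ofReal_mul hK, ← ENNReal.ofReal_mul (by positivity), ENNReal.ofReal_le_ofReal_iff (by positivity)] at h3
    have h4 : Real.log (100 / 97) ≤ Real.log (t₂ / t₁) := Real.log_le_log (by norm_num) hq
    calc _ ≤ D ^ 2 * Real.log (t₂ / t₁) := by gcongr
      _ ≤ _ := h3
      _ = _ := by ring
  rcases le_or_gt ‖x - y‖ (‖y‖ / 2) with hc | hc
  · refine main y (‖y‖ / 2) ‖y‖ (by positivity) (by linarith) ?_ ?_ hc
    · rw [le_div_iff₀ (by positivity)]; linarith
    · intro t ht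
      exact circle_hit hEc hyE h0E (by simp; linarith [ht.1]) (by simpa using ht.2)
  · refine main (-y) (1.94 * ‖y‖) (2 * ‖y‖) (by positivity) (by linarith) ?_ ?_ ?_
    · rw [le_div_iff₀ (by positivity)]; linarith
    · intro t ht
      refine circle_hit hEc h0E hyE (by simp; linarith [ht.1]) ?_
      rw [sub_neg_eq_add, ← two_mul, norm_mul]; simpa using ht.2
    · rw [sub_neg_eq_add]
      have hp := parallelogram_law_with_norm ℝ x y
      refine abs_le_of_sq_le_sq' ?_ (by positivity) |>.2
      nlinarith [norm_nonneg x, norm_nonneg (x - y)]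

theorem exists_wqs (K : ℝ) (hK : 0 ≤ K) : ∃ C : ℝ, 0 < C ∧ ∀ f : ℂ → ℂ, ContDiff ℝ 1 f → IsHomeomorph f →
    (∀ z, ‖fderiv ℝ f z‖ ^ 2 ≤ K * (fderiv ℝ f z).det) → (∀ z, 0 ≤ (fderiv ℝ f z).det) → WQS C f := by
  set A := max (Real.log 4) (16 * Real.pi ^ 2 * K / Real.log (100 / 97)) with hA
  have hL : 0 < Real.log (100 / 97) := Real.log_pos (by norm_num)
  refine ⟨Real.exp A, Real.exp_pos _, ?_⟩
  intro f hf hh hD hd c x y hxy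
  have hA0 : 0 ≤ A := le_trans (Real.log_nonneg (by norm_num)) (le_max_left _ _)
  rcases le_or_gt ‖f x - f c‖ ‖f y - f c‖ with hle | hlt
  · refine hle.trans (le_mul_of_one_le_left (norm_nonneg _) (Real.one_le_exp hA0))
  rcases eq_or_lt_of_le (norm_nonneg (f y - f c)) with h0 | hpos
  · have : y = c := hh.injective (by rw [← sub_eq_zero, ← norm_eq_zero]; exact h0.symm)
    subst this
    simp only [sub_self, norm_zero, norm_le_zero_iff, sub_eq_zero] at hxy
    subst hxy; simp
  have hfd : ∀ z, fderiv ℝ (fun z => f (z + c) - f c) z = fderiv ℝ f (z + c) := by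
    intro z
    rw [fderiv_sub_const, fderiv_comp_add_right]
  have key := wqs_aux (f := fun z => f (z + c) - f c) (by fun_prop)
    ((Homeomorph.subRight (f c)).isHomeomorph.comp (hh.comp (Homeomorph.addRight c).isHomeomorph)) hK
    (fun z => by rw [hfd]; exact hD _) (fun z => by rw [hfd]; exact hd _) (by simp) (x := x - c) (y := y - c)
    hxy (by simpa using hpos) (by simpa using hlt)
  simp only [sub_add_cancel] at key
  set l := ‖f y - f c‖
  set M := ‖f x - f c‖
  have hM0 : 0 < M := hpos.trans hlt
  suffices h : Real.log (M / l) ≤ A by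
    rw [Real.log_le_iff_le_exp (by positivity), div_le_iff₀ hpos] at h
    exact h
  by_contra hc
  push Not at hc
  have hX4 : Real.log 4 < Real.log (M / l) := (le_max_left _ _).trans_lt hc
  have hX5 : 16 * Real.pi ^ 2 * K / Real.log (100 / 97) < Real.log (M / l) := (le_max_right _ _).trans_lt hc
  rw [div_lt_iff₀ hL] at hX5
  have hX0 : 0 < Real.log (M / l) := hA0.trans_lt hc
  have hDX : Real.log (M / l) ≤ Real.log ((l ^ 2 + M ^ 2) ^ 2 / (4 * l ^ 2 * M ^ 2)) := by
    have e1 : Real.log (M ^ 2 / (4 * l ^ 2)) = 2 * Real.log (M / l) - Real.log 4 := by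
      rw [Real.log_div (by positivity) (by positivity), Real.log_div (by positivity) (by positivity),
        Real.log_mul (by positivity) (by positivity), Real.log_pow, Real.log_pow]; push_cast; ring
    have e2 : Real.log (M ^ 2 / (4 * l ^ 2)) ≤ Real.log ((l ^ 2 + M ^ 2) ^ 2 / (4 * l ^ 2 * M ^ 2)) := by
      apply Real.log_le_log (by positivity)
      rw [div_le_div_iff₀ (by positivity) (by positivity)]
      have : 0 ≤ l ^ 2 * (l ^ 2 * (l ^ 2 + 2 * M ^ 2)) := by positivity
      nlinarith
    linarith
  have : Real.log (M / l) ^ 2 * Real.log (100 / 97) ≤ 16 * Real.pi ^ 2 * K * Real.log (M / l) := by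
    refine le_trans ?_ key
    gcongr
  nlinarith

end MRM

namespace MRM
open Set Filter Topology ComplexConjugate

noncomputable def ee (n : ℤ × ℤ) (z : ℂ) : ℂ := Complex.exp ((((n.1 : ℝ) * z.re + (n.2 : ℝ) * z.im : ℝ) : ℂ) * Complex.I)
noncomputable def wt (n : ℤ × ℤ) : ℝ := |(n.1 : ℝ)| + |(n.2 : ℝ)|

lemma norm_ee (n : ℤ × ℤ) (z : ℂ) : ‖ee n z‖ = 1 := Complex.norm_exp_ofReal_mul_I _

lemma ee_add (m n : ℤ × ℤ) (z : ℂ) : ee (m + n) z = ee m z * ee n z := by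
  rw [ee, ee, ee, ← Complex.exp_add]
  congr 1
  simp only [Prod.fst_add, Prod.snd_add]
  push_cast; ring

lemma ee_conj (n : ℤ × ℤ) (z : ℂ) : conj (ee n z) = ee (-n) z := by
  rw [ee, ee, ← Complex.exp_conj, map_mul, Complex.conj_ofReal, Complex.conj_I]
  congr 1
  simp only [Prod.fst_neg, Prod.snd_neg]
  push_cast; ring

lemma wt_nonneg (n : ℤ × ℤ) : 0 ≤ wt n := by unfold wt; positivity
lemma wt_add (m n : ℤ × ℤ) : wt (m + n) ≤ wt m + wt n := by
  unfold wt
  simp only [Prod.fst_add, Prod.snd_add, Int.cast_add]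
  have h1 := abs_add_le (m.1:ℝ) n.1
  have h2 := abs_add_le (m.2:ℝ) n.2
  linarith
lemma wt_neg (n : ℤ × ℤ) : wt (-n) = wt n := by simp [wt]

/-- exponentially decaying coefficients -/
def Dec (a : ℤ × ℤ → ℂ) : Prop := ∃ C ε : ℝ, 0 < ε ∧ ∀ n, ‖a n‖ ≤ C * Real.exp (-ε * wt n)

noncomputable def PP (a : ℤ × ℤ → ℂ) (z : ℂ) : ℂ := ∑' n, a n * ee n z

lemma summable_exp_wt {ε : ℝ} (hε : 0 < ε) : Summable (fun n : ℤ × ℤ => Real.exp (-ε * wt n)) := by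
  have h1 : Summable (fun n : ℤ => Real.exp (-ε * |(n:ℝ)|)) := by
    have h0 : Summable (fun n : ℕ => Real.exp (-ε * n)) := by
      have := Real.summable_exp_nat_mul_iff.2 (neg_lt_zero.2 hε)
      refine this.congr (fun n => ?_)
      rw [mul_comm]
    apply Summable.of_nat_of_neg
    · refine h0.congr (fun n => ?_); simp
    · refine h0.congr (fun n => ?_); simp
  have := h1.mul_of_nonneg h1 (fun n => (Real.exp_pos _).le) (fun n => (Real.exp_pos _).le)
  refine this.congr (fun n => ?_)
  rw [← Real.exp_add]; congr 1; unfold wt; ring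

lemma Dec.summable {a : ℤ × ℤ → ℂ} (h : Dec a) : Summable (fun n => ‖a n‖) := by
  obtain ⟨C, ε, hε, h⟩ := h
  exact Summable.of_nonneg_of_le (fun n => norm_nonneg _) h ((summable_exp_wt hε).mul_left C)

lemma Dec.summable_ee {a : ℤ × ℤ → ℂ} (h : Dec a) (z : ℂ) : Summable (fun n => a n * ee n z) := by
  apply Summable.of_norm
  refine h.summable.congr (fun n => ?_)
  rw [norm_mul, norm_ee, mul_one]

lemma Dec.mul {a : ℤ × ℤ → ℂ} (h : Dec a) (m : ℤ × ℤ → ℂ) (A : ℝ) (hm : ∀ n, ‖m n‖ ≤ A * (1 + wt n)) :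
    Dec (fun n => m n * a n) := by
  obtain ⟨C, ε, hε, h⟩ := h
  have hA : 0 ≤ A := by
    have := (norm_nonneg _).trans (hm 0); simpa [wt] using this
  have hC : 0 ≤ C := by
    have := (norm_nonneg _).trans (h 0); simpa [wt] using this
  refine ⟨A * (1 + 2 / ε) * C, ε / 2, by positivity, fun n => ?_⟩
  have h1 : 1 + wt n ≤ (1 + 2 / ε) * Real.exp (ε / 2 * wt n) := by
    have h2 := Real.add_one_le_exp (ε / 2 * wt n)
    have h3 : 1 ≤ Real.exp (ε / 2 * wt n) := Real.one_le_exp (by have := wt_nonneg n; positivity)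
    have h4 : wt n = 2 / ε * (ε / 2 * wt n) := by field_simp
    have h5 : 2 / ε * (ε / 2 * wt n) ≤ 2 / ε * Real.exp (ε / 2 * wt n) := by gcongr; linarith
    linarith
  rw [norm_mul]
  calc _ ≤ (A * (1 + wt n)) * (C * Real.exp (-ε * wt n)) := by
        have := wt_nonneg n
        gcongr
        · exact hm n
        · exact h n
    _ ≤ (A * ((1 + 2 / ε) * Real.exp (ε / 2 * wt n))) * (C * Real.exp (-ε * wt n)) := by gcongr
    _ = A * (1 + 2 / ε) * C * (Real.exp (ε / 2 * wt n) * Real.exp (-ε * wt n)) := by ring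
    _ = _ := by rw [← Real.exp_add]; congr 2; ring

noncomputable def dx (a : ℤ × ℤ → ℂ) : ℤ × ℤ → ℂ := fun n => (Complex.I * n.1) * a n
noncomputable def dy (a : ℤ × ℤ → ℂ) : ℤ × ℤ → ℂ := fun n => (Complex.I * n.2) * a n

lemma Dec.dx {a : ℤ × ℤ → ℂ} (h : Dec a) : Dec (dx a) := by
  refine h.mul _ 1 (fun n => ?_)
  rw [norm_mul, Complex.norm_I, Complex.norm_intCast]
  have : 0 ≤ |(n.2:ℝ)| := abs_nonneg _
  unfold wt; linarith
lemma Dec.dy {a : ℤ × ℤ → ℂ} (h : Dec a) : Dec (dy a) := by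
  refine h.mul _ 1 (fun n => ?_)
  rw [norm_mul, Complex.norm_I, Complex.norm_intCast]
  have : 0 ≤ |(n.1:ℝ)| := abs_nonneg _
  unfold wt; linarith

lemma ee_hasFDeriv (n : ℤ × ℤ) (z : ℂ) : HasFDerivAt (ee n)
    (Complex.reCLM.smulRight ((Complex.I * n.1) * ee n z) + Complex.imCLM.smulRight ((Complex.I * n.2) * ee n z)) z := by
  have h1 : HasFDerivAt (fun z : ℂ => (n.1 : ℝ) * z.re + (n.2 : ℝ) * z.im)
      ((n.1 : ℝ) • Complex.reCLM + (n.2 : ℝ) • Complex.imCLM) z :=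
    (Complex.reCLM.hasFDerivAt.const_mul _).add (Complex.imCLM.hasFDerivAt.const_mul _)
  have h2 : HasFDerivAt (fun z : ℂ => (((n.1 : ℝ) * z.re + (n.2 : ℝ) * z.im : ℝ) : ℂ) * Complex.I) _ z :=
    (Complex.ofRealCLM.hasFDerivAt.comp z h1).mul_const (Complex.I)
  have h3 := h2.cexp
  refine h3.congr_fderiv ?_
  ext <;> simp [ee] <;> ring

lemma PP_hasFDeriv {a : ℤ × ℤ → ℂ} (h : Dec a) (z : ℂ) : HasFDerivAt (PP a)
    (Complex.reCLM.smulRight (PP (dx a) z) + Complex.imCLM.smulRight (PP (dy a) z)) z := by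
  have hs : Summable (fun n => ‖dx a n‖ + ‖dy a n‖) := h.dx.summable.add h.dy.summable
  have key := hasFDerivAt_tsum (𝕜 := ℝ) (f := fun n z => a n * ee n z)
    (f' := fun n z => Complex.reCLM.smulRight (dx a n * ee n z) + Complex.imCLM.smulRight (dy a n * ee n z))
    hs (fun n z => ?_) (fun n z => ?_) (h.summable_ee 0) z
  · refine key.congr_fderiv ?_
    have hs1 : Summable (fun n => Complex.reCLM.smulRight (dx a n * ee n z) + Complex.imCLM.smulRight (dy a n * ee n z)) := by
      refine Summable.of_norm_bounded hs (fun n => ?_)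
      refine (norm_add_le _ _).trans ?_
      rw [ContinuousLinearMap.norm_smulRight_apply, ContinuousLinearMap.norm_smulRight_apply, Complex.reCLM_norm, Complex.imCLM_norm]
      simp [norm_ee]
    refine ContinuousLinearMap.ext (fun v => ?_)
    have := (ContinuousLinearMap.apply ℝ ℂ v).map_tsum hs1
    simp only [ContinuousLinearMap.apply_apply] at this
    rw [this]
    simp only [_root_.add_apply, ContinuousLinearMap.smulRight_apply]
    rw [Summable.tsum_add ((h.dx.summable_ee z).const_smul _) ((h.dy.summable_ee z).const_smul _), (h.dx.summable_ee z).tsum_const_smul, (h.dy.summable_ee z).tsum_const_smul]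
    rfl
  · refine ((ee_hasFDeriv n z).const_mul (a n)).congr_fderiv ?_
    ext <;> simp [dx, dy] <;> ring
  · refine (norm_add_le _ _).trans ?_
    rw [ContinuousLinearMap.norm_smulRight_apply, ContinuousLinearMap.norm_smulRight_apply, Complex.reCLM_norm, Complex.imCLM_norm]
    simp [norm_ee]

lemma PP_contDiff_nat (k : ℕ) : ∀ {a : ℤ × ℤ → ℂ}, Dec a → ContDiff ℝ k (PP a) := by
  induction k with
  | zero =>
    intro a h
    rw [Nat.cast_zero, contDiff_zero]
    exact continuous_iff_continuousAt.2 (fun z => (PP_hasFDeriv h z).continuousAt)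
  | succ k ih =>
    intro a h
    have : ((k + 1 : ℕ) : WithTop ℕ∞) = (k : WithTop ℕ∞) + 1 := by norm_cast
    rw [this, contDiff_succ_iff_fderiv]
    refine ⟨fun z => (PP_hasFDeriv h z).differentiableAt, by simp, ?_⟩
    have e : fderiv ℝ (PP a) = fun z => (Complex.reCLM.smulRight (PP (dx a) z) + Complex.imCLM.smulRight (PP (dy a) z)) := by
      ext1 z; exact (PP_hasFDeriv h z).fderiv
    rw [e]
    have h1 := ih h.dx
    have h2 := ih h.dy
    exact (contDiff_const.smulRight h1).add (contDiff_const.smulRight h2)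

lemma PP_contDiff {a : ℤ × ℤ → ℂ} (h : Dec a) : ContDiff ℝ (⊤ : ℕ∞) (PP a) :=
  contDiff_infty.2 (fun k => PP_contDiff_nat k h)

end MRM

namespace MRM
open Set Filter Topology ComplexConjugate

noncomputable def QI {E : Type*} [NormedAddCommGroup E] [NormedSpace ℝ E] (z₀ : ℂ) (g : ℂ → E) : E :=
  ∫ x in (0:ℝ)..(2 * Real.pi), ∫ y in (0:ℝ)..(2 * Real.pi), g (z₀ + (x + y * Complex.I))

lemma integral_exp_int (n : ℤ) : ∫ x in (0:ℝ)..(2 * Real.pi), Complex.exp ((((n:ℝ) * x : ℝ) : ℂ) * Complex.I) =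
    if n = 0 then ((2 * Real.pi : ℝ) : ℂ) else 0 := by
  split_ifs with h
  · subst h; simp
  · have h1 : (n * Complex.I : ℂ) ≠ 0 := by simp [h]
    have h2 := integral_exp_mul_complex (a := 0) (b := 2 * Real.pi) h1
    have h3 : Complex.exp (n * Complex.I * ((2 * Real.pi : ℝ) : ℂ)) = 1 := by
      rw [Complex.exp_eq_one_iff]
      exact ⟨n, by push_cast; ring⟩
    rw [h3] at h2
    simp only [Complex.ofReal_zero, mul_zero, Complex.exp_zero, sub_self, zero_div] at h2
    rw [← h2]
    congr 1; ext x; congr 1; push_cast; ring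

lemma ee_xy (n : ℤ × ℤ) (x y : ℝ) : ee n (0 + (x + y * Complex.I)) =
    Complex.exp ((((n.1:ℝ) * x : ℝ) : ℂ) * Complex.I) * Complex.exp ((((n.2:ℝ) * y : ℝ) : ℂ) * Complex.I) := by
  rw [ee, ← Complex.exp_add]; congr 1; simp; ring

lemma QI_ee (n : ℤ × ℤ) : QI 0 (ee n) = if n = 0 then (((2 * Real.pi) ^ 2 : ℝ) : ℂ) else 0 := by
  simp only [QI, ee_xy, intervalIntegral.integral_const_mul, intervalIntegral.integral_mul_const, integral_exp_int]
  rcases n with ⟨n1, n2⟩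
  by_cases h1 : n1 = 0 <;> by_cases h2 : n2 = 0 <;> simp [h1, h2, pow_two]

lemma ee_continuous (n : ℤ × ℤ) : Continuous (ee n) := by unfold ee; fun_prop

lemma QI_sum {ι : Type*} {E : Type*} [NormedAddCommGroup E] [NormedSpace ℝ E] (z₀ : ℂ) (s : Finset ι) (g : ι → ℂ → E) (hg : ∀ i, Continuous (g i)) :
    QI z₀ (fun z => ∑ i ∈ s, g i z) = ∑ i ∈ s, QI z₀ (g i) := by
  unfold QI
  rw [← intervalIntegral.integral_finsetSum]
  · congr 1; ext x
    rw [← intervalIntegral.integral_finsetSum]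
    intro i _
    have := hg i
    exact Continuous.intervalIntegrable (by fun_prop) _ _
  · intro i _
    have := hg i
    apply Continuous.intervalIntegrable
    exact intervalIntegral.continuous_parametric_intervalIntegral_of_continuous' (by fun_prop) _ _

lemma QI_const_mul (z₀ : ℂ) (c : ℂ) (g : ℂ → ℂ) : QI z₀ (fun z => c * g z) = c * QI z₀ g := by
  simp [QI, intervalIntegral.integral_const_mul]

lemma QI_ofReal (z₀ : ℂ) (g : ℂ → ℝ) : QI z₀ (fun z => (g z : ℂ)) = ((QI z₀ g : ℝ) : ℂ) := by
  simp [QI, intervalIntegral.integral_ofReal]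

lemma parseval (F : Finset (ℤ × ℤ)) (a : ℤ × ℤ → ℂ) :
    QI 0 (fun z => ‖∑ n ∈ F, a n * ee n z‖ ^ 2) = (2 * Real.pi) ^ 2 * ∑ n ∈ F, ‖a n‖ ^ 2 := by
  rw [← Complex.ofReal_inj, ← QI_ofReal]
  have h1 : ∀ z, ((‖∑ n ∈ F, a n * ee n z‖ ^ 2 : ℝ) : ℂ) = ∑ m ∈ F, ∑ n ∈ F, (a m * conj (a n)) * ee (m - n) z := by
    intro z
    rw [Complex.ofReal_pow, ← Complex.mul_conj', map_sum, Finset.sum_mul_sum]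
    refine Finset.sum_congr rfl (fun m _ => Finset.sum_congr rfl (fun n _ => ?_))
    rw [map_mul, ee_conj, sub_eq_add_neg, ee_add]; ring
  simp_rw [h1]
  rw [QI_sum _ _ _ (fun i => by have := ee_continuous; fun_prop)]
  push_cast
  rw [Finset.mul_sum]
  refine Finset.sum_congr rfl (fun m hm => ?_)
  rw [QI_sum _ _ _ (fun i => by have := ee_continuous; fun_prop), Finset.sum_eq_single m]
  · rw [QI_const_mul, QI_ee]; simp [Complex.mul_conj']; ring
  · intro n _ hn
    rw [QI_const_mul, QI_ee, if_neg (by rwa [sub_eq_zero, eq_comm]), mul_zero]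
  · exact fun h => absurd hm h

lemma QI_mono (z₀ : ℂ) {g h : ℂ → ℝ} (hg : Continuous g) (hh : Continuous h) (hle : ∀ z, g z ≤ h z) : QI z₀ g ≤ QI z₀ h := by
  have hpi := Real.pi_pos
  unfold QI
  refine intervalIntegral.integral_mono_on (by linarith) ?_ ?_ (fun x _ => ?_)
  · apply Continuous.intervalIntegrable
    exact intervalIntegral.continuous_parametric_intervalIntegral_of_continuous' (by fun_prop) _ _
  · apply Continuous.intervalIntegrable
    exact intervalIntegral.continuous_parametric_intervalIntegral_of_continuous' (by fun_prop) _ _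
  refine intervalIntegral.integral_mono_on (by linarith) ?_ ?_ (fun y _ => hle _)
  · exact Continuous.intervalIntegrable (by fun_prop) _ _
  · exact Continuous.intervalIntegrable (by fun_prop) _ _

noncomputable def NN (a : ℤ × ℤ → ℂ) : ENNReal := eLpNorm a 2 Measure.count

lemma NN_sq {a : ℤ × ℤ → ℂ} {F : Finset (ℤ × ℤ)} (h : ∀ n ∉ F, a n = 0) :
    NN a ^ 2 = ENNReal.ofReal (∑ n ∈ F, ‖a n‖ ^ 2) := by
  have := eLpNorm_nnreal_pow_eq_lintegral (f := a) (μ := Measure.count) (p := 2) (by norm_num)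
  simp only [NNReal.coe_ofNat, ENNReal.coe_ofNat] at this
  rw [NN]
  have h2 : ∀ x : ENNReal, x ^ (2:ℝ) = x ^ 2 := fun x => by
    rw [← ENNReal.rpow_natCast]; norm_num
  rw [h2] at this
  rw [this, lintegral_count, tsum_eq_sum (s := F)]
  · rw [ENNReal.ofReal_sum_of_nonneg (fun _ _ => by positivity)]
    refine Finset.sum_congr rfl (fun n _ => ?_)
    rw [h2, ENNReal.ofReal_pow (norm_nonneg _), ofReal_norm]
  · intro n hn
    rw [h n hn]; simp

noncomputable def conv (D : Finset (ℤ × ℤ)) (ν a : ℤ × ℤ → ℂ) : ℤ × ℤ → ℂ := fun n => ∑ d ∈ D, ν d * a (n - d)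

lemma PP_conv (D : Finset (ℤ × ℤ)) (ν : ℤ × ℤ → ℂ) {a : ℤ × ℤ → ℂ} (ha : Summable (fun n => ‖a n‖)) (z : ℂ) :
    PP (conv D ν a) z = (∑ d ∈ D, ν d * ee d z) * PP a z := by
  have hs : Summable (fun n => a n * ee n z) := by
    apply Summable.of_norm
    refine ha.congr (fun n => ?_)
    rw [norm_mul, norm_ee, mul_one]
  have e : ∀ d n, ν d * a (n - d) * ee n z = (ν d * ee d z) * (a (n - d) * ee (n - d) z) := by
    intro d n
    have : ee n z = ee d z * ee (n - d) z := by rw [← ee_add, add_sub_cancel]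
    rw [this]; ring
  have hs2 : ∀ d, Summable (fun n => a (n - d) * ee (n - d) z) := fun d =>
    (Equiv.subRight d).summable_iff.2 hs
  simp only [PP, conv, Finset.sum_mul, e]
  rw [Summable.tsum_finsetSum (fun d _ => (hs2 d).mul_left _)]
  refine Finset.sum_congr rfl (fun d _ => ?_)
  rw [tsum_mul_left]
  congr 1
  exact (Equiv.subRight d).tsum_eq (fun n => a n * ee n z)

lemma conv_support {D : Finset (ℤ × ℤ)} {ν a : ℤ × ℤ → ℂ} (ha : a.support.Finite) : (conv D ν a).support.Finite := by
  refine Set.Finite.subset (Set.Finite.biUnion D.finite_toSet (fun d _ => ha.image (fun n => n + d))) ?_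
  intro n hn
  obtain ⟨d, hd, hne⟩ := Finset.exists_ne_zero_of_sum_ne_zero hn
  simp only [mem_iUnion]
  exact ⟨d, hd, n - d, right_ne_zero_of_mul hne, by simp⟩

lemma PP_finite {a : ℤ × ℤ → ℂ} {F : Finset (ℤ × ℤ)} (h : ∀ n ∉ F, a n = 0) (z : ℂ) : PP a z = ∑ n ∈ F, a n * ee n z :=
  tsum_eq_sum (fun n hn => by rw [h n hn, zero_mul])

lemma conv_bound {D : Finset (ℤ × ℤ)} {ν a : ℤ × ℤ → ℂ} {k : ℝ} (hk0 : 0 ≤ k) (hk : ∀ z, ‖∑ d ∈ D, ν d * ee d z‖ ≤ k)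
    (ha : a.support.Finite) : NN (conv D ν a) ≤ ENNReal.ofReal k * NN a := by
  have h1 : ∀ n ∉ ha.toFinset, a n = 0 := fun n hn => by simpa using hn
  have h2 : ∀ n ∉ (conv_support (D := D) (ν := ν) ha).toFinset, conv D ν a n = 0 := fun n hn => by simpa using hn
  have hee := ee_continuous
  rw [← ENNReal.pow_le_pow_left_iff two_ne_zero, mul_pow, NN_sq h1, NN_sq h2, ← ENNReal.ofReal_pow hk0, ← ENNReal.ofReal_mul (by positivity)]
  apply ENNReal.ofReal_le_ofReal
  have hpi : 0 < (2 * Real.pi) ^ 2 := by have := Real.pi_pos; positivity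
  rw [← mul_le_mul_iff_right₀ hpi, ← parseval, mul_left_comm, ← parseval]
  have : k ^ 2 * QI 0 (fun z => ‖∑ n ∈ ha.toFinset, a n * ee n z‖ ^ 2) = QI 0 (fun z => k ^ 2 * ‖∑ n ∈ ha.toFinset, a n * ee n z‖ ^ 2) := by
    simp [QI, intervalIntegral.integral_const_mul]
  rw [this]
  apply QI_mono
  · fun_prop
  · fun_prop
  intro z
  rw [← PP_finite h1, ← PP_finite h2, PP_conv _ _ (summable_of_finite_support (ha.subset (fun n hn => by simpa using hn))), norm_mul, mul_pow]
  gcongr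
  exact hk z

noncomputable def ss (n : ℤ × ℤ) : ℂ := conj ((n.1 : ℂ) + n.2 * Complex.I) / ((n.1 : ℂ) + n.2 * Complex.I)

lemma norm_ss (n : ℤ × ℤ) : ‖ss n‖ ≤ 1 := by
  rw [ss, norm_div, RCLike.norm_conj]; exact div_self_le_one _

noncomputable def TT (D : Finset (ℤ × ℤ)) (ν a : ℤ × ℤ → ℂ) : ℤ × ℤ → ℂ := conv D ν (fun n => ss n * a n)

lemma TT_support {D : Finset (ℤ × ℤ)} {ν a : ℤ × ℤ → ℂ} (ha : a.support.Finite) : (TT D ν a).support.Finite :=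
  conv_support (ha.subset (fun n hn => right_ne_zero_of_mul hn))

lemma NN_mono_mul {a b : ℤ × ℤ → ℂ} {c : ℝ} (h : ∀ n, ‖a n‖ ≤ c * ‖b n‖) : NN a ≤ ENNReal.ofReal c * NN b :=
  eLpNorm_le_mul_eLpNorm_of_ae_le_mul (Eventually.of_forall h) 2

lemma NN_shift (a : ℤ × ℤ → ℂ) (d : ℤ × ℤ) : NN (fun n => a (n - d)) = NN a := by
  have h : MeasurePreserving (fun n : ℤ × ℤ => n - d) Measure.count Measure.count := measurePreserving_sub_right _ d
  exact eLpNorm_comp_measurePreserving (g := a) (measurable_of_countable a).aestronglyMeasurable h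

lemma TT_bound {D : Finset (ℤ × ℤ)} {ν a : ℤ × ℤ → ℂ} {k ε : ℝ} (hε : 0 ≤ ε) (hk0 : 0 ≤ k) (hk : ∀ z, ‖∑ d ∈ D, ν d * ee d z‖ ≤ k)
    (ha : a.support.Finite) :
    NN (fun n => Real.exp (ε * wt n) * TT D ν a n) ≤
     ENNReal.ofReal (k + ∑ d ∈ D, ‖ν d‖ * (Real.exp (ε * wt d) - 1)) * NN (fun n => Real.exp (ε * wt n) * a n) := by
  set A : ℤ × ℤ → ℂ := fun n => Real.exp (ε * wt n) * a n with hA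
  set R : ℤ × ℤ → ℤ × ℤ → ℂ := fun d n => ν d * (Real.exp (ε * (wt n - wt (n - d))) - 1) * ss (n - d) * A (n - d) with hR
  have e1 : (fun n => (Real.exp (ε * wt n) : ℂ) * TT D ν a n) = conv D ν (fun n => ss n * A n) + ∑ d ∈ D, R d := by
    ext n
    simp only [TT, conv, Pi.add_apply, Finset.sum_apply, Finset.mul_sum, ← Finset.sum_add_distrib]
    refine Finset.sum_congr rfl (fun d _ => ?_)
    have : (Real.exp (ε * wt n) : ℂ) = Real.exp (ε * (wt n - wt (n - d))) * Real.exp (ε * wt (n - d)) := by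
      rw [← Complex.ofReal_mul, ← Real.exp_add]; congr 2; ring
    simp only [hR, hA, this]; ring
  have hAs : A.support.Finite := ha.subset (fun n hn => right_ne_zero_of_mul hn)
  have b1 : NN (conv D ν (fun n => ss n * A n)) ≤ ENNReal.ofReal k * NN A := by
    refine (conv_bound hk0 hk (hAs.subset (fun n hn => right_ne_zero_of_mul hn))).trans ?_
    gcongr
    have := NN_mono_mul (a := fun n => ss n * A n) (b := A) (c := 1) (fun n => by
      rw [norm_mul]; gcongr; exact norm_ss n)
    simpa using this
  have hpos : ∀ d, 0 ≤ Real.exp (ε * wt d) - 1 := fun d => by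
    have : 1 ≤ Real.exp (ε * wt d) := Real.one_le_exp (by have := wt_nonneg d; positivity)
    linarith
  have b2 : ∀ d, NN (R d) ≤ ENNReal.ofReal (‖ν d‖ * (Real.exp (ε * wt d) - 1)) * NN A := by
    intro d
    rw [← NN_shift A d]
    refine NN_mono_mul (fun n => ?_)
    simp only [hR, norm_mul]
    have h1 : ‖(Real.exp (ε * (wt n - wt (n - d))) : ℂ) - 1‖ ≤ Real.exp (ε * wt d) - 1 := by
      rw [← Complex.ofReal_one, ← Complex.ofReal_sub, Complex.norm_real, Real.norm_eq_abs]
      have h2 : wt n - wt (n - d) ≤ wt d := by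
        have := wt_add (n - d) d; rw [sub_add_cancel] at this; linarith
      have h3 : -wt d ≤ wt n - wt (n - d) := by
        have := wt_add n (-d); rw [wt_neg, ← sub_eq_add_neg] at this; linarith
      have h4 : Real.exp (ε * (wt n - wt (n - d))) ≤ Real.exp (ε * wt d) := by gcongr
      have h5 : Real.exp (-(ε * wt d)) ≤ Real.exp (ε * (wt n - wt (n - d))) := by
        apply Real.exp_le_exp.2; nlinarith
      rw [abs_le]
      refine ⟨?_, by linarith⟩
      have h6 := Real.add_one_le_exp (ε * wt d)
      have h7 := Real.add_one_le_exp (-(ε * wt d))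
      linarith
    have h8 := norm_ss (n - d)
    calc ‖ν d‖ * _ * ‖ss (n - d)‖ * ‖A (n - d)‖ ≤ ‖ν d‖ * (Real.exp (ε * wt d) - 1) * 1 * ‖A (n - d)‖ := by
          have := hpos d
          gcongr
      _ = _ := by ring
  have hm : ∀ g : ℤ × ℤ → ℂ, AEStronglyMeasurable g Measure.count := fun g => (measurable_of_countable g).aestronglyMeasurable
  rw [e1, NN]
  refine (eLpNorm_add_le (hm _) (hm _) (by norm_num)).trans ?_
  rw [ENNReal.ofReal_add hk0 (Finset.sum_nonneg (fun d _ => mul_nonneg (norm_nonneg _) (hpos d))), add_mul,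
    ENNReal.ofReal_sum_of_nonneg (fun d _ => mul_nonneg (norm_nonneg _) (hpos d)), Finset.sum_mul]
  refine add_le_add b1 ((eLpNorm_sum_le (fun d _ => hm _) (by norm_num)).trans ?_)
  exact Finset.sum_le_sum (fun d _ => b2 d)

theorem torus_solve {D : Finset (ℤ × ℤ)} {ν : ℤ × ℤ → ℂ} {k : ℝ} (hk0 : 0 ≤ k) (hk1 : k < 1)
    (hk : ∀ z, ‖∑ d ∈ D, ν d * ee d z‖ ≤ k) {r : ℤ × ℤ → ℂ} (hr : r.support.Finite) :
    ∃ τ, Dec τ ∧ ∀ z, PP τ z = (∑ d ∈ D, ν d * ee d z) * PP (fun n => ss n * τ n) z + PP r z := by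
  obtain ⟨ε, hε, hq⟩ : ∃ ε : ℝ, 0 < ε ∧ k + ∑ d ∈ D, ‖ν d‖ * (Real.exp (ε * wt d) - 1) < (1 + k) / 2 := by
    have hc : Continuous (fun ε : ℝ => k + ∑ d ∈ D, ‖ν d‖ * (Real.exp (ε * wt d) - 1)) := by fun_prop
    have h0 : (fun ε : ℝ => k + ∑ d ∈ D, ‖ν d‖ * (Real.exp (ε * wt d) - 1)) 0 < (1 + k) / 2 := by
      simp; linarith
    have := (hc.continuousAt (x := 0)).eventually_lt_const h0
    obtain ⟨ε, h1, h2⟩ := ((this.filter_mono nhdsWithin_le_nhds).and (self_mem_nhdsWithin (s := Ioi (0:ℝ)))).exists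
    exact ⟨ε, h2, h1⟩
  set q := (1 + k) / 2 with hqd
  have hq0 : 0 ≤ q := by positivity
  have hq1 : q < 1 := by rw [hqd]; linarith
  set t : ℕ → ℤ × ℤ → ℂ := fun j => (TT D ν)^[j] r with ht
  have hts : ∀ j, t (j + 1) = TT D ν (t j) := fun j => Function.iterate_succ_apply' _ _ _
  have htf : ∀ j, (t j).support.Finite := by
    intro j; induction j with
    | zero => exact hr
    | succ j ih => rw [hts]; exact TT_support ih
  set R := NN (fun n => Real.exp (ε * wt n) * r n) with hRd
  have hRt : R ≠ ⊤ := by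
    have hfin : (fun n => (Real.exp (ε * wt n) : ℂ) * r n).support.Finite := hr.subset (fun n hn => right_ne_zero_of_mul hn)
    have := NN_sq (a := fun n => (Real.exp (ε * wt n) : ℂ) * r n) (F := hfin.toFinset) (fun n hn => by simpa using hn)
    intro htop
    rw [← hRd, htop] at this
    simp at this
  have hbd : ∀ j, NN (fun n => Real.exp (ε * wt n) * t j n) ≤ ENNReal.ofReal (q ^ j) * R := by
    intro j; induction j with
    | zero => simp [ht, hRd]
    | succ j ih =>
      rw [hts]
      refine (TT_bound hε.le hk0 hk (htf j)).trans ?_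
      rw [pow_succ', ENNReal.ofReal_mul hq0, mul_assoc]
      gcongr
  have hpt : ∀ j n, ‖t j n‖ ≤ q ^ j * (R.toReal * Real.exp (-ε * wt n)) := by
    intro j n
    have h1 := (enorm_le_eLpNorm_count (p := 2) (fun n => (Real.exp (ε * wt n) : ℂ) * t j n) n (by norm_num)).trans (hbd j)
    rw [← ofReal_norm, ← ENNReal.ofReal_toReal hRt, ← ENNReal.ofReal_mul (by positivity), ENNReal.ofReal_le_ofReal_iff (by positivity), norm_mul,
      Complex.norm_real, Real.norm_of_nonneg (Real.exp_pos _).le] at h1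
    have h2 : Real.exp (-ε * wt n) * Real.exp (ε * wt n) = 1 := by rw [← Real.exp_add]; simp
    calc ‖t j n‖ = Real.exp (-ε * wt n) * (Real.exp (ε * wt n) * ‖t j n‖) := by rw [← mul_assoc, h2, one_mul]
      _ ≤ Real.exp (-ε * wt n) * (q ^ j * R.toReal) := by gcongr
      _ = _ := by ring
  have hsum : ∀ n, Summable (fun j => t j n) := fun n =>
    Summable.of_norm_bounded ((summable_geometric_of_lt_one hq0 hq1).mul_right _) (fun j => hpt j n)
  set τ : ℤ × ℤ → ℂ := fun n => ∑' j, t j n with hτ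
  have hdec : Dec τ := by
    refine ⟨(1 - q)⁻¹ * R.toReal, ε, hε, fun n => ?_⟩
    rw [mul_assoc]
    exact tsum_of_norm_bounded ((hasSum_geometric_of_lt_one hq0 hq1).mul_right _) (fun j => hpt j n)
  have hdecs : Dec (fun n => ss n * τ n) := hdec.mul _ 1 (fun n => by
    have := norm_ss n; have := wt_nonneg n; linarith)
  have heq : ∀ n, τ n = conv D ν (fun n => ss n * τ n) n + r n := by
    intro n
    have h1 : τ n = t 0 n + ∑' j, t (j + 1) n := (hsum n).tsum_eq_zero_add
    rw [h1, add_comm]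
    congr 1
    simp only [hts, TT, conv, hτ]
    rw [Summable.tsum_finsetSum (fun d _ => ((hsum (n - d)).mul_left _).mul_left _)]
    simp only [tsum_mul_left]
  refine ⟨τ, hdec, fun z => ?_⟩
  rw [← PP_conv _ _ hdecs.summable]
  unfold PP
  have hrs : Summable (fun n => r n * ee n z) := summable_of_finite_support (hr.subset (fun n hn => left_ne_zero_of_mul hn))
  have hcs : Summable (fun n => conv D ν (fun n => ss n * τ n) n * ee n z) := by
    refine ((hdec.summable_ee z).sub hrs).congr (fun n => ?_)
    rw [heq n]; ring
  rw [← hcs.tsum_add hrs]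
  refine tsum_congr (fun n => ?_)
  rw [heq n]; ring

end MRM

namespace MRM
open Set Filter Topology ComplexConjugate

def TrigPoly (N : ℂ → ℂ) : Prop := ∃ a : ℤ × ℤ → ℂ, a.support.Finite ∧ N = PP a

def Per {α : Type*} (g : ℂ → α) : Prop := ∀ z, g (z + ((2 * Real.pi : ℝ) : ℂ)) = g z ∧ g (z + ((2 * Real.pi : ℝ) : ℂ) * Complex.I) = g z

lemma dec_of_finite {a : ℤ × ℤ → ℂ} (h : a.support.Finite) : Dec a := by
  obtain ⟨C, hC⟩ := (h.image (fun n => ‖a n‖ * Real.exp (wt n))).bddAbove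
  refine ⟨max C 0, 1, one_pos, fun n => ?_⟩
  by_cases hn : a n = 0
  · rw [hn, norm_zero]; positivity
  have := hC ⟨n, hn, rfl⟩
  simp only at this
  rw [neg_one_mul, Real.exp_neg, ← div_eq_mul_inv, le_div_iff₀ (Real.exp_pos _)]
  exact this.trans (le_max_left _ _)

lemma ee_per (n : ℤ × ℤ) : Per (ee n) := by
  intro z
  constructor
  · rw [ee, ee, Complex.exp_eq_exp_iff_exists_int]
    refine ⟨n.1, ?_⟩
    simp; ring
  · rw [ee, ee, Complex.exp_eq_exp_iff_exists_int]
    refine ⟨n.2, ?_⟩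
    simp; ring

lemma PP_per (a : ℤ × ℤ → ℂ) : Per (PP a) := by
  intro z
  simp only [PP, (ee_per _ z).1, (ee_per _ z).2, and_self]

lemma fderiv_PP_one {a : ℤ × ℤ → ℂ} (h : Dec a) (z : ℂ) : fderiv ℝ (PP a) z 1 = PP (dx a) z := by
  rw [(PP_hasFDeriv h z).fderiv]; simp
lemma fderiv_PP_I {a : ℤ × ℤ → ℂ} (h : Dec a) (z : ℂ) : fderiv ℝ (PP a) z Complex.I = PP (dy a) z := by
  rw [(PP_hasFDeriv h z).fderiv]; simp

lemma wderiv_PP {a : ℤ × ℤ → ℂ} (h : Dec a) (z : ℂ) :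
    wderiv (PP a) z = PP (fun n => (Complex.I / 2 * conj ((n.1 : ℂ) + n.2 * Complex.I)) * a n) z := by
  rw [wderiv, fderiv_PP_one h, fderiv_PP_I h]
  simp only [PP]
  rw [← tsum_mul_left, ← (h.dx.summable_ee z).tsum_sub ((h.dy.summable_ee z).mul_left _), ← tsum_div_const]
  refine tsum_congr (fun n => ?_)
  simp only [dx, dy, map_add, map_mul, Complex.conj_I, map_intCast]
  ring

lemma wderivBar_PP {a : ℤ × ℤ → ℂ} (h : Dec a) (z : ℂ) :
    wderivBar (PP a) z = PP (fun n => (Complex.I / 2 * ((n.1 : ℂ) + n.2 * Complex.I)) * a n) z := by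
  rw [wderivBar, fderiv_PP_one h, fderiv_PP_I h]
  simp only [PP]
  rw [← tsum_mul_left, ← (h.dx.summable_ee z).tsum_add ((h.dy.summable_ee z).mul_left _), ← tsum_div_const]
  refine tsum_congr (fun n => ?_)
  simp only [dx, dy]
  ring

lemma TrigPoly.wderiv {N : ℂ → ℂ} (h : TrigPoly N) : TrigPoly (wderiv N) := by
  obtain ⟨a, ha, rfl⟩ := h
  exact ⟨_, ha.subset (fun n hn => right_ne_zero_of_mul hn), funext (fun z => wderiv_PP (dec_of_finite ha) z)⟩

lemma TrigPoly.contDiff {N : ℂ → ℂ} (h : TrigPoly N) : ContDiff ℝ (⊤ : ℕ∞) N := by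
  obtain ⟨a, ha, rfl⟩ := h
  exact PP_contDiff (dec_of_finite ha)

lemma xi_norm {n : ℤ × ℤ} (hn : n ≠ 0) : 1 ≤ ‖(n.1 : ℂ) + n.2 * Complex.I‖ := by
  have h1 := Complex.abs_re_le_norm ((n.1 : ℂ) + n.2 * Complex.I)
  have h2 := Complex.abs_im_le_norm ((n.1 : ℂ) + n.2 * Complex.I)
  simp at h1 h2
  by_cases h : n.1 = 0
  · have h3 : n.2 ≠ 0 := fun h' => hn (Prod.ext h h')
    have : (1:ℝ) ≤ |(n.2:ℝ)| := by exact_mod_cast Int.one_le_abs h3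
    linarith
  · have : (1:ℝ) ≤ |(n.1:ℝ)| := by exact_mod_cast Int.one_le_abs h
    linarith

theorem solver {N r : ℂ → ℂ} (hN : TrigPoly N) (hr : TrigPoly r) {k : ℝ} (hk0 : 0 ≤ k) (hk1 : k < 1) (hk : ∀ z, ‖N z‖ ≤ k) :
    ∃ (b : ℂ) (p : ℂ → ℂ), ContDiff ℝ (⊤ : ℕ∞) p ∧ Per p ∧ ∀ z, wderivBar p z + b = N z * wderiv p z + r z := by
  obtain ⟨ν, hν, rfl⟩ := hN
  obtain ⟨ρ, hρ, rfl⟩ := hr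
  have hνe : ∀ z, PP ν z = ∑ d ∈ hν.toFinset, ν d * ee d z := fun z => PP_finite (fun n hn => by simpa using hn) z
  obtain ⟨τ, hτ, heq⟩ := torus_solve hk0 hk1 (fun z => by rw [← hνe]; exact hk z) hρ
  set m : ℤ × ℤ → ℂ := fun n => (Complex.I / 2 * ((n.1 : ℂ) + n.2 * Complex.I))⁻¹ with hm
  have hmd : Dec (fun n => m n * τ n) := by
    refine hτ.mul m 2 (fun n => ?_)
    have hw := wt_nonneg n
    by_cases hn : n = 0
    · simp [hm, hn]; have := wt_nonneg 0; linarith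
    · have h1 := xi_norm hn
      simp only [hm, norm_inv, norm_mul, norm_div, Complex.norm_I, Complex.norm_ofNat]
      have h2 : (1 / 2 * ‖(n.1 : ℂ) + n.2 * Complex.I‖)⁻¹ ≤ (1 / 2 * 1)⁻¹ := by gcongr
      linarith
  have hξ : ∀ n : ℤ × ℤ, n ≠ 0 → ((n.1 : ℂ) + n.2 * Complex.I) ≠ 0 := fun n hn h => by
    have := xi_norm hn; rw [h] at this; simp at this; linarith
  refine ⟨τ 0, PP (fun n => m n * τ n), PP_contDiff hmd, PP_per _, fun z => ?_⟩
  rw [wderivBar_PP hmd, wderiv_PP hmd, hνe]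
  have e1 : PP (fun n => (Complex.I / 2 * ((n.1 : ℂ) + n.2 * Complex.I)) * (m n * τ n)) z + τ 0 = PP τ z := by
    have := (hτ.summable_ee z).tsum_eq_add_tsum_ite 0
    rw [PP, PP, this, add_comm]
    congr 1
    · simp [ee]
    · refine tsum_congr (fun n => ?_)
      by_cases hn : n = 0
      · simp [hn]
      · have := hξ n hn
        rw [if_neg hn]
        simp only [hm]
        have hI := Complex.I_ne_zero
        rw [mul_inv_cancel_left₀ (mul_ne_zero (by simp) this)]
  have e2 : PP (fun n => (Complex.I / 2 * conj ((n.1 : ℂ) + n.2 * Complex.I)) * (m n * τ n)) z = PP (fun n => ss n * τ n) z := by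
    unfold PP
    refine tsum_congr (fun n => ?_)
    by_cases hn : n = 0
    · simp [hn, ss]
    · have := hξ n hn
      simp only [hm, ss]
      have hI := Complex.I_ne_zero
      field_simp
  rw [e1, e2, heq]

end MRM

namespace MRM
open Set Filter Topology ComplexConjugate

lemma la_add (D E : ℂ →L[ℝ] ℂ) : la (D + E) = la D + la E := by simp [la]; ring
lemma lb_add (D E : ℂ →L[ℝ] ℂ) : lb (D + E) = lb D + lb E := by simp [lb]; ring
lemma la_smul (c : ℂ) (D : ℂ →L[ℝ] ℂ) : la (c • D) = c * la D := by simp [la]; ring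
lemma lb_smul (c : ℂ) (D : ℂ →L[ℝ] ℂ) : lb (c • D) = c * lb D := by simp [lb]; ring

section
variable {f g : ℂ → ℂ} {z : ℂ}
lemma wd_add (hf : DifferentiableAt ℝ f z) (hg : DifferentiableAt ℝ g z) : wderiv (fun w => f w + g w) z = wderiv f z + wderiv g z := by
  rw [wderiv_eq, fderiv_fun_add hf hg, la_add]; rfl
lemma wdb_add (hf : DifferentiableAt ℝ f z) (hg : DifferentiableAt ℝ g z) : wderivBar (fun w => f w + g w) z = wderivBar f z + wderivBar g z := by
  rw [wderivBar_eq, fderiv_fun_add hf hg, lb_add]; rfl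
lemma wd_mul (hf : DifferentiableAt ℝ f z) (hg : DifferentiableAt ℝ g z) : wderiv (fun w => f w * g w) z = f z * wderiv g z + g z * wderiv f z := by
  rw [wderiv_eq, fderiv_fun_mul hf hg, la_add, la_smul, la_smul]; rfl
lemma wdb_mul (hf : DifferentiableAt ℝ f z) (hg : DifferentiableAt ℝ g z) : wderivBar (fun w => f w * g w) z = f z * wderivBar g z + g z * wderivBar f z := by
  rw [wderivBar_eq, fderiv_fun_mul hf hg, lb_add, lb_smul, lb_smul]; rfl
lemma wd_exp (hf : DifferentiableAt ℝ f z) : wderiv (fun w => Complex.exp (f w)) z = Complex.exp (f z) * wderiv f z := by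
  rw [wderiv_eq, hf.hasFDerivAt.cexp.fderiv, la_smul]; rfl
lemma wdb_exp (hf : DifferentiableAt ℝ f z) : wderivBar (fun w => Complex.exp (f w)) z = Complex.exp (f z) * wderivBar f z := by
  rw [wderivBar_eq, hf.hasFDerivAt.cexp.fderiv, lb_smul]; rfl
lemma wd_const_mul (c : ℂ) (hf : DifferentiableAt ℝ f z) : wderiv (fun w => c * f w) z = c * wderiv f z := by
  rw [wderiv_eq, fderiv_const_mul hf, la_smul]; rfl
lemma wdb_const_mul (c : ℂ) (hf : DifferentiableAt ℝ f z) : wderivBar (fun w => c * f w) z = c * wderivBar f z := by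
  rw [wderivBar_eq, fderiv_const_mul hf, lb_smul]; rfl
end
lemma wd_id (z : ℂ) : wderiv (fun w => w) z = 1 := by
  rw [wderiv, fderiv_id']; simp
lemma wdb_id (z : ℂ) : wderivBar (fun w => w) z = 0 := by
  rw [wderivBar, fderiv_id']; simp
lemma conj_diff : ContDiff ℝ (⊤ : ℕ∞) (fun w : ℂ => conj w) := Complex.conjCLE.contDiff
lemma wd_conj (z : ℂ) : wderiv (fun w => conj w) z = 0 := by
  have : fderiv ℝ (fun w : ℂ => conj w) z = (Complex.conjCLE : ℂ →L[ℝ] ℂ) := Complex.conjCLE.hasFDerivAt.fderiv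
  rw [wderiv, this]; simp
lemma wdb_conj (z : ℂ) : wderivBar (fun w => conj w) z = 1 := by
  have : fderiv ℝ (fun w : ℂ => conj w) z = (Complex.conjCLE : ℂ →L[ℝ] ℂ) := Complex.conjCLE.hasFDerivAt.fderiv
  rw [wderivBar, this]; simp

lemma fderiv_contDiff {f : ℂ → ℂ} (hf : ContDiff ℝ (⊤ : ℕ∞) f) : ContDiff ℝ (⊤ : ℕ∞) (fderiv ℝ f) :=
  hf.fderiv_right (by simp)

lemma fderiv_apply_contDiff {f : ℂ → ℂ} (hf : ContDiff ℝ (⊤ : ℕ∞) f) (u : ℂ) : ContDiff ℝ (⊤ : ℕ∞) (fun z => fderiv ℝ f z u) :=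
  (fderiv_contDiff hf).clm_apply contDiff_const

lemma wderiv_contDiff {f : ℂ → ℂ} (hf : ContDiff ℝ (⊤ : ℕ∞) f) : ContDiff ℝ (⊤ : ℕ∞) (wderiv f) := by
  unfold wderiv
  exact ((fderiv_apply_contDiff hf _).sub (contDiff_const.mul (fderiv_apply_contDiff hf _))).div_const _
lemma wderivBar_contDiff {f : ℂ → ℂ} (hf : ContDiff ℝ (⊤ : ℕ∞) f) : ContDiff ℝ (⊤ : ℕ∞) (wderivBar f) := by
  unfold wderivBar
  exact ((fderiv_apply_contDiff hf _).add (contDiff_const.mul (fderiv_apply_contDiff hf _))).div_const _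

lemma smooth_diff {f : ℂ → ℂ} (hf : ContDiff ℝ (⊤ : ℕ∞) f) : Differentiable ℝ f := hf.differentiable (by simp)

lemma fderiv_fderiv_apply {f : ℂ → ℂ} (hf : ContDiff ℝ (⊤ : ℕ∞) f) (z u v : ℂ) :
    fderiv ℝ (fun w => fderiv ℝ f w u) z v = fderiv ℝ (fderiv ℝ f) z v u := by
  have h : DifferentiableAt ℝ (fderiv ℝ f) z := (fderiv_contDiff hf).differentiable (by simp) z
  rw [fderiv_clm_apply h (differentiableAt_const _)]; simp

lemma fderiv_symm {f : ℂ → ℂ} (hf : ContDiff ℝ (⊤ : ℕ∞) f) (z u v : ℂ) :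
    fderiv ℝ (fderiv ℝ f) z v u = fderiv ℝ (fderiv ℝ f) z u v :=
  (hf.contDiffAt.isSymmSndFDerivAt (by simp [minSmoothness_of_isRCLikeNormedField]; exact WithTop.coe_le_coe.2 le_top)) v u

lemma wderiv_comm {f : ℂ → ℂ} (hf : ContDiff ℝ (⊤ : ℕ∞) f) (z : ℂ) : wderivBar (wderiv f) z = wderiv (wderivBar f) z := by
  have h1 := (smooth_diff (fderiv_apply_contDiff hf 1)) z
  have h2 := (smooth_diff (fderiv_apply_contDiff hf Complex.I)) z
  have e1 : ∀ v, fderiv ℝ (wderiv f) z v = (fderiv ℝ (fderiv ℝ f) z v 1 - Complex.I * fderiv ℝ (fderiv ℝ f) z v Complex.I) / 2 := by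
    intro v
    have : HasFDerivAt (wderiv f) _ z := (h1.hasFDerivAt.sub (h2.hasFDerivAt.const_mul Complex.I)).mul_const' (2⁻¹ : ℂ)
    rw [this.fderiv, ← fderiv_fderiv_apply hf, ← fderiv_fderiv_apply hf]
    simp; ring
  have e2 : ∀ v, fderiv ℝ (wderivBar f) z v = (fderiv ℝ (fderiv ℝ f) z v 1 + Complex.I * fderiv ℝ (fderiv ℝ f) z v Complex.I) / 2 := by
    intro v
    have : HasFDerivAt (wderivBar f) _ z := (h1.hasFDerivAt.add (h2.hasFDerivAt.const_mul Complex.I)).mul_const' (2⁻¹ : ℂ)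
    rw [this.fderiv, ← fderiv_fderiv_apply hf, ← fderiv_fderiv_apply hf]
    simp; ring
  rw [wderivBar, wderiv, e1, e1, e2, e2, fderiv_symm hf z 1 Complex.I]
  ring

section
variable {E : Type*} [NormedAddCommGroup E] [NormedSpace ℝ E]

lemma QI_inner_cont {g : ℂ → E} (hg : Continuous g) (z₀ : ℂ) :
    Continuous (fun x : ℝ => ∫ y in (0:ℝ)..(2 * Real.pi), g (z₀ + (x + y * Complex.I))) :=
  intervalIntegral.continuous_parametric_intervalIntegral_of_continuous' (by fun_prop) _ _

lemma QI_add (z₀ : ℂ) {g h : ℂ → E} (hg : Continuous g) (hh : Continuous h) : QI z₀ (fun z => g z + h z) = QI z₀ g + QI z₀ h := by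
  unfold QI
  rw [← intervalIntegral.integral_add ((QI_inner_cont hg z₀).intervalIntegrable _ _) ((QI_inner_cont hh z₀).intervalIntegrable _ _)]
  congr 1; ext x
  exact intervalIntegral.integral_add (Continuous.intervalIntegrable (by fun_prop) _ _) (Continuous.intervalIntegrable (by fun_prop) _ _)

lemma QI_sub (z₀ : ℂ) {g h : ℂ → E} (hg : Continuous g) (hh : Continuous h) : QI z₀ (fun z => g z - h z) = QI z₀ g - QI z₀ h := by
  unfold QI
  rw [← intervalIntegral.integral_sub ((QI_inner_cont hg z₀).intervalIntegrable _ _) ((QI_inner_cont hh z₀).intervalIntegrable _ _)]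
  congr 1; ext x
  exact intervalIntegral.integral_sub (Continuous.intervalIntegrable (by fun_prop) _ _) (Continuous.intervalIntegrable (by fun_prop) _ _)

end
lemma QI_const (z₀ : ℂ) (c : ℂ) : QI z₀ (fun _ => c) = (((2 * Real.pi) ^ 2 : ℝ) : ℂ) * c := by
  simp [QI]; ring

lemma QI_pos (z₀ : ℂ) {g : ℂ → ℝ} (hg : Continuous g) (h0 : ∀ z, 0 ≤ g z) (hz : 0 < g z₀) : 0 < QI z₀ g := by
  have hpi := Real.pi_pos
  refine intervalIntegral.integral_pos (by linarith) (QI_inner_cont hg z₀).continuousOn (fun x _ => ?_) ⟨0, ⟨le_rfl, by linarith⟩, ?_⟩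
  · exact intervalIntegral.integral_nonneg (by linarith) (fun y _ => h0 _)
  · refine intervalIntegral.integral_pos (by linarith) (Continuous.continuousOn (by fun_prop)) (fun x _ => h0 _) ⟨0, ⟨le_rfl, by linarith⟩, ?_⟩
    simpa using hz

lemma QI_dy (z₀ : ℂ) {g : ℂ → ℂ} (hg : ContDiff ℝ 1 g) (hp : ∀ z, g (z + ((2 * Real.pi : ℝ) : ℂ) * Complex.I) = g z) :
    QI z₀ (fun z => fderiv ℝ g z Complex.I) = 0 := by
  unfold QI
  have hc : Continuous (fun z => fderiv ℝ g z Complex.I) := (hg.continuous_fderiv one_ne_zero).clm_apply continuous_const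
  have : ∀ x : ℝ, ∫ y in (0:ℝ)..(2 * Real.pi), fderiv ℝ g (z₀ + (x + y * Complex.I)) Complex.I = 0 := by
    intro x
    have hd : ∀ y : ℝ, HasDerivAt (fun y : ℝ => g (z₀ + (x + y * Complex.I))) (fderiv ℝ g (z₀ + (x + y * Complex.I)) Complex.I) y := by
      intro y
      have h1 : HasDerivAt (fun y : ℝ => z₀ + (x + (y : ℂ) * Complex.I)) Complex.I y := by
        have : HasDerivAt (fun y : ℝ => (y : ℂ) * Complex.I) (1 * Complex.I) y := (Complex.ofRealCLM.hasDerivAt (x := y)).mul_const (Complex.I)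
        rw [one_mul] at this
        exact (this.const_add _).const_add _
      exact ((hg.differentiable one_ne_zero) _).hasFDerivAt.comp_hasDerivAt y h1
    rw [intervalIntegral.integral_eq_sub_of_hasDerivAt (fun y _ => hd y) (Continuous.intervalIntegrable (by fun_prop) _ _)]
    have := hp (z₀ + x)
    rw [sub_eq_zero]
    simpa [add_assoc] using this
  simp [this]

lemma QI_dx (z₀ : ℂ) {g : ℂ → ℂ} (hg : ContDiff ℝ 1 g) (hp : ∀ z, g (z + ((2 * Real.pi : ℝ) : ℂ)) = g z) :
    QI z₀ (fun z => fderiv ℝ g z 1) = 0 := by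
  unfold QI
  have hc : Continuous (fun z => fderiv ℝ g z 1) := (hg.continuous_fderiv one_ne_zero).clm_apply continuous_const
  rw [intervalIntegral_intervalIntegral_swap]
  swap
  · refine IntegrableOn.mono_set (t := uIcc 0 (2 * Real.pi) ×ˢ uIcc 0 (2 * Real.pi)) ?_ (prod_mono uIoc_subset_uIcc uIoc_subset_uIcc)
    refine ContinuousOn.integrableOn_compact (isCompact_uIcc.prod isCompact_uIcc) (Continuous.continuousOn ?_)
    unfold Function.uncurry
    fun_prop
  have : ∀ y : ℝ, ∫ x in (0:ℝ)..(2 * Real.pi), fderiv ℝ g (z₀ + (x + y * Complex.I)) 1 = 0 := by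
    intro y
    have hd : ∀ x : ℝ, HasDerivAt (fun x : ℝ => g (z₀ + (x + y * Complex.I))) (fderiv ℝ g (z₀ + (x + y * Complex.I)) 1) x := by
      intro x
      have h1 : HasDerivAt (fun x : ℝ => z₀ + ((x : ℂ) + (y : ℂ) * Complex.I)) 1 x :=
        ((Complex.ofRealCLM.hasDerivAt (x := x)).add_const _).const_add _
      exact ((hg.differentiable one_ne_zero) _).hasFDerivAt.comp_hasDerivAt x h1
    rw [intervalIntegral.integral_eq_sub_of_hasDerivAt (fun y _ => hd y) (Continuous.intervalIntegrable (by fun_prop) _ _)]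
    have := hp (z₀ + y * Complex.I)
    rw [sub_eq_zero]
    convert this using 2
    · ring
    · simp
  simp [this]

lemma normsq_sub_eq (f : ℂ → ℂ) (z : ℂ) : (((‖wderiv f z‖ ^ 2 - ‖wderivBar f z‖ ^ 2 : ℝ)) : ℂ) * (2 * Complex.I) =
    conj (fderiv ℝ f z 1) * fderiv ℝ f z Complex.I - conj (fderiv ℝ f z Complex.I) * fderiv ℝ f z 1 := by
  rw [clm_one (fderiv ℝ f z), clm_I (fderiv ℝ f z), wderiv_eq, wderivBar_eq]
  push_cast
  rw [← Complex.mul_conj', ← Complex.mul_conj']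
  simp only [map_mul, map_add, map_sub, Complex.conj_I]
  ring

lemma quasi_liouville_int (z₀ : ℂ) {v : ℂ → ℂ} (hv : ContDiff ℝ (⊤ : ℕ∞) v) {m₁ m₂ : ℂ} (h1 : ‖m₁‖ = 1) (h2 : ‖m₂‖ = 1)
    (hp1 : ∀ z, v (z + ((2 * Real.pi : ℝ) : ℂ)) = m₁ * v z) (hp2 : ∀ z, v (z + ((2 * Real.pi : ℝ) : ℂ) * Complex.I) = m₂ * v z) :
    QI z₀ (fun z => ‖wderiv v z‖ ^ 2 - ‖wderivBar v z‖ ^ 2) = 0 := by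
  have hd := smooth_diff hv
  have hcv : ContDiff ℝ (⊤ : ℕ∞) (fun z => conj (v z)) := conj_diff.comp hv
  have hfp : ∀ (T m : ℂ), (∀ z, v (z + T) = m * v z) → ∀ z u, fderiv ℝ v (z + T) u = m * fderiv ℝ v z u := by
    intro T m h z u
    rw [← fderiv_comp_add_right, show (fun x => v (x + T)) = fun x => m * v x from funext h, fderiv_const_mul (hd z)]
    simp
  have hG : ∀ (T m u : ℂ), ‖m‖ = 1 → (∀ z, v (z + T) = m * v z) → ∀ z,
      conj (v (z + T)) * fderiv ℝ v (z + T) u = conj (v z) * fderiv ℝ v z u := by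
    intro T m u hm h z
    rw [h, hfp T m h, map_mul]
    have : conj m * m = 1 := by rw [mul_comm, Complex.mul_conj', hm]; simp
    linear_combination (conj (v z) * fderiv ℝ v z u) * this
  have hGs : ∀ u, ContDiff ℝ (⊤ : ℕ∞) (fun z => conj (v z) * fderiv ℝ v z u) := fun u => hcv.mul (fderiv_apply_contDiff hv u)
  have hconj : ∀ z u, fderiv ℝ (fun z => conj (v z)) z u = conj (fderiv ℝ v z u) := by
    intro z u
    have : HasFDerivAt (fun z => conj (v z)) _ z := (Complex.conjCLE.hasFDerivAt).comp z (hd z).hasFDerivAt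
    rw [this.fderiv]; simp
  have hGd : ∀ z u w, fderiv ℝ (fun z => conj (v z) * fderiv ℝ v z u) z w = conj (v z) * fderiv ℝ (fderiv ℝ v) z w u + fderiv ℝ v z u * conj (fderiv ℝ v z w) := by
    intro z u w
    rw [fderiv_fun_mul (smooth_diff hcv z) (smooth_diff (fderiv_apply_contDiff hv u) z)]
    simp [hconj, fderiv_fderiv_apply hv]
  have i1 := QI_dx z₀ ((hGs Complex.I).of_le (by norm_cast)) (hG _ m₁ Complex.I h1 hp1)
  have i2 := QI_dy z₀ ((hGs 1).of_le (by norm_cast)) (hG _ m₂ 1 h2 hp2)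
  have i3 := QI_sub z₀ (g := fun z => fderiv ℝ (fun z => conj (v z) * fderiv ℝ v z Complex.I) z 1)
    (h := fun z => fderiv ℝ (fun z => conj (v z) * fderiv ℝ v z 1) z Complex.I)
    (fderiv_apply_contDiff (hGs _) _).continuous (fderiv_apply_contDiff (hGs _) _).continuous
  rw [i1, i2, sub_zero] at i3
  have e : (fun z => fderiv ℝ (fun z => conj (v z) * fderiv ℝ v z Complex.I) z 1 - fderiv ℝ (fun z => conj (v z) * fderiv ℝ v z 1) z Complex.I)
     = fun z => (2 * Complex.I) * (((‖wderiv v z‖ ^ 2 - ‖wderivBar v z‖ ^ 2 : ℝ)) : ℂ) := by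
    ext z
    rw [mul_comm, normsq_sub_eq, hGd, hGd, fderiv_symm hv z 1 Complex.I]; ring
  rw [e, QI_const_mul, QI_ofReal] at i3
  have : (2 * Complex.I) ≠ 0 := by simp
  simpa using i3

end MRM

namespace MRM
open Set Filter Topology ComplexConjugate

lemma le_top_one : (1 : WithTop ℕ∞) ≤ ((⊤ : ℕ∞) : WithTop ℕ∞) := by norm_cast

lemma QI_wd {p : ℂ → ℂ} (hp : ContDiff ℝ (⊤ : ℕ∞) p) (hP : Per p) (z₀ : ℂ) : QI z₀ (wderiv p) = 0 ∧ QI z₀ (wderivBar p) = 0 := by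
  have h1 := QI_dx z₀ (hp.of_le le_top_one) (fun z => (hP z).1)
  have h2 := QI_dy z₀ (hp.of_le le_top_one) (fun z => (hP z).2)
  have c1 : Continuous (fun z => (1/2 : ℂ) * fderiv ℝ p z 1) := continuous_const.mul (fderiv_apply_contDiff hp _).continuous
  have c2 : Continuous (fun z => (Complex.I/2 : ℂ) * fderiv ℝ p z Complex.I) := continuous_const.mul (fderiv_apply_contDiff hp _).continuous
  constructor
  · have : wderiv p = fun z => (1/2 : ℂ) * fderiv ℝ p z 1 - (Complex.I/2 : ℂ) * fderiv ℝ p z Complex.I := by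
      ext z; simp only [wderiv]; ring
    rw [this, QI_sub z₀ c1 c2, QI_const_mul, QI_const_mul, h1, h2]; simp
  · have : wderivBar p = fun z => (1/2 : ℂ) * fderiv ℝ p z 1 + (Complex.I/2 : ℂ) * fderiv ℝ p z Complex.I := by
      ext z; simp only [wderivBar]; ring
    rw [this, QI_add z₀ c1 c2, QI_const_mul, QI_const_mul, h1, h2]; simp

lemma conj_fderiv {p : ℂ → ℂ} {z : ℂ} (hd : DifferentiableAt ℝ p z) (u : ℂ) : fderiv ℝ (fun z => conj (p z)) z u = conj (fderiv ℝ p z u) := by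
  have : HasFDerivAt (fun z => conj (p z)) _ z := (Complex.conjCLE.hasFDerivAt).comp z hd.hasFDerivAt
  rw [this.fderiv]; simp

lemma wd_conj' {p : ℂ → ℂ} {z : ℂ} (hd : DifferentiableAt ℝ p z) : wderiv (fun z => conj (p z)) z = conj (wderivBar p z) ∧
    wderivBar (fun z => conj (p z)) z = conj (wderiv p z) := by
  have h2 : conj (2 : ℂ) = 2 := Complex.conj_ofNat 2
  constructor <;> simp [wderiv, wderivBar, conj_fderiv hd, h2, sub_eq_add_neg]

lemma per_norm_one (x : ℂ) (h : x.re = 0) : ‖Complex.exp x‖ = 1 := by rw [Complex.norm_exp, h, Real.exp_zero]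

lemma b_lt {N p : ℂ → ℂ} {b : ℂ} {k : ℝ} (hk0 : 0 ≤ k) (hk1 : k < 1) (hk : ∀ z, ‖N z‖ ≤ k) (hp : ContDiff ℝ (⊤ : ℕ∞) p) (hP : Per p)
    (he : ∀ z, wderivBar p z + b = N z * (1 + wderiv p z)) : ‖b‖ < 1 ∧ ∃ z, 1 + wderiv p z ≠ 0 := by
  have hcw := (wderiv_contDiff hp).continuous
  have hcb := (wderivBar_contDiff hp).continuous
  have hne : ∃ z, 1 + wderiv p z ≠ 0 := by
    by_contra! h
    have h1 := (QI_wd hp hP 0).1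
    have : wderiv p = fun _ => (-1 : ℂ) := by ext z; linear_combination h z
    rw [this, QI_const] at h1
    have := Real.pi_pos
    simp at h1
  refine ⟨?_, hne⟩
  obtain ⟨z₀, hz₀⟩ := hne
  have hpc : ContDiff ℝ (⊤ : ℕ∞) (fun z => conj (p z)) := Complex.conjCLE.contDiff.comp hp
  have hPc : Per (fun z => conj (p z)) := fun z => ⟨congrArg conj (hP z).1, congrArg conj (hP z).2⟩
  have q1 := QI_wd hp hP z₀
  have q2 := QI_wd hpc hPc z₀
  have q3 := quasi_liouville_int z₀ hp (m₁ := 1) (m₂ := 1) (by simp) (by simp) (by simpa using fun z => (hP z).1) (by simpa using fun z => (hP z).2)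
  have q4 : QI z₀ (fun z => (((‖wderiv p z‖ ^ 2 - ‖wderivBar p z‖ ^ 2 : ℝ)) : ℂ)) = 0 := by rw [QI_ofReal, q3]; simp
  have key : QI z₀ (fun z => ‖1 + wderiv p z‖ ^ 2 - ‖wderivBar p z + b‖ ^ 2) = (1 - ‖b‖ ^ 2) * (2 * Real.pi) ^ 2 := by
    apply Complex.ofReal_injective
    rw [← QI_ofReal]
    have e : (fun z => ((‖1 + wderiv p z‖ ^ 2 - ‖wderivBar p z + b‖ ^ 2 : ℝ) : ℂ)) = fun z =>
        ((1 - conj b * b) + wderiv p z + wderivBar (fun z => conj (p z)) z - conj b * wderivBar p z - b * wderiv (fun z => conj (p z)) z)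
          + (((‖wderiv p z‖ ^ 2 - ‖wderivBar p z‖ ^ 2 : ℝ)) : ℂ) := by
      ext z
      rw [(wd_conj' (smooth_diff hp z)).1, (wd_conj' (smooth_diff hp z)).2]
      push_cast
      simp only [← Complex.conj_mul', map_add, map_one]
      ring
    have d1 := (wderivBar_contDiff hpc).continuous
    have d2 := (wderiv_contDiff hpc).continuous
    rw [e, QI_add z₀ (by fun_prop) (by fun_prop), q4, QI_sub z₀ (by fun_prop) (by fun_prop), QI_sub z₀ (by fun_prop) (by fun_prop),
      QI_add z₀ (by fun_prop) (by fun_prop), QI_add z₀ (by fun_prop) (by fun_prop), QI_const, QI_const_mul, QI_const_mul]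
    rw [show QI z₀ (fun z => wderiv p z) = 0 from q1.1, show QI z₀ (fun z => wderivBar p z) = 0 from q1.2]
    rw [show QI z₀ (fun z => wderiv (fun z => conj (p z)) z) = 0 from q2.1, show QI z₀ (fun z => wderivBar (fun z => conj (p z)) z) = 0 from q2.2]
    push_cast
    rw [← Complex.conj_mul']; ring
  have hle : ∀ z, (1 - k ^ 2) * ‖1 + wderiv p z‖ ^ 2 ≤ ‖1 + wderiv p z‖ ^ 2 - ‖wderivBar p z + b‖ ^ 2 := by
    intro z
    rw [he z, norm_mul]
    have : ‖N z‖ ^ 2 ≤ k ^ 2 := by gcongr; exact hk z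
    have := mul_le_mul_of_nonneg_right this (sq_nonneg ‖1 + wderiv p z‖)
    nlinarith
  have h1k : 0 < 1 - k ^ 2 := by nlinarith
  have := QI_pos z₀ (g := fun z => ‖1 + wderiv p z‖ ^ 2 - ‖wderivBar p z + b‖ ^ 2) (by fun_prop)
    (fun z => le_trans (by positivity) (hle z)) (lt_of_lt_of_le (by have := norm_pos_iff.2 hz₀; positivity) (hle z₀))
  rw [key] at this
  have h2 : 0 < 1 - ‖b‖ ^ 2 := by
    by_contra h
    push Not at h
    have : (1 - ‖b‖ ^ 2) * (2 * Real.pi) ^ 2 ≤ 0 := mul_nonpos_of_nonpos_of_nonneg h (by positivity)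
    linarith
  nlinarith [norm_nonneg b]

lemma liouville {N v : ℂ → ℂ} {k : ℝ} (hk0 : 0 ≤ k) (hk1 : k < 1) (hk : ∀ z, ‖N z‖ ≤ k) (hv : ContDiff ℝ (⊤ : ℕ∞) v)
    {m₁ m₂ : ℂ} (h1 : ‖m₁‖ = 1) (h2 : ‖m₂‖ = 1)
    (hp1 : ∀ z, v (z + ((2 * Real.pi : ℝ) : ℂ)) = m₁ * v z) (hp2 : ∀ z, v (z + ((2 * Real.pi : ℝ) : ℂ) * Complex.I) = m₂ * v z)
    (he : ∀ z, wderivBar v z = N z * wderiv v z) (x y : ℂ) : v x = v y := by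
  have hcw := (wderiv_contDiff hv).continuous
  have hcb := (wderivBar_contDiff hv).continuous
  have hle : ∀ z, (1 - k ^ 2) * ‖wderiv v z‖ ^ 2 ≤ ‖wderiv v z‖ ^ 2 - ‖wderivBar v z‖ ^ 2 := by
    intro z
    rw [he z, norm_mul]
    have : ‖N z‖ ^ 2 ≤ k ^ 2 := by gcongr; exact hk z
    have := mul_le_mul_of_nonneg_right this (sq_nonneg ‖wderiv v z‖)
    nlinarith
  have h1k : 0 < 1 - k ^ 2 := by nlinarith
  have hz : ∀ z, wderiv v z = 0 := by
    intro z
    by_contra hz₀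
    have := QI_pos z (g := fun z => ‖wderiv v z‖ ^ 2 - ‖wderivBar v z‖ ^ 2) (by fun_prop)
      (fun z => le_trans (by positivity) (hle z)) (lt_of_lt_of_le (by have := norm_pos_iff.2 hz₀; positivity) (hle z))
    rw [quasi_liouville_int z hv h1 h2 hp1 hp2] at this
    exact lt_irrefl _ this
  refine is_const_of_fderiv_eq_zero (𝕜 := ℝ) (smooth_diff hv) (fun z => ?_) x y
  have h3 : la (fderiv ℝ v z) = 0 := hz z
  have h4 : lb (fderiv ℝ v z) = 0 := by have := he z; rw [hz z, mul_zero] at this; exact this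
  ext u
  rw [clm_apply, h3, h4]; simp

lemma solveLam (b c : ℂ) (hb : ‖b‖ < 1) : ∃ l : ℂ, conj l + b * l = c := by
  have hne : (1 - b * conj b) ≠ 0 := by
    rw [Complex.mul_conj']
    intro h
    have : (1 : ℝ) - ‖b‖ ^ 2 = 0 := by exact_mod_cast h
    nlinarith [norm_nonneg b]
  refine ⟨(conj c - conj b * c) / (1 - b * conj b), ?_⟩
  have : conj (1 - b * conj b) = 1 - b * conj b := by simp; ring
  rw [map_div₀, this]
  simp
  field_simp
  ring

lemma per_bdd {p : ℂ → ℂ} (hc : Continuous p) (hP : Per p) : ∃ M, ∀ z, ‖p z‖ ≤ M := by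
  have hpi := Real.pi_pos
  obtain ⟨M, hM⟩ := (isCompact_closedBall (0 : ℂ) (4 * Real.pi)).exists_bound_of_continuousOn hc.continuousOn
  refine ⟨M, fun z => ?_⟩
  have P1 : Function.Periodic p ((2 * Real.pi : ℝ) : ℂ) := fun z => (hP z).1
  have P2 : Function.Periodic p (((2 * Real.pi : ℝ) : ℂ) * Complex.I) := fun z => (hP z).2
  have key : p z = p (z - (⌊z.re / (2 * Real.pi)⌋ : ℂ) * ((2 * Real.pi : ℝ) : ℂ) - (⌊z.im / (2 * Real.pi)⌋ : ℂ) * (((2 * Real.pi : ℝ) : ℂ) * Complex.I)) := by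
    rw [P2.sub_int_mul_eq, P1.sub_int_mul_eq]
  have e : ∀ t : ℝ, 0 ≤ t - ⌊t / (2 * Real.pi)⌋ * (2 * Real.pi) ∧ t - ⌊t / (2 * Real.pi)⌋ * (2 * Real.pi) ≤ 2 * Real.pi := by
    intro t
    have h1 := Int.floor_le (t / (2 * Real.pi))
    have h2 := (Int.lt_floor_add_one (t / (2 * Real.pi))).le
    rw [le_div_iff₀ (by positivity)] at h1
    rw [div_le_iff₀ (by positivity)] at h2
    constructor <;> linarith
  rw [key]
  apply hM
  rw [mem_closedBall_zero_iff]
  refine (Complex.norm_le_abs_re_add_abs_im _).trans ?_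
  have e1 := e z.re
  have e2 := e z.im
  have r1 : (z - (⌊z.re / (2 * Real.pi)⌋ : ℂ) * ((2 * Real.pi : ℝ) : ℂ) - (⌊z.im / (2 * Real.pi)⌋ : ℂ) * (((2 * Real.pi : ℝ) : ℂ) * Complex.I)).re = z.re - ⌊z.re / (2 * Real.pi)⌋ * (2 * Real.pi) := by
    simp
  have r2 : (z - (⌊z.re / (2 * Real.pi)⌋ : ℂ) * ((2 * Real.pi : ℝ) : ℂ) - (⌊z.im / (2 * Real.pi)⌋ : ℂ) * (((2 * Real.pi : ℝ) : ℂ) * Complex.I)).im = z.im - ⌊z.im / (2 * Real.pi)⌋ * (2 * Real.pi) := by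
    simp
  rw [r1, r2, abs_of_nonneg e1.1, abs_of_nonneg e2.1]
  linarith [e1.2, e2.2]

theorem torus_diffeo {N : ℂ → ℂ} (hN : TrigPoly N) {k : ℝ} (hk0 : 0 ≤ k) (hk1 : k < 1) (hk : ∀ z, ‖N z‖ ≤ k) :
    ∃ f : ℂ → ℂ, ContDiff ℝ (⊤ : ℕ∞) f ∧ IsHomeomorph f ∧ ∀ z, wderivBar f z = N z * wderiv f z := by
  obtain ⟨b, p, hp, hP, he⟩ := solver hN hN hk0 hk1 hk
  obtain ⟨c, s, hs, hS, hes⟩ := solver hN hN.wderiv hk0 hk1 hk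
  obtain ⟨hb, z₀, hz₀⟩ := b_lt hk0 hk1 hk hp hP (fun z => by rw [he]; ring)
  obtain ⟨l, hl⟩ := solveLam b c hb
  set f : ℂ → ℂ := fun z => z + (b * conj z + p z) with hf
  have hfs : ContDiff ℝ (⊤ : ℕ∞) f := contDiff_id.add ((contDiff_const.mul conj_diff).add hp)
  have hidd : ∀ z, DifferentiableAt ℝ (fun w : ℂ => w) z := fun z => differentiableAt_id
  have hcd : ∀ z, DifferentiableAt ℝ (fun w : ℂ => conj w) z := fun z => smooth_diff conj_diff z
  have hpd : ∀ z, DifferentiableAt ℝ p z := smooth_diff hp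
  have hsd : ∀ z, DifferentiableAt ℝ s z := smooth_diff hs
  have hNd : ∀ z, DifferentiableAt ℝ N z := smooth_diff hN.contDiff
  have hfd : ∀ z, DifferentiableAt ℝ f z := smooth_diff hfs
  have hFd : ∀ z, DifferentiableAt ℝ (wderiv f) z := smooth_diff (wderiv_contDiff hfs)
  have hfz : ∀ z, wderiv f z = 1 + wderiv p z := by
    intro z
    rw [hf, wd_add (hidd z) (((hcd z).const_mul b).fun_add (hpd z)), wd_add ((hcd z).const_mul b) (hpd z), wd_const_mul b (hcd z), wd_id, wd_conj]; ring
  have hfzb : ∀ z, wderivBar f z = N z * wderiv f z := by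
    intro z
    rw [hfz, hf, wdb_add (hidd z) (((hcd z).const_mul b).fun_add (hpd z)), wdb_add ((hcd z).const_mul b) (hpd z), wdb_const_mul b (hcd z), wdb_id, wdb_conj]
    linear_combination he z
  set EE : ℂ → ℂ := fun z => (-c) * conj z + ((-1) * s z + l * f z) with hEE
  have hEs : ContDiff ℝ (⊤ : ℕ∞) EE := (contDiff_const.mul conj_diff).add ((contDiff_const.mul hs).add (contDiff_const.mul hfs))
  have hEd : ∀ z, DifferentiableAt ℝ EE z := smooth_diff hEs
  have hEz : ∀ z, wderiv EE z = - wderiv s z + l * wderiv f z := by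
    intro z
    rw [hEE, wd_add ((hcd z).const_mul _) (((hsd z).const_mul _).fun_add ((hfd z).const_mul _)), wd_add ((hsd z).const_mul _) ((hfd z).const_mul _),
      wd_const_mul _ (hcd z), wd_const_mul _ (hsd z), wd_const_mul _ (hfd z), wd_conj]; ring
  have hEzb : ∀ z, wderivBar EE z = N z * wderiv EE z - wderiv N z := by
    intro z
    rw [hEz, hEE, wdb_add ((hcd z).const_mul _) (((hsd z).const_mul _).fun_add ((hfd z).const_mul _)), wdb_add ((hsd z).const_mul _) ((hfd z).const_mul _),
      wdb_const_mul _ (hcd z), wdb_const_mul _ (hsd z), wdb_const_mul _ (hfd z), wdb_conj, hfzb]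
    linear_combination - hes z
  set v : ℂ → ℂ := fun z => wderiv f z * Complex.exp (EE z) with hv
  have hvs : ContDiff ℝ (⊤ : ℕ∞) v := (wderiv_contDiff hfs).mul hEs.cexp
  have hFb : ∀ z, wderivBar (wderiv f) z = N z * wderiv (wderiv f) z + wderiv f z * wderiv N z := by
    intro z
    rw [wderiv_comm hfs, show wderivBar f = fun z => N z * wderiv f z from funext hfzb, wd_mul (hNd z) (hFd z)]
  have hvb : ∀ z, wderivBar v z = N z * wderiv v z := by
    intro z
    rw [hv, wdb_mul (hFd z) (hEd z).cexp, wd_mul (hFd z) (hEd z).cexp, wdb_exp (hEd z), wd_exp (hEd z), hFb, hEzb]; ring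
  have hFp : ∀ T, (∀ z, p (z + T) = p z) → ∀ z, wderiv f (z + T) = wderiv f z := by
    intro T h z
    have : ∀ u, fderiv ℝ p (z + T) u = fderiv ℝ p z u := by
      intro u; rw [← fderiv_comp_add_right, show (fun x => p (x + T)) = p from funext h]
    rw [hfz, hfz]; simp [wderiv, this]
  have hvp : ∀ T, (∀ z, p (z + T) = p z) → (∀ z, s (z + T) = s z) → ∀ z, v (z + T) = Complex.exp (- c * conj T + l * (T + b * conj T)) * v z := by
    intro T h h' z
    have e1 : EE (z + T) = (- c * conj T + l * (T + b * conj T)) + EE z := by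
      simp only [hEE, hf, h, h', map_add]; ring
    simp only [hv]
    rw [hFp T h, e1, Complex.exp_add]; ring
  have hconst := liouville hk0 hk1 hk hvs (m₁ := _) (m₂ := _) ?_ ?_ (hvp _ (fun z => (hP z).1) (fun z => (hS z).1)) (hvp _ (fun z => (hP z).2) (fun z => (hS z).2)) hvb
  rotate_left
  · apply per_norm_one
    rw [Complex.conj_ofReal, show - c * ((2 * Real.pi : ℝ) : ℂ) + l * (((2 * Real.pi : ℝ) : ℂ) + b * ((2 * Real.pi : ℝ) : ℂ)) = ((2 * Real.pi : ℝ) : ℂ) * (l - conj l) by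
      linear_combination ((2 * Real.pi : ℝ) : ℂ) * hl]
    rw [Complex.re_ofReal_mul]; simp
  · apply per_norm_one
    rw [map_mul, Complex.conj_ofReal, Complex.conj_I, show - c * (((2 * Real.pi : ℝ) : ℂ) * -Complex.I) + l * (((2 * Real.pi : ℝ) : ℂ) * Complex.I + b * (((2 * Real.pi : ℝ) : ℂ) * -Complex.I)) = ((2 * Real.pi : ℝ) : ℂ) * (Complex.I * (l + conj l)) by
      linear_combination - ((2 * Real.pi : ℝ) : ℂ) * Complex.I * hl]
    rw [Complex.re_ofReal_mul]; simp
  have hF0 : ∀ z, wderiv f z ≠ 0 := by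
    intro z h
    have h1 := hconst z₀ z
    simp only [hv, h, zero_mul] at h1
    rcases mul_eq_zero.1 h1 with h2 | h2
    · exact hz₀ (by rw [← hfz]; exact h2)
    · exact Complex.exp_ne_zero _ h2
  have hdet : ∀ z, (fderiv ℝ f z).det ≠ 0 := by
    intro z
    have h1 : ‖lb (fderiv ℝ f z)‖ ≤ k * ‖la (fderiv ℝ f z)‖ := by
      change ‖wderivBar f z‖ ≤ k * ‖wderiv f z‖
      rw [hfzb, norm_mul]; gcongr; exact hk z
    have h2 := (clm_dist hk0 hk1 h1).2.2
    have h3 : 0 < ‖la (fderiv ℝ f z)‖ := norm_pos_iff.2 (hF0 z)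
    have h1k : 0 < 1 - k ^ 2 := by nlinarith
    have : 0 < (1 - k ^ 2) * ‖la (fderiv ℝ f z)‖ ^ 2 := by positivity
    exact (lt_of_lt_of_le this h2).ne'
  refine ⟨f, hfs, homeo_of_local ?_ ?_, hfzb⟩
  · refine IsLocalHomeomorph.mk f (fun z => ?_)
    have hd : HasFDerivAt f ((fderiv ℝ f z).toContinuousLinearEquivOfDetNeZero (hdet z) : ℂ →L[ℝ] ℂ) z := by
      rw [ContinuousLinearMap.coe_toContinuousLinearEquivOfDetNeZero]; exact (hfd z).hasFDerivAt
    exact ⟨hfs.contDiffAt.toOpenPartialHomeomorph f hd (by simp), hfs.contDiffAt.mem_toOpenPartialHomeomorph_source hd (by simp), fun x _ => rfl⟩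
  · have hbd : ∃ M, ∀ z, ‖p z‖ ≤ M := per_bdd hp.continuous hP
    obtain ⟨M, hM⟩ := hbd
    rw [← Metric.cobounded_eq_cocompact, ← comap_norm_atTop, tendsto_comap_iff]
    refine tendsto_atTop_mono (f := fun z => (1 - ‖b‖) * ‖z‖ - M) (fun z => ?_) ?_
    · have : z = f z - (b * conj z + p z) := by simp [hf]
      have h1 : ‖z‖ ≤ ‖f z‖ + (‖b‖ * ‖z‖ + ‖p z‖) := by
        calc ‖z‖ = ‖f z - (b * conj z + p z)‖ := by rw [← this]
          _ ≤ _ := (norm_sub_le _ _).trans (by gcongr; exact (norm_add_le _ _).trans (by simp))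
      have := hM z
      simp only [Function.comp]
      linarith
    · exact tendsto_atTop_add_const_right _ _ (tendsto_comap.const_mul_atTop (by linarith))

end MRM

namespace MRM
open Set Filter Topology ComplexConjugate

lemma TrigPoly.of_span {N : ℂ → ℂ} (h : N ∈ Submodule.span ℂ (range ee)) : TrigPoly N := by
  induction h using Submodule.span_induction with
  | mem x hx =>
    obtain ⟨n, rfl⟩ := hx
    refine ⟨Pi.single n 1, (Set.finite_singleton n).subset Pi.support_single_subset, ?_⟩
    ext z
    rw [PP_finite (F := {n}) (fun m hm => Pi.single_eq_of_ne (by simpa using hm) _)]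
    simp
  | zero => exact ⟨0, by simp, by ext z; simp [PP]⟩
  | add x y _ _ hx hy =>
    obtain ⟨a, ha, rfl⟩ := hx
    obtain ⟨b, hb, rfl⟩ := hy
    refine ⟨a + b, (ha.union hb).subset (Function.support_add _ _), ?_⟩
    ext z
    have h1 := (dec_of_finite ha).summable_ee z
    have h2 := (dec_of_finite hb).summable_ee z
    simp only [PP, Pi.add_apply, add_mul]
    rw [h1.tsum_add h2]
  | smul c x _ hx =>
    obtain ⟨a, ha, rfl⟩ := hx
    refine ⟨c • a, ha.subset (Function.support_const_smul_subset _ _), ?_⟩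
    ext z
    simp only [PP, Pi.smul_apply, smul_eq_mul, mul_assoc]
    rw [tsum_mul_left]

noncomputable def Tg : Subalgebra ℂ (ℂ → ℂ) := (Submodule.span ℂ (range ee)).toSubalgebra
  (Submodule.subset_span ⟨0, by ext z; simp [ee]⟩)
  (fun x y hx hy => by
    have := Submodule.mul_mem_mul hx hy
    rw [Submodule.span_mul_span] at this
    refine Submodule.span_mono ?_ this
    rintro _ ⟨_, ⟨m, rfl⟩, _, ⟨n, rfl⟩, rfl⟩
    exact ⟨m + n, by ext z; simp [ee_add]⟩)

lemma mem_Tg {N : ℂ → ℂ} : N ∈ Tg ↔ N ∈ Submodule.span ℂ (range ee) := Iff.rfl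

lemma Tg_conj {N : ℂ → ℂ} (h : N ∈ Tg) : (fun z => conj (N z)) ∈ Tg := by
  rw [mem_Tg] at h
  induction h using Submodule.span_induction with
  | mem x hx =>
    obtain ⟨n, rfl⟩ := hx
    exact Submodule.subset_span ⟨-n, by ext z; rw [ee_conj]⟩
  | zero => convert Tg.zero_mem using 1; ext z; simp
  | add x y _ _ hx hy => convert Tg.add_mem hx hy using 1; ext z; simp
  | smul c x _ hx => convert Tg.smul_mem hx (conj c) using 1; ext z; simp

abbrev Sq := Icc (-1:ℝ) 1 × Icc (-1:ℝ) 1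

noncomputable def qm (z : ℂ) : Sq := (⟨Real.sin z.re, Real.sin_mem_Icc _⟩, ⟨Real.sin z.im, Real.sin_mem_Icc _⟩)

noncomputable def TA : StarSubalgebra ℂ C(Sq, ℂ) where
  carrier := {F | (fun z => F (qm z)) ∈ Tg}
  mul_mem' := fun {a b} ha hb => Tg.mul_mem ha hb
  add_mem' := fun {a b} ha hb => Tg.add_mem ha hb
  algebraMap_mem' := fun r => Tg.algebraMap_mem r
  star_mem' := fun {a} ha => Tg_conj ha

lemma sin_mem (n : ℤ × ℤ) : (fun z : ℂ => ((Real.sin ((n.1 : ℝ) * z.re + (n.2 : ℝ) * z.im) : ℝ) : ℂ)) ∈ Tg := by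
  have h1 : ee n ∈ Tg := Submodule.subset_span ⟨n, rfl⟩
  have h2 : ee (-n) ∈ Tg := Submodule.subset_span ⟨-n, rfl⟩
  have := Tg.smul_mem (Tg.sub_mem h2 h1) (Complex.I / 2)
  convert this using 1
  ext z
  simp only [Pi.smul_apply, Pi.sub_apply, smul_eq_mul, Complex.ofReal_sin, Complex.sin, ee]
  simp only [Prod.fst_neg, Prod.snd_neg, Int.cast_neg]
  rw [show (((-(n.1:ℝ)) * z.re + (-(n.2:ℝ)) * z.im : ℝ) : ℂ) = -(((n.1:ℝ) * z.re + (n.2:ℝ) * z.im : ℝ) : ℂ) by push_cast; ring]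
  ring

lemma TA_sep : TA.SeparatesPoints := by
  intro x y hxy
  have : (x.1 : ℝ) ≠ y.1 ∨ (x.2 : ℝ) ≠ y.2 := by
    by_contra! h
    exact hxy (Prod.ext (Subtype.ext h.1) (Subtype.ext h.2))
  rcases this with h | h
  · refine ⟨fun x => ((x.1 : ℝ) : ℂ), ⟨⟨fun x => ((x.1 : ℝ) : ℂ), by fun_prop⟩, ?_, rfl⟩, by simpa using h⟩
    change (fun z : ℂ => ((Real.sin z.re : ℝ) : ℂ)) ∈ Tg
    simpa using sin_mem (1, 0)
  · refine ⟨fun x => ((x.2 : ℝ) : ℂ), ⟨⟨fun x => ((x.2 : ℝ) : ℂ), by fun_prop⟩, ?_, rfl⟩, by simpa using h⟩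
    change (fun z : ℂ => ((Real.sin z.im : ℝ) : ℂ)) ∈ Tg
    simpa using sin_mem (0, 1)

lemma trig_approx {g : ℂ → ℂ} (hg : Continuous g) {k ε R : ℝ} (hk : ∀ z, ‖g z‖ ≤ k) (hε : 0 < ε) (hR : 0 < R) :
    ∃ (N : ℂ → ℂ) (s : ℝ), TrigPoly N ∧ 0 < s ∧ (∀ z, ‖N z‖ ≤ k + ε) ∧ ∀ z, ‖z‖ ≤ R → ‖N (s * z) - g z‖ ≤ ε := by
  have hpi := Real.pi_pos
  set s : ℝ := Real.pi / 2 / R with hs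
  have hs0 : 0 < s := by positivity
  let h : C(Sq, ℂ) := ⟨fun x => g ((s⁻¹ : ℝ) * ((Real.arcsin x.1 : ℝ) + (Real.arcsin x.2 : ℝ) * Complex.I)), by
    have := Real.continuous_arcsin
    fun_prop⟩
  have hmem : h ∈ TA.topologicalClosure := by
    rw [ContinuousMap.starSubalgebra_topologicalClosure_eq_top_of_separatesPoints TA TA_sep]; trivial
  have hmem2 : h ∈ closure (TA : Set C(Sq, ℂ)) := hmem
  rw [Metric.mem_closure_iff] at hmem2
  obtain ⟨F, hF, hd⟩ := hmem2 ε hε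
  have hd' : ∀ x, ‖F x - h x‖ ≤ ε := by
    intro x
    have := (ContinuousMap.dist_apply_le_dist (f := h) (g := F) x).trans hd.le
    rwa [dist_comm, dist_eq_norm] at this
  refine ⟨fun z => F (qm z), s, TrigPoly.of_span hF, hs0, fun z => ?_, fun z hz => ?_⟩
  · have h1 := hd' (qm z)
    have h2 : ‖h (qm z)‖ ≤ k := hk _
    have := norm_add_le (F (qm z) - h (qm z)) (h (qm z))
    rw [sub_add_cancel] at this
    linarith
  · have h1 := hd' (qm (s * z))
    have e : h (qm (s * z)) = g z := by
      have a1 : |s * z.re| ≤ Real.pi / 2 := by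
        rw [abs_mul, abs_of_pos hs0]
        calc s * |z.re| ≤ s * R := by gcongr; exact (Complex.abs_re_le_norm z).trans hz
          _ = _ := by rw [hs]; field_simp
      have a2 : |s * z.im| ≤ Real.pi / 2 := by
        rw [abs_mul, abs_of_pos hs0]
        calc s * |z.im| ≤ s * R := by gcongr; exact (Complex.abs_im_le_norm z).trans hz
          _ = _ := by rw [hs]; field_simp
      change g ((s⁻¹ : ℝ) * ((Real.arcsin (Real.sin ((s:ℂ) * z).re) : ℝ) + (Real.arcsin (Real.sin ((s:ℂ) * z).im) : ℝ) * Complex.I)) = g z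
      rw [Complex.re_ofReal_mul, Complex.im_ofReal_mul, Real.arcsin_sin (abs_le.1 a1).1 (abs_le.1 a1).2, Real.arcsin_sin (abs_le.1 a2).1 (abs_le.1 a2).2]
      congr 1
      conv_rhs => rw [← Complex.re_add_im z]
      have : (s : ℂ) ≠ 0 := by exact_mod_cast hs0.ne'
      push_cast
      field_simp
    rwa [e] at h1

lemma trig_seq {μ : ℂ → ℂ} (hμ : Measurable μ) {k : ℝ} (hk0 : 0 ≤ k) (hk : k < 1) (hb : ∀ᵐ z : ℂ, ‖μ z‖ ≤ k) :
    ∃ k' : ℝ, 0 ≤ k' ∧ k' < 1 ∧ ∃ (N : ℕ → ℂ → ℂ) (s : ℕ → ℝ), (∀ n, TrigPoly (N n)) ∧ (∀ n, 0 < s n) ∧ (∀ n z, ‖N n z‖ ≤ k') ∧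
      ∀ᵐ z : ℂ, Tendsto (fun n => N n (s n * z)) atTop (𝓝 (μ z)) := by
  have hint : ∀ n : ℕ, Integrable ((Metric.closedBall (0:ℂ) n).indicator μ) volume := by
    intro n
    rw [integrable_indicator_iff Metric.isClosed_closedBall.measurableSet]
    refine Measure.integrableOn_of_bounded (M := k) (isCompact_closedBall _ _).measure_lt_top.ne hμ.aestronglyMeasurable (ae_restrict_of_ae hb)
  have hg : ∀ n : ℕ, ∃ g : ℂ → ℂ, HasCompactSupport g ∧ ∫⁻ x, ‖(Metric.closedBall (0:ℂ) n).indicator μ x - g x‖ₑ ≤ (2⁻¹ : ENNReal) ^ n ∧ Continuous g ∧ Integrable g volume :=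
    fun n => (hint n).exists_hasCompactSupport_lintegral_sub_le (by simp)
  choose g _ hg1 hg2 _ using hg
  have hconv : ∀ᵐ z : ℂ, Tendsto (fun n => g n z) atTop (𝓝 (μ z)) := by
    have hm : ∀ n : ℕ, AEMeasurable (fun x => ‖(Metric.closedBall (0:ℂ) n).indicator μ x - g n x‖ₑ) volume := by
      intro n
      exact ((hμ.indicator Metric.isClosed_closedBall.measurableSet).sub (hg2 n).measurable).enorm.aemeasurable
    have hfin : ∫⁻ x, ∑' n : ℕ, ‖(Metric.closedBall (0:ℂ) n).indicator μ x - g n x‖ₑ ≠ ⊤ := by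
      rw [lintegral_tsum hm]
      refine ((ENNReal.tsum_le_tsum hg1).trans_lt ?_).ne
      rw [ENNReal.tsum_geometric]
      simp
    filter_upwards [ae_lt_top' (AEMeasurable.ennreal_tsum hm) hfin] with z hz
    have h1 := ENNReal.tendsto_atTop_zero_of_tsum_ne_top hz.ne
    rw [tendsto_iff_edist_tendsto_0]
    refine h1.congr' ?_
    filter_upwards [eventually_ge_atTop ⌈‖z‖⌉₊] with n hn
    have : z ∈ Metric.closedBall (0:ℂ) n := by
      rw [mem_closedBall_zero_iff]
      exact (Nat.le_ceil _).trans (by exact_mod_cast hn)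
    rw [indicator_of_mem this, edist_comm, edist_eq_enorm_sub]
  set k₁ := (2 * k + 1) / 3 with hk₁
  have hk₁0 : 0 < k₁ := by positivity
  have hkk : k ≤ k₁ := by linarith
  set clip : ℂ → ℂ := fun w => w * ((k₁ / max k₁ ‖w‖ : ℝ) : ℂ) with hclip
  have hcc : Continuous clip := by
    refine continuous_id.mul (Complex.continuous_ofReal.comp (continuous_const.div (by fun_prop) (fun w => (lt_max_of_lt_left hk₁0).ne')))
  have hcb : ∀ w, ‖clip w‖ ≤ k₁ := by
    intro w
    have hp : 0 < max k₁ ‖w‖ := lt_max_of_lt_left hk₁0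
    rw [hclip, norm_mul, Complex.norm_real, Real.norm_of_nonneg (by positivity), mul_div_assoc', div_le_iff₀ hp, mul_comm]
    gcongr
    exact le_max_right _ _
  have hci : ∀ w, ‖w‖ ≤ k → clip w = w := by
    intro w hw
    simp only [hclip]
    rw [max_eq_left (hw.trans hkk), div_self hk₁0.ne']; simp
  set δ := (1 - k) / 6 with hδ
  have hδ0 : 0 < δ := by rw [hδ]; linarith
  have hN : ∀ n : ℕ, ∃ (N : ℂ → ℂ) (s : ℝ), TrigPoly N ∧ 0 < s ∧ (∀ z, ‖N z‖ ≤ k₁ + δ / (n + 1)) ∧ ∀ z, ‖z‖ ≤ n + 1 → ‖N (s * z) - clip (g n z)‖ ≤ δ / (n + 1) :=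
    fun n => trig_approx (hcc.comp (hg2 n)) (fun z => hcb _) (by positivity) (by positivity)
  choose N s h1 h2 h3 h4 using hN
  refine ⟨k₁ + δ, by positivity, by rw [hδ, hk₁]; linarith, N, s, h1, h2, fun n z => (h3 n z).trans ?_, ?_⟩
  · gcongr
    exact div_le_self hδ0.le (by linarith [(Nat.cast_nonneg n : (0:ℝ) ≤ n)])
  · filter_upwards [hconv, hb] with z hz hbz
    have t1 : Tendsto (fun n => clip (g n z)) atTop (𝓝 (μ z)) := by
      have := (hcc.tendsto (μ z)).comp hz
      rwa [hci _ hbz] at this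
    have t2 : Tendsto (fun n => N n (s n * z) - clip (g n z)) atTop (𝓝 0) := by
      have t3 : Tendsto (fun n : ℕ => δ / ((n:ℝ) + 1)) atTop (𝓝 0) := by
        have := (tendsto_one_div_add_atTop_nhds_zero_nat (𝕜 := ℝ)).const_mul δ
        simpa [div_eq_mul_inv] using this
      refine squeeze_zero_norm' ?_ t3
      filter_upwards [eventually_ge_atTop ⌈‖z‖⌉₊] with n hn
      apply h4
      have := (Nat.le_ceil ‖z‖).trans (by exact_mod_cast hn : ((⌈‖z‖⌉₊ : ℕ) : ℝ) ≤ n)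
      linarith
    simpa using t2.add t1

end MRM

namespace MRM
open Set Filter Topology ComplexConjugate

structure Sol (k C : ℝ) (m f : ℂ → ℂ) : Prop where
  smooth : ContDiff ℝ (⊤ : ℕ∞) f
  homeo : IsHomeomorph f
  nqs : NQS C f
  mcont : Continuous m
  bd : ∀ z, ‖m z‖ ≤ k
  eq : ∀ z, wderivBar f z = m z * wderiv f z

lemma normalise {N : ℂ → ℂ} (hN : TrigPoly N) {k : ℝ} (hk0 : 0 ≤ k) (hk1 : k < 1) (hk : ∀ z, ‖N z‖ ≤ k) {s : ℝ} (hs : 0 < s) :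
    ∃ f : ℂ → ℂ, ContDiff ℝ (⊤ : ℕ∞) f ∧ IsHomeomorph f ∧ f 0 = 0 ∧ f 1 = 1 ∧ ∀ z, wderivBar f z = N (s * z) * wderiv f z := by
  obtain ⟨g, hg, hh, he⟩ := torus_diffeo hN hk0 hk1 hk
  have hs' : (s : ℂ) ≠ 0 := by exact_mod_cast hs.ne'
  have hne : g s - g 0 ≠ 0 := sub_ne_zero.2 (fun h => hs' (hh.injective h))
  set α := (g s - g 0)⁻¹ with hα
  have hα0 : α ≠ 0 := inv_ne_zero hne
  set L : ℂ →L[ℝ] ℂ := s • ContinuousLinearMap.id ℝ ℂ with hL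
  have hLz : ∀ z, L z = s * z := fun z => by simp [hL]
  set f : ℂ → ℂ := fun z => α * (g (L z) - g 0) with hf
  have hd : ∀ z, HasFDerivAt f (α • ((fderiv ℝ g (s * z)).comp L)) z := by
    intro z
    have h1 : HasFDerivAt g (fderiv ℝ g (L z)) (L z) := (smooth_diff hg _).hasFDerivAt
    have h2 := ((h1.comp z L.hasFDerivAt).sub_const (g 0)).const_mul α
    rw [hLz] at h2
    exact h2
  have hd1 : ∀ z u, fderiv ℝ f z u = α * s * fderiv ℝ g (s * z) u := by
    intro z u
    rw [(hd z).fderiv]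
    have : L u = s • u := by simp [hL]
    change α * (fderiv ℝ g (s * z) (L u)) = _
    rw [this, map_smul, Complex.real_smul]
    ring
  refine ⟨f, contDiff_const.mul ((hg.comp L.contDiff).sub contDiff_const), ?_, ?_, ?_, fun z => ?_⟩
  · have i1 : IsHomeomorph (fun z : ℂ => s * z) := (Homeomorph.mulLeft₀ (s : ℂ) hs').isHomeomorph
    have i2 : IsHomeomorph (fun z : ℂ => α * z) := (Homeomorph.mulLeft₀ α hα0).isHomeomorph
    have i3 : IsHomeomorph (fun z : ℂ => z - g 0) := (Homeomorph.subRight (g 0)).isHomeomorph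
    have := i2.comp (i3.comp (hh.comp i1))
    convert this using 1
    ext z; simp [hf, hLz]
  · simp [hf]
  · simp [hf, hLz, hα, inv_mul_cancel₀ hne]
  · have := he (s * z)
    simp only [wderiv, wderivBar] at this ⊢
    rw [hd1, hd1]
    linear_combination α * s * this

theorem approx {μ : ℂ → ℂ} (hμ : Measurable μ) {k : ℝ} (hk0 : 0 ≤ k) (hk : k < 1) (hb : ∀ᵐ z : ℂ, ‖μ z‖ ≤ k) :
    ∃ k' C : ℝ, 0 ≤ k' ∧ k' < 1 ∧ 0 < C ∧ ∃ (m f : ℕ → ℂ → ℂ), (∀ n, Sol k' C (m n) (f n)) ∧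
      ∀ᵐ z : ℂ, Tendsto (fun n => m n z) atTop (𝓝 (μ z)) := by
  obtain ⟨k', hk'0, hk'1, N, s, h1, h2, h3, h4⟩ := trig_seq hμ hk0 hk hb
  obtain ⟨C, hC, hwqs⟩ := exists_wqs ((1 + k') / (1 - k')) (div_nonneg (by linarith) (by linarith))
  choose f f1 f2 f3 f4 f5 using fun n => normalise (h1 n) hk'0 hk'1 (h3 n) (h2 n)
  refine ⟨k', C, hk'0, hk'1, hC, fun n z => N n (s n * z), f, fun n => ⟨f1 n, f2 n, ⟨?_, f3 n, f4 n⟩, ?_, fun z => h3 n _, f5 n⟩, h4⟩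
  · have hd : ∀ z, ‖lb (fderiv ℝ (f n) z)‖ ≤ k' * ‖la (fderiv ℝ (f n) z)‖ := by
      intro z
      change ‖wderivBar (f n) z‖ ≤ k' * ‖wderiv (f n) z‖
      rw [f5, norm_mul]; gcongr; exact h3 n _
    exact hwqs (f n) ((f1 n).of_le le_top_one) (f2 n) (fun z => (clm_dist hk'0 hk'1 (hd z)).2.1) (fun z => (clm_dist hk'0 hk'1 (hd z)).1)
  · have := (h1 n).contDiff.continuous
    fun_prop
end MRM

namespace MRM
open Set Filter Topology ComplexConjugate

structure Lim (k C : ℝ) (m f : ℕ → ℂ → ℂ) (μ Φ : ℂ → ℂ) : Prop where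
  k0 : 0 ≤ k
  k1 : k < 1
  C0 : 0 < C
  sol : ∀ n, Sol k C (m n) (f n)
  mlim : ∀ᵐ z : ℂ, Tendsto (fun n => m n z) atTop (𝓝 (μ z))
  nqs : NQS C Φ
  homeo : IsHomeomorph Φ
  flim : ∀ z, Tendsto (fun n => f n z) atTop (𝓝 (Φ z))
  glim : ∀ x, ∀ y : ℕ → ℂ, (∀ n, f n (y n) = Φ x) → Tendsto y atTop (𝓝 x)

theorem exists_lim {μ : ℂ → ℂ} (hμ : Measurable μ) {k : ℝ} (hk0 : 0 ≤ k) (hk : k < 1) (hb : ∀ᵐ z : ℂ, ‖μ z‖ ≤ k) :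
    ∃ k' C m f Φ, Lim k' C m f μ Φ := by
  obtain ⟨k', C, h0, h1, hC, m, f, hs, hm⟩ := approx hμ hk0 hk hb
  obtain ⟨Φ, hΦ, hh, l1, l2⟩ := wqs_limit C hC f (fun n => (hs n).nqs) (fun n => (hs n).homeo.surjective) (hyperfilter ℕ)
  obtain ⟨σ, hσ, hP⟩ := extraction_forall_of_frequently (P := fun j n => (∀ z, ‖z‖ ≤ (j:ℝ) → ‖f n z - Φ z‖ < 1 / ((j:ℝ) + 1)) ∧
      (∀ x y, ‖Φ x‖ ≤ (j:ℝ) → f n y = Φ x → ‖y - x‖ < 1 / ((j:ℝ) + 1))) (fun j => by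
    have := ((l1 j (1 / ((j:ℝ) + 1)) (by positivity)).and (l2 j (1 / ((j:ℝ) + 1)) (by positivity))).frequently
    exact this.filter_mono Nat.hyperfilter_le_atTop)
  refine ⟨k', C, fun n => m (σ n), fun n => f (σ n), Φ, h0, h1, hC, fun n => hs _, ?_, hΦ, hh, ?_, ?_⟩
  · filter_upwards [hm] with z hz using hz.comp hσ.tendsto_atTop
  · intro z
    rw [tendsto_iff_norm_sub_tendsto_zero]
    refine squeeze_zero' (Eventually.of_forall fun _ => norm_nonneg _) ?_ (tendsto_one_div_add_atTop_nhds_zero_nat (𝕜 := ℝ))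
    filter_upwards [eventually_ge_atTop ⌈‖z‖⌉₊] with n hn
    exact ((hP n).1 z ((Nat.le_ceil _).trans (by exact_mod_cast hn))).le
  · intro x y hy
    rw [tendsto_iff_norm_sub_tendsto_zero]
    refine squeeze_zero' (Eventually.of_forall fun _ => norm_nonneg _) ?_ (tendsto_one_div_add_atTop_nhds_zero_nat (𝕜 := ℝ))
    filter_upwards [eventually_ge_atTop ⌈‖Φ x‖⌉₊] with n hn
    exact ((hP n).2 x (y n) ((Nat.le_ceil _).trans (by exact_mod_cast hn)) (hy n)).le

/-- local energy bound -/
lemma Sol.energy {k C : ℝ} (hk0 : 0 ≤ k) (hk1 : k < 1) (hC : 0 ≤ C) (R : ℝ) :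
    ∃ M : ℝ, 0 ≤ M ∧ ∀ m f, Sol k C m f → ∫ z in Metric.closedBall 0 R, ‖wderiv f z‖ ^ 2 ≤ M := by
  obtain ⟨M, hM, h⟩ := wqs_upper C hC R
  have h1k : 0 < 1 - k ^ 2 := by nlinarith
  refine ⟨(1 - k ^ 2)⁻¹ * (volume (Metric.closedBall (0:ℂ) M)).toReal, by positivity, fun m f hf => ?_⟩
  have hB : MeasurableSet (Metric.closedBall (0:ℂ) R) := Metric.isClosed_closedBall.measurableSet
  have hd : ∀ z, 0 ≤ (fderiv ℝ f z).det ∧ (1 - k ^ 2) * ‖wderiv f z‖ ^ 2 ≤ (fderiv ℝ f z).det := by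
    intro z
    have : ‖lb (fderiv ℝ f z)‖ ≤ k * ‖la (fderiv ℝ f z)‖ := by
      change ‖wderivBar f z‖ ≤ k * ‖wderiv f z‖
      rw [hf.eq, norm_mul]; gcongr; exact hf.bd z
    exact ⟨(clm_dist hk0 hk1 this).1, (clm_dist hk0 hk1 this).2.2⟩
  have hcd : Continuous (fun z => (fderiv ℝ f z).det) :=
    ContinuousLinearMap.continuous_det.comp (fderiv_contDiff hf.smooth).continuous
  have hint : ∫ z in Metric.closedBall 0 R, (fderiv ℝ f z).det ≤ (volume (Metric.closedBall (0:ℂ) M)).toReal := by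
    have := integral_image_eq_integral_abs_det_fderiv_smul volume hB (f := f) (f' := fderiv ℝ f)
      (fun x _ => (smooth_diff hf.smooth x).hasFDerivAt.hasFDerivWithinAt) hf.homeo.injective.injOn (fun _ => (1:ℝ))
    simp only [smul_eq_mul, mul_one, abs_of_nonneg (hd _).1] at this
    rw [← this]
    simp only [integral_const, smul_eq_mul, mul_one, measureReal_restrict_apply_univ]
    refine ENNReal.toReal_mono (isCompact_closedBall _ _).measure_lt_top.ne (measure_mono ?_)
    rintro _ ⟨z, hz, rfl⟩
    rw [mem_closedBall_zero_iff] at hz ⊢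
    exact h f hf.nqs.wqs hf.nqs.zero hf.nqs.one z hz
  rw [inv_mul_eq_div, le_div_iff₀ h1k, mul_comm, ← integral_const_mul]
  refine le_trans (setIntegral_mono_on ?_ ?_ hB (fun z _ => (hd z).2)) hint
  · exact ((continuous_const.mul ((wderiv_contDiff hf.smooth).continuous.norm.pow 2)).continuousOn.integrableOn_compact (isCompact_closedBall _ _))
  · exact hcd.continuousOn.integrableOn_compact (isCompact_closedBall _ _)

end MRM

namespace MRM
open Set Filter Topology ComplexConjugate

lemma weak_hilbert {E : Type*} [NormedAddCommGroup E] [InnerProductSpace ℂ E] [CompleteSpace E] (u : ℕ → E) (M : ℝ) (hu : ∀ n, ‖u n‖ ≤ M)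
    (𝒰 : Ultrafilter ℕ) : ∃ w : E, ∀ v : E, Tendsto (fun n => inner ℂ (u n) v) 𝒰 (𝓝 (inner ℂ w v)) := by
  have hK := WeakDual.isCompact_closedBall (𝕜 := ℂ) (E := E) 0 M
  set T : ℕ → WeakDual ℂ E := fun n => StrongDual.toWeakDual (InnerProductSpace.toDual ℂ E (u n)) with hT
  have hmem : ∀ n, T n ∈ (WeakDual.toStrongDual ⁻¹' Metric.closedBall (0 : StrongDual ℂ E) M) := by
    intro n
    simp only [mem_preimage, mem_closedBall_zero_iff]
    exact ((InnerProductSpace.toDual ℂ E).norm_map (u n)).trans_le (hu n)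
  obtain ⟨x, _, hx⟩ := hK.ultrafilter_le_nhds' (𝒰.map T) (Filter.mem_map.2 (Filter.univ_mem' hmem))
  refine ⟨(InnerProductSpace.toDual ℂ E).symm (WeakDual.toStrongDual x), fun v => ?_⟩
  have h1 : Tendsto T 𝒰 (𝓝 x) := hx
  have h2 := ((WeakDual.eval_continuous (𝕜 := ℂ) v).tendsto x).comp h1
  rw [InnerProductSpace.toDual_symm_apply]
  exact h2

lemma L2_inner {ν : Measure ℂ} {u v : ℂ → ℂ} (hu : MemLp u 2 ν) (hv : MemLp v 2 ν) : inner ℂ (hu.toLp u) (hv.toLp v) = ∫ z, conj (u z) * v z ∂ν := by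
  rw [L2.inner_def]
  refine integral_congr_ae ?_
  filter_upwards [hu.coeFn_toLp, hv.coeFn_toLp] with z h1 h2
  rw [h1, h2, RCLike.inner_apply, mul_comm]

lemma L2_norm {ν : Measure ℂ} {u : ℂ → ℂ} (hu : MemLp u 2 ν) : ‖hu.toLp u‖ ^ 2 = ∫ z, ‖u z‖ ^ 2 ∂ν := by
  have h := inner_self_eq_norm_sq_to_K (𝕜 := ℂ) (hu.toLp u)
  rw [L2_inner] at h
  have e : ∀ z, conj (u z) * u z = ((‖u z‖ ^ 2 : ℝ) : ℂ) := fun z => by rw [Complex.conj_mul']; push_cast; rfl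
  simp only [e] at h
  rw [integral_complex_ofReal] at h
  have h2 : ((∫ z, ‖u z‖ ^ 2 ∂ν : ℝ) : ℂ) = ((‖hu.toLp u‖ ^ 2 : ℝ) : ℂ) := by rw [h]; push_cast; rfl
  exact (Complex.ofReal_injective h2).symm

lemma memLp_conj {ν : Measure ℂ} {u : ℂ → ℂ} (hu : MemLp u 2 ν) : MemLp (fun z => conj (u z)) 2 ν :=
  hu.of_le (Complex.continuous_conj.comp_aestronglyMeasurable hu.1) (Eventually.of_forall fun z => by simp)

lemma cs {ν : Measure ℂ} {u v : ℂ → ℂ} (hu : MemLp u 2 ν) (hv : MemLp v 2 ν) :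
    ‖∫ z, u z * v z ∂ν‖ ^ 2 ≤ (∫ z, ‖u z‖ ^ 2 ∂ν) * ∫ z, ‖v z‖ ^ 2 ∂ν := by
  have h := norm_inner_le_norm (𝕜 := ℂ) ((memLp_conj hu).toLp) (hv.toLp v)
  rw [L2_inner] at h
  simp only [Complex.conj_conj] at h
  calc _ ≤ (‖(memLp_conj hu).toLp‖ * ‖hv.toLp v‖) ^ 2 := by gcongr
    _ = _ := by rw [mul_pow, L2_norm, L2_norm]; simp

lemma cs_lim {ν : Measure ℂ} {u v : ℕ → ℂ → ℂ} {M : ℝ} (hu : ∀ n, MemLp (u n) 2 ν) (hv : ∀ n, MemLp (v n) 2 ν) (hM : ∀ n, ∫ z, ‖v n z‖ ^ 2 ∂ν ≤ M)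
    (h0 : Tendsto (fun n => ∫ z, ‖u n z‖ ^ 2 ∂ν) atTop (𝓝 0)) : Tendsto (fun n => ∫ z, u n z * v n z ∂ν) atTop (𝓝 0) := by
  have h1 : Tendsto (fun n => ‖∫ z, u n z * v n z ∂ν‖ ^ 2) atTop (𝓝 0) := by
    refine squeeze_zero (fun n => by positivity) (fun n => (cs (hu n) (hv n)).trans ?_) (by simpa using h0.mul_const M)
    gcongr
    exact hM n
  have h2 := (Real.continuous_sqrt.tendsto 0).comp h1
  rw [tendsto_zero_iff_norm_tendsto_zero]
  simpa [Function.comp_def, Real.sqrt_sq] using h2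

lemma weak_L2 {ν : Measure ℂ} (u : ℕ → ℂ → ℂ) (hu : ∀ n, MemLp (u n) 2 ν) (M : ℝ) (hM : ∀ n, ∫ z, ‖u n z‖ ^ 2 ∂ν ≤ M) :
    ∃ H : ℂ → ℂ, MemLp H 2 ν ∧ ∀ φ, MemLp φ 2 ν → Tendsto (fun n => ∫ z, u n z * φ z ∂ν) (hyperfilter ℕ) (𝓝 (∫ z, H z * φ z ∂ν)) := by
  obtain ⟨w, hw⟩ := weak_hilbert (fun n => (hu n).toLp (u n)) (√M) (fun n => Real.le_sqrt_of_sq_le (by rw [L2_norm]; exact hM n)) (hyperfilter ℕ)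
  refine ⟨w, Lp.memLp w, fun φ hφ => ?_⟩
  have h1 := hw ((memLp_conj hφ).toLp)
  have h2 := (Complex.continuous_conj.tendsto _).comp h1
  have e1 : ∀ u (hu : MemLp u 2 ν), conj (inner ℂ (hu.toLp u) ((memLp_conj hφ).toLp)) = ∫ z, u z * φ z ∂ν := by
    intro u hu
    rw [L2_inner, ← integral_conj]
    simp
  have e2 := e1 w (Lp.memLp w)
  rw [Lp.toLp_coeFn] at e2
  rw [e2] at h2
  exact h2.congr (fun n => e1 _ (hu n))

def Ann (j : ℕ) : Set ℂ := {z | ⌊‖z‖⌋₊ = j}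

lemma Ann_meas (j : ℕ) : MeasurableSet (Ann j) := (Nat.measurable_floor.comp measurable_norm) (measurableSet_singleton j)

lemma Ann_sub (j : ℕ) : Ann j ⊆ Metric.closedBall 0 (j + 1) := by
  intro z hz
  rw [mem_closedBall_zero_iff]
  have : ⌊‖z‖⌋₊ = j := hz
  rw [← this]
  exact (Nat.lt_floor_add_one _).le

lemma ball_sub (J : ℕ) : Metric.closedBall (0:ℂ) J ⊆ ⋃ j ∈ Finset.range (J + 1), Ann j := by
  intro z hz
  rw [mem_closedBall_zero_iff] at hz
  simp only [mem_iUnion]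
  refine ⟨⌊‖z‖⌋₊, ?_, rfl⟩
  rw [Finset.mem_range, Nat.lt_succ_iff]
  exact Nat.floor_le_of_le hz

lemma Ann_disj : Pairwise (Function.onFun Disjoint Ann) := by
  intro i j hij
  rw [Function.onFun, Set.disjoint_left]
  intro z hz hz'
  exact hij (hz.symm.trans hz')

lemma weak_loc (u : ℕ → ℂ → ℂ) (hu : ∀ n, Continuous (u n)) (hM : ∀ R : ℝ, ∃ M, ∀ n, ∫ z in Metric.closedBall 0 R, ‖u n z‖ ^ 2 ≤ M) :
    ∃ H : ℂ → ℂ, (∀ R : ℝ, MemLp H 2 (volume.restrict (Metric.closedBall 0 R))) ∧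
      ∀ φ (R : ℝ), MemLp φ 2 volume → (∀ z, R < ‖z‖ → φ z = 0) →
        Tendsto (fun n => ∫ z, u n z * φ z) (hyperfilter ℕ) (𝓝 (∫ z, H z * φ z)) := by
  have hmc : ∀ n (R : ℝ), MemLp (u n) 2 (volume.restrict (Metric.closedBall 0 R)) := by
    intro n R
    rw [memLp_two_iff_integrable_sq_norm (hu n).aestronglyMeasurable]
    exact ((hu n).norm.pow 2).continuousOn.integrableOn_compact (isCompact_closedBall _ _)
  have hmA : ∀ n j, MemLp (u n) 2 (volume.restrict (Ann j)) := fun n j => (hmc n _).mono_measure (Measure.restrict_mono (Ann_sub j) le_rfl)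
  have hb : ∀ j, ∃ H : ℂ → ℂ, MemLp H 2 (volume.restrict (Ann j)) ∧ ∀ φ, MemLp φ 2 (volume.restrict (Ann j)) →
      Tendsto (fun n => ∫ z in Ann j, u n z * φ z) (hyperfilter ℕ) (𝓝 (∫ z in Ann j, H z * φ z)) := by
    intro j
    obtain ⟨M, hM⟩ := hM (j + 1)
    refine weak_L2 u (fun n => hmA n j) M (fun n => le_trans ?_ (hM n))
    refine setIntegral_mono_set (((hu n).norm.pow 2).continuousOn.integrableOn_compact (isCompact_closedBall _ _)) ?_ (Ann_sub j).eventuallyLE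
    exact Eventually.of_forall fun z => by positivity
  choose H hH hHl using hb
  set G : ℂ → ℂ := fun z => H ⌊‖z‖⌋₊ z with hG
  have hGA : ∀ j, ∀ᵐ z ∂(volume.restrict (Ann j)), H j z = G z := by
    intro j
    filter_upwards [ae_restrict_mem (Ann_meas j)] with z hz
    have : ⌊‖z‖⌋₊ = j := hz
    simp only [hG, this]
  have hGm : ∀ j, MemLp G 2 (volume.restrict (Ann j)) := fun j => (memLp_congr_ae (hGA j)).1 (hH j)
  have hGl : ∀ j φ, MemLp φ 2 (volume.restrict (Ann j)) →
      Tendsto (fun n => ∫ z in Ann j, u n z * φ z) (hyperfilter ℕ) (𝓝 (∫ z in Ann j, G z * φ z)) := by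
    intro j φ hφ
    rw [← integral_congr_ae (f := fun z => H j z * φ z) (by filter_upwards [hGA j] with z hz; rw [hz])]
    exact hHl j φ hφ
  have hmeas : AEStronglyMeasurable G volume := by
    have : AEStronglyMeasurable G (volume.restrict (⋃ j, Ann j)) := aestronglyMeasurable_iUnion_iff.2 fun j => (hGm j).1
    rwa [show (⋃ j, Ann j) = univ from eq_univ_of_forall fun z => mem_iUnion.2 ⟨_, rfl⟩, Measure.restrict_univ] at this
  refine ⟨G, fun R => ?_, fun φ R hφ hR => ?_⟩
  · rw [memLp_two_iff_integrable_sq_norm hmeas.restrict]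
    have : IntegrableOn (fun z => ‖G z‖ ^ 2) (⋃ j ∈ Finset.range (⌈R⌉₊ + 1), Ann j) volume := by
      rw [integrableOn_finset_iUnion]
      intro j _
      exact (memLp_two_iff_integrable_sq_norm hmeas.restrict).1 (hGm j)
    refine this.mono_set (Subset.trans (Metric.closedBall_subset_closedBall (Nat.le_ceil R)) (ball_sub _))
  · have key : ∀ v : ℂ → ℂ, (∀ j, MemLp v 2 (volume.restrict (Ann j))) → ∫ z, v z * φ z = ∑ j ∈ Finset.range (⌈R⌉₊ + 1), ∫ z in Ann j, v z * φ z := by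
      intro v hv
      rw [← integral_biUnion_finset (f := fun z => v z * φ z) _ (fun j _ => Ann_meas j) (fun i _ j _ hij => Ann_disj hij) (fun j _ => (hv j).integrable_mul (hφ.restrict _))]
      rw [setIntegral_eq_integral_of_forall_compl_eq_zero]
      intro z hz
      rw [hR z, mul_zero]
      by_contra! h
      exact hz (ball_sub _ (mem_closedBall_zero_iff.2 (h.trans (Nat.le_ceil R))))
    rw [key G hGm]
    simp only [fun n => key (u n) (hmA n)]
    exact tendsto_finsetSum _ fun j _ => hGl j φ (hφ.restrict _)

end MRM

namespace MRM
open Set Filter Topology ComplexConjugate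

variable {k C : ℝ} {m f : ℕ → ℂ → ℂ} {μ Φ : ℂ → ℂ}

lemma Lim.mu_bd (h : Lim k C m f μ Φ) : ∀ᵐ z : ℂ, ‖μ z‖ ≤ k := by
  filter_upwards [h.mlim] with z hz
  exact le_of_tendsto hz.norm (Eventually.of_forall fun n => (h.sol n).bd z)

lemma Lim.mdiff (h : Lim k C m f μ Φ) (hμ : Measurable μ) {W : ℂ → ℂ} {S : Set ℂ} (hW : MemLp W 2 (volume.restrict S)) :
    (∀ n, MemLp (fun z => (m n z - μ z) * W z) 2 (volume.restrict S)) ∧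
    Tendsto (fun n => ∫ z in S, ‖(m n z - μ z) * W z‖ ^ 2) atTop (𝓝 0) := by
  have hm : ∀ n, AEStronglyMeasurable (fun z => (m n z - μ z) * W z) (volume.restrict S) := fun n =>
    ((h.sol n).mcont.aestronglyMeasurable.sub hμ.aestronglyMeasurable).mul hW.1
  have hle : ∀ n, ∀ᵐ z ∂(volume.restrict S), ‖(m n z - μ z) * W z‖ ≤ 2 * ‖W z‖ := by
    intro n
    filter_upwards [ae_restrict_of_ae h.mu_bd] with z hz
    rw [norm_mul]
    gcongr
    have := (h.sol n).bd z
    exact (norm_sub_le _ _).trans (by linarith [h.k1])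
  refine ⟨fun n => hW.of_le_mul (hm n) (hle n), ?_⟩
  have := tendsto_integral_of_dominated_convergence (μ := volume.restrict S) (F := fun n z => ‖(m n z - μ z) * W z‖ ^ 2) (f := fun _ => (0:ℝ))
    (fun z => 4 * ‖W z‖ ^ 2) (fun n => ((hm n).norm.pow 2)) (((memLp_two_iff_integrable_sq_norm hW.1).1 hW).const_mul 4) ?_ ?_
  · simpa using this
  · intro n
    filter_upwards [hle n] with z hz
    rw [Real.norm_of_nonneg (by positivity)]
    calc _ ≤ (2 * ‖W z‖) ^ 2 := by gcongr
      _ = _ := by ring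
  · filter_upwards [ae_restrict_of_ae h.mlim] with z hz
    have : Tendsto (fun n => (m n z - μ z) * W z) atTop (𝓝 0) := by
      simpa using (hz.sub_const (μ z)).mul_const (W z)
    simpa using this.norm.pow 2

lemma exists_supp {φ : ℂ → ℂ} (hc : HasCompactSupport φ) : ∃ R : ℝ, 0 ≤ R ∧ ∀ z, R < ‖z‖ → φ z = 0 := by
  obtain ⟨R, hR⟩ := hc.isBounded.subset_closedBall 0
  refine ⟨max R 0, le_max_right _ _, fun z hz => ?_⟩
  by_contra h
  have := hR (subset_tsupport _ (Function.mem_support.2 h))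
  rw [mem_closedBall_zero_iff] at this
  exact absurd hz (not_lt.2 (this.trans (le_max_left _ _)))

lemma integral_ball_of {v : ℂ → ℂ} {R : ℝ} (h : ∀ z, R < ‖z‖ → v z = 0) : ∫ z in Metric.closedBall 0 R, v z = ∫ z, v z := by
  apply setIntegral_eq_integral_of_forall_compl_eq_zero
  intro z hz
  exact h z (by simpa using hz)

lemma ibp {u φ : ℂ → ℂ} (hu : ContDiff ℝ 1 u) (hφ : ContDiff ℝ 1 φ) (hc : HasCompactSupport φ) (d : ℂ) :
    ∫ z, u z * fderiv ℝ φ z d = - ∫ z, fderiv ℝ u z d * φ z := by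
  have hu' : Continuous (fun z => fderiv ℝ u z d) := (hu.continuous_fderiv one_ne_zero).clm_apply continuous_const
  have hφ' : Continuous (fun z => fderiv ℝ φ z d) := (hφ.continuous_fderiv one_ne_zero).clm_apply continuous_const
  have hc' : HasCompactSupport (fun z => fderiv ℝ φ z d) := (hc.fderiv (𝕜 := ℝ)).comp_left (g := fun L : ℂ →L[ℝ] ℂ => L d) (by simp)
  exact integral_mul_fderiv_eq_neg_fderiv_mul_of_integrable
    ((hu'.mul hφ.continuous).integrable_of_hasCompactSupport hc.mul_left)
    ((hu.continuous.mul hφ').integrable_of_hasCompactSupport hc'.mul_left)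
    ((hu.continuous.mul hφ.continuous).integrable_of_hasCompactSupport hc.mul_left)
    (fun x _ => hu.differentiable one_ne_zero x) (fun x _ => hφ.differentiable one_ne_zero x)

theorem Lim.exists_derivs (h : Lim k C m f μ Φ) (hμ : Measurable μ) : ∃ g h : ℂ → ℂ, HasWeakDerivsOn Set.univ Φ g h ∧
        ∀ᵐ z : ℂ, (g z + Complex.I * h z) / 2 = μ z * ((g z - Complex.I * h z) / 2) := by
  have hac : ∀ n, Continuous (wderiv (f n)) := fun n => (wderiv_contDiff (h.sol n).smooth).continuous
  have hen : ∀ R : ℝ, ∃ M, ∀ n, ∫ z in Metric.closedBall 0 R, ‖wderiv (f n) z‖ ^ 2 ≤ M := by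
    intro R
    obtain ⟨M, _, hM⟩ := Sol.energy h.k0 h.k1 h.C0.le R
    exact ⟨M, fun n => hM _ _ (h.sol n)⟩
  obtain ⟨H, hH, hHl⟩ := weak_loc (fun n => wderiv (f n)) hac hen
  have hmc : ∀ n (R : ℝ), MemLp (wderiv (f n)) 2 (volume.restrict (Metric.closedBall 0 R)) := by
    intro n R
    rw [memLp_two_iff_integrable_sq_norm (hac n).aestronglyMeasurable]
    exact ((hac n).norm.pow 2).continuousOn.integrableOn_compact (isCompact_closedBall _ _)
  have hμH : ∀ R : ℝ, MemLp (fun z => μ z * H z) 2 (volume.restrict (Metric.closedBall 0 R)) := by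
    intro R
    refine (hH R).of_le_mul (c := k) (hμ.aestronglyMeasurable.mul (hH R).1) ?_
    filter_upwards [ae_restrict_of_ae h.mu_bd] with z hz
    rw [norm_mul]; gcongr
  have hL : ∀ α β : ℂ, LocallyL2On univ (fun z => α * H z + β * (μ z * H z)) := by
    intro α β K _ hK
    obtain ⟨R, hR⟩ := hK.isBounded.subset_closedBall 0
    have : MemLp (fun z => α * H z + β * (μ z * H z)) 2 (volume.restrict (Metric.closedBall 0 R)) := ((hH R).const_mul α).add ((hμH R).const_mul β)
    exact IntegrableOn.mono_set ((memLp_two_iff_integrable_sq_norm this.1).1 this) hR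
  have main : ∀ (α β d : ℂ), (∀ n z, fderiv ℝ (f n) z d = α * wderiv (f n) z + β * (m n z * wderiv (f n) z)) →
      ∀ φ : ℂ → ℂ, ContDiff ℝ (⊤ : ℕ∞) φ → HasCompactSupport φ →
      (∫ z, Φ z * fderiv ℝ φ z d) = -∫ z, (α * H z + β * (μ z * H z)) * φ z := by
    intro α β d hfd φ hφ hc
    obtain ⟨R, hR0, hR⟩ := exists_supp hc
    have hc' : HasCompactSupport (fun z => fderiv ℝ φ z d) := (hc.fderiv (𝕜 := ℝ)).comp_left (g := fun L : ℂ →L[ℝ] ℂ => L d) (by simp)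
    obtain ⟨R', hR'0, hR'⟩ := exists_supp hc'
    have hφ2 : MemLp φ 2 volume := hφ.continuous.memLp_of_hasCompactSupport hc
    have hμφ : MemLp (fun z => μ z * φ z) 2 volume := by
      refine hφ2.of_le_mul (c := k) (hμ.aestronglyMeasurable.mul hφ2.1) ?_
      filter_upwards [h.mu_bd] with z hz
      rw [norm_mul]; gcongr
    have t1 := hHl φ R hφ2 hR
    have t2 := hHl (fun z => μ z * φ z) R hμφ (fun z hz => by rw [hR z hz, mul_zero])
    have t3 : Tendsto (fun n => ∫ z, wderiv (f n) z * ((m n z - μ z) * φ z)) (hyperfilter ℕ) (𝓝 0) := by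
      obtain ⟨M, hM⟩ := hen R
      have h1 := h.mdiff hμ (hφ2.restrict (Metric.closedBall 0 R))
      have := cs_lim h1.1 (fun n => hmc n R) hM h1.2
      refine (this.mono_left Nat.hyperfilter_le_atTop).congr (fun n => ?_)
      rw [integral_ball_of]
      · simp only [mul_comm]
      · intro z hz; rw [hR z hz]; simp
    have hfin : ∀ (v w : ℂ → ℂ), (∀ R : ℝ, MemLp v 2 (volume.restrict (Metric.closedBall 0 R))) → MemLp w 2 volume → (∀ z, R < ‖z‖ → w z = 0) → Integrable (fun z => v z * w z) volume := by
      intro v w hv hw hw0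
      have h1 : IntegrableOn (fun z => v z * w z) (Metric.closedBall 0 R) volume := (hv R).integrable_mul (hw.restrict _)
      refine h1.integrable_of_forall_notMem_eq_zero (fun z hz => ?_)
      rw [hw0 z (by simpa using hz), mul_zero]
    have t4 : Tendsto (fun n => ∫ z, f n z * fderiv ℝ φ z d) (hyperfilter ℕ) (𝓝 (-∫ z, (α * H z + β * (μ z * H z)) * φ z)) := by
      have hlim := ((t1.const_mul α).add ((t2.add t3).const_mul β)).neg
      have e1 : -∫ z, (α * H z + β * (μ z * H z)) * φ z = -(α * (∫ z, H z * φ z) + β * ((∫ z, H z * (μ z * φ z)) + 0)) := by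
        rw [add_zero, ← integral_const_mul, ← integral_const_mul, ← integral_add]
        · congr 2; ext z; ring
        · exact (hfin _ _ hH hφ2 hR).const_mul _
        · exact (hfin _ _ hH hμφ (fun z hz => by rw [hR z hz, mul_zero])).const_mul _
      rw [e1]
      refine hlim.congr (fun n => ?_)
      rw [ibp ((h.sol n).smooth.of_le le_top_one) (hφ.of_le le_top_one) hc]
      have hz2 : Integrable (fun z => wderiv (f n) z * ((m n z - μ z) * φ z)) := by
        refine hfin _ _ (hmc n) ?_ (fun z hz => by rw [hR z hz, mul_zero])
        have := (h.mdiff hμ (S := univ) (hφ2.restrict _)).1 n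
        rwa [Measure.restrict_univ] at this
      rw [← integral_add (hfin _ _ (hmc n) hμφ (fun z hz => by rw [hR z hz, mul_zero])) hz2, ← integral_const_mul, ← integral_const_mul, ← integral_add]
      · congr 2; ext z; rw [hfd]; ring
      · exact (hfin _ _ (hmc n) hφ2 hR).const_mul _
      · exact ((hfin _ _ (hmc n) hμφ (fun z hz => by rw [hR z hz, mul_zero])).add hz2).const_mul _
    have t5 : Tendsto (fun n => ∫ z, f n z * fderiv ℝ φ z d) atTop (𝓝 (∫ z, Φ z * fderiv ℝ φ z d)) := by
      obtain ⟨M, hM0, hM⟩ := wqs_upper C h.C0.le R'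
      have hcc : Continuous (fun z => fderiv ℝ φ z d) := (fderiv_apply_contDiff hφ d).continuous
      refine tendsto_integral_of_dominated_convergence (fun z => M * ‖fderiv ℝ φ z d‖) (fun n => ((h.sol n).smooth.continuous.mul hcc).aestronglyMeasurable)
        ((hcc.integrable_of_hasCompactSupport hc').norm.const_mul M) (fun n => Eventually.of_forall fun z => ?_) (Eventually.of_forall fun z => (h.flim z).mul_const _)
      rw [norm_mul]
      by_cases hz : ‖z‖ ≤ R'
      · gcongr
        exact hM _ (h.sol n).nqs.wqs (h.sol n).nqs.zero (h.sol n).nqs.one z hz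
      · rw [hR' z (not_le.1 hz)]; simp
    exact tendsto_nhds_unique (t5.mono_left Nat.hyperfilter_le_atTop) t4
  refine ⟨fun z => 1 * H z + 1 * (μ z * H z), fun z => Complex.I * H z + (-Complex.I) * (μ z * H z), ⟨hL _ _, hL _ _, fun φ hφ hc _ => ?_⟩, Eventually.of_forall fun z => ?_⟩
  · rw [setIntegral_univ, setIntegral_univ, setIntegral_univ, setIntegral_univ]
    refine ⟨main 1 1 1 (fun n z => ?_) φ hφ hc, main Complex.I (-Complex.I) Complex.I (fun n z => ?_) φ hφ hc⟩
    · rw [← (h.sol n).eq, clm_one, wderiv_eq, wderivBar_eq]; ring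
    · rw [← (h.sol n).eq, clm_I, wderiv_eq, wderivBar_eq]; ring
  · have := Complex.I_sq
    linear_combination (H z / 2 - μ z * H z / 2 + μ z * (H z - μ z * H z) / 2) * this
end MRM

namespace MRM
open Set Filter Topology ComplexConjugate

lemma moll {H : ℂ → ℂ} (hH : Continuous H) : ∃ u : ℕ → ℂ → ℂ, (∀ n, Differentiable ℝ (u n)) ∧
    (∀ n z, ∃ φ : ℂ → ℂ, ContDiff ℝ (⊤ : ℕ∞) φ ∧ HasCompactSupport φ ∧ ∀ d, fderiv ℝ (u n) z d = ∫ t, H t * fderiv ℝ φ t d) ∧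
    TendstoLocallyUniformly u H atTop := by
  let ρ : ℕ → ContDiffBump (0:ℂ) := fun n => ⟨1 / (2 * ((n:ℝ) + 1)), 1 / ((n:ℝ) + 1), by positivity, by
    apply one_div_lt_one_div_of_lt <;> linarith [(Nat.cast_nonneg n : (0:ℝ) ≤ n)]⟩
  let L := (ContinuousLinearMap.lsmul ℝ ℝ : ℝ →L[ℝ] ℂ →L[ℝ] ℂ)
  have hs : ∀ n, ContDiff ℝ (⊤:ℕ∞) ((ρ n).normed volume) := fun n => (ρ n).contDiff_normed
  have hcs : ∀ n, HasCompactSupport ((ρ n).normed volume) := fun n => (ρ n).hasCompactSupport_normed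
  have hder := fun n z => (hcs n).hasFDerivAt_convolution_right L.flip (μ := volume) hH.locallyIntegrable ((hs n).of_le le_top_one) z
  refine ⟨fun n => MeasureTheory.convolution H ((ρ n).normed volume) L.flip volume, fun n z => (hder n z).differentiableAt, fun n z => ?_, ?_⟩
  · refine ⟨fun t => -(((ρ n).normed volume (z - t) : ℝ) : ℂ), ?_, ?_, fun d => ?_⟩
    · exact (Complex.ofRealCLM.contDiff.comp ((hs n).comp (contDiff_const.sub contDiff_id))).neg
    · have h1 : HasCompactSupport (fun t => (ρ n).normed volume (z - t)) :=
        (hcs n).comp_homeomorph (Homeomorph.subLeft z)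
      exact h1.comp_left (g := fun x : ℝ => -(x:ℂ)) (by simp)
    · rw [(hder n z).fderiv, convolution_precompR_apply L.flip hH.locallyIntegrable ((hcs n).fderiv (𝕜 := ℝ)) (((hs n).of_le le_top_one).continuous_fderiv one_ne_zero)]
      simp only [convolution_def]
      congr 1; ext t
      have hd : HasFDerivAt (fun t => -(((ρ n).normed volume (z - t) : ℝ) : ℂ)) (-(Complex.ofRealCLM ∘L ((fderiv ℝ ((ρ n).normed volume) (z - t)) ∘L (-ContinuousLinearMap.id ℝ ℂ)))) t := by
        have h1 : HasFDerivAt ((ρ n).normed volume) (fderiv ℝ ((ρ n).normed volume) (z - t)) (z - t) :=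
          ((hs n).differentiable (by simp) _).hasFDerivAt
        have h2 : HasFDerivAt (fun t => z - t) (-ContinuousLinearMap.id ℝ ℂ) t := (hasFDerivAt_id t).const_sub z
        have h3 : HasFDerivAt (fun t => (ρ n).normed volume (z - t)) _ t := h1.comp t h2
        exact ((Complex.ofRealCLM.hasFDerivAt (x := (ρ n).normed volume (z - t))).comp t h3).neg
      rw [hd.fderiv]
      simp [L, mul_comm]
  · rw [Metric.tendstoLocallyUniformly_iff]
    intro ε hε x
    have hu : UniformContinuousOn H (Metric.closedBall x 2) := (isCompact_closedBall x 2).uniformContinuousOn_of_continuous hH.continuousOn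
    rw [Metric.uniformContinuousOn_iff] at hu
    obtain ⟨δ, hδ, hu⟩ := hu (ε / 2) (by positivity)
    refine ⟨Metric.ball x 1, Metric.ball_mem_nhds _ one_pos, ?_⟩
    have hl : ∀ᶠ n : ℕ in atTop, 1 / ((n:ℝ) + 1) < min δ 1 :=
      (tendsto_one_div_add_atTop_nhds_zero_nat (𝕜 := ℝ)).eventually (gt_mem_nhds (lt_min hδ one_pos))
    filter_upwards [hl] with n hn y hy
    rw [convolution_flip, dist_comm]
    refine lt_of_le_of_lt ((ρ n).dist_normed_convolution_le hH.aestronglyMeasurable (ε := ε / 2) (fun w hw => (hu w ?_ y ?_ ?_).le)) (by linarith)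
    · have h1 : dist w y < 1 / ((n:ℝ) + 1) := hw
      have h2 := dist_triangle w y x
      have h3 := min_le_right δ 1
      rw [Metric.mem_ball] at hy
      rw [Metric.mem_closedBall]; linarith
    · exact Metric.ball_subset_closedBall.trans (Metric.closedBall_subset_closedBall (by norm_num)) hy
    · have h1 : dist w y < 1 / ((n:ℝ) + 1) := hw
      exact h1.trans (hn.trans_le (min_le_left _ _))

lemma const_dir {H : ℂ → ℂ} (hH : Continuous H) (d : ℂ)
    (h : ∀ φ : ℂ → ℂ, ContDiff ℝ (⊤ : ℕ∞) φ → HasCompactSupport φ → ∫ t, H t * fderiv ℝ φ t d = 0) : H 0 = H d := by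
  obtain ⟨u, h1, h2, h3⟩ := moll hH
  have hu : ∀ n, u n 0 = u n d := by
    intro n
    have hd : ∀ s : ℝ, HasDerivAt (fun s : ℝ => u n (s * d)) 0 s := by
      intro s
      obtain ⟨φ, a, b, c⟩ := h2 n (s * d)
      have e : HasDerivAt (fun s : ℝ => (s:ℂ) * d) d s := by
        simpa using (Complex.ofRealCLM.hasDerivAt (x := s)).mul_const d
      have := (h1 n (s * d)).hasFDerivAt.comp_hasDerivAt s e
      rwa [c, h φ a b] at this
    have := is_const_of_deriv_eq_zero (fun s => (hd s).differentiableAt) (fun s => (hd s).deriv) 0 1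
    simpa using this
  have l0 := (tendstoLocallyUniformlyOn_univ.2 h3).tendsto_at (mem_univ 0)
  have l1 := (tendstoLocallyUniformlyOn_univ.2 h3).tendsto_at (mem_univ d)
  simp only [hu] at l0
  exact tendsto_nhds_unique l0 l1

lemma weyl {H : ℂ → ℂ} (hH : Continuous H)
    (h : ∀ φ : ℂ → ℂ, ContDiff ℝ (⊤ : ℕ∞) φ → HasCompactSupport φ → ∫ t, H t * wderivBar φ t = 0) : Differentiable ℂ H := by
  obtain ⟨u, h1, h2, h3⟩ := moll hH
  have hu : ∀ n, Differentiable ℂ (u n) := by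
    intro n z
    rw [differentiableAt_complex_iff_differentiableAt_real]
    refine ⟨h1 n z, ?_⟩
    obtain ⟨φ, a, b, c⟩ := h2 n z
    have e := h φ a b
    have hc : ∀ d, Integrable (fun t => H t * fderiv ℝ φ t d) := by
      intro d
      have hc' : HasCompactSupport (fun z => fderiv ℝ φ z d) := (b.fderiv (𝕜 := ℝ)).comp_left (g := fun L : ℂ →L[ℝ] ℂ => L d) (by simp)
      exact (hH.mul (fderiv_apply_contDiff a d).continuous).integrable_of_hasCompactSupport hc'.mul_left
    have e2 : ∫ t, H t * wderivBar φ t = (1/2) * ((∫ t, H t * fderiv ℝ φ t 1) + Complex.I * ∫ t, H t * fderiv ℝ φ t Complex.I) := by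
      rw [← integral_const_mul, ← integral_add (hc _) ((hc _).const_mul _), ← integral_const_mul]
      congr 1; ext t; unfold wderivBar; ring
    rw [e2, ← c, ← c] at e
    have := Complex.I_sq
    rw [smul_eq_mul]
    linear_combination (-2) * Complex.I * e + (fderiv ℝ (u n) z Complex.I) * this
  have := (tendstoLocallyUniformlyOn_univ.2 h3).differentiableOn (Eventually.of_forall fun n => (hu n).differentiableOn) isOpen_univ
  exact differentiableOn_univ.1 this

lemma meas_of_weak {Ψ g : ℂ → ℂ} (hΨ : Continuous Ψ) {d : ℂ} (hd : Ψ 0 ≠ Ψ d)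
    (h : ∀ φ : ℂ → ℂ, ContDiff ℝ (⊤ : ℕ∞) φ → HasCompactSupport φ → ∫ t, Ψ t * fderiv ℝ φ t d = -∫ t, g t * φ t) :
    AEStronglyMeasurable g volume := by
  by_contra hg
  have : ∃ N : ℕ, ¬ AEStronglyMeasurable g (volume.restrict (Metric.closedBall 0 N)) := by
    by_contra hN
    push Not at hN
    apply hg
    rw [← Measure.restrict_univ (μ := volume), ← Metric.iUnion_closedBall_nat (0:ℂ)]
    exact aestronglyMeasurable_iUnion_iff.2 hN
  obtain ⟨N, hN⟩ := this
  let ρ : ContDiffBump (0:ℂ) := ⟨N + 1, N + 2, by positivity, by linarith⟩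
  let φ0 : ℂ → ℂ := fun z => ((ρ z : ℝ) : ℂ)
  have s0 : ContDiff ℝ (⊤ : ℕ∞) φ0 := Complex.ofRealCLM.contDiff.comp ρ.contDiff
  have c0 : HasCompactSupport φ0 := ρ.hasCompactSupport.comp_left (g := fun x : ℝ => (x:ℂ)) (by simp)
  have n0 : ¬ Integrable (fun t => g t * φ0 t) := by
    intro hi
    apply hN
    refine (hi.aestronglyMeasurable.restrict (s := Metric.closedBall 0 N)).congr ?_
    filter_upwards [ae_restrict_mem Metric.isClosed_closedBall.measurableSet] with z hz
    have : ρ z = 1 := ρ.one_of_mem_closedBall (Metric.closedBall_subset_closedBall (by simp [ρ]) hz)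
    simp [φ0, this]
  apply hd
  apply const_dir hΨ
  have hc : ∀ φ : ℂ → ℂ, ContDiff ℝ (⊤ : ℕ∞) φ → HasCompactSupport φ → Integrable (fun t => Ψ t * fderiv ℝ φ t d) := by
    intro φ a b
    have hc' : HasCompactSupport (fun z => fderiv ℝ φ z d) := (b.fderiv (𝕜 := ℝ)).comp_left (g := fun L : ℂ →L[ℝ] ℂ => L d) (by simp)
    exact (hΨ.mul (fderiv_apply_contDiff a d).continuous).integrable_of_hasCompactSupport hc'.mul_left
  intro φ a b
  by_cases hi : Integrable (fun t => g t * φ t)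
  · have e0 := h φ0 s0 c0
    rw [integral_undef n0, neg_zero] at e0
    have e1 := h (fun t => φ0 t + φ t) (s0.add a) (c0.add b)
    rw [integral_undef (f := fun t => g t * (φ0 t + φ t)), neg_zero] at e1
    · have e2 : ∫ t, Ψ t * fderiv ℝ (fun t => φ0 t + φ t) t d = (∫ t, Ψ t * fderiv ℝ φ0 t d) + ∫ t, Ψ t * fderiv ℝ φ t d := by
        rw [← integral_add (hc _ s0 c0) (hc _ a b)]
        congr 1; ext t
        rw [fderiv_fun_add (smooth_diff s0 t) (smooth_diff a t)]
        simp [mul_add]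
      rw [e2, e0, zero_add] at e1
      exact e1
    · intro hi2
      apply n0
      convert hi2.sub hi using 1
      ext t; simp [mul_add]
  · rw [h φ a b, integral_undef hi, neg_zero]

lemma dslope_diff {H : ℂ → ℂ} (hd : Differentiable ℂ H) (a : ℂ) : Differentiable ℂ (dslope H a) := by
  rw [← differentiableOn_univ, Complex.differentiableOn_dslope univ_mem]
  exact hd.differentiableOn

lemma entire_inj {H : ℂ → ℂ} (hd : Differentiable ℂ H) (hh : IsHomeomorph H) (h0 : H 0 = 0) (h1 : H 1 = 1) (z : ℂ) : H z = z := by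
  have hinj := hh.injective
  obtain ⟨a, ha⟩ : ∃ a, deriv H a ≠ 0 := by
    by_contra hc
    push Not at hc
    have := is_const_of_deriv_eq_zero hd hc 0 1
    rw [h0, h1] at this; exact zero_ne_one this
  have hK := dslope_diff hd a
  have hKn : ∀ z, dslope H a z ≠ 0 := by
    intro z
    by_cases hz : z = a
    · rw [hz, dslope_same]; exact ha
    · rw [dslope_of_ne _ hz, slope_def_field]
      exact div_ne_zero (sub_ne_zero.2 (fun h => hz (hinj h))) (sub_ne_zero.2 hz)
  have hP : Differentiable ℂ (fun z => (dslope H a z)⁻¹) := hK.inv hKn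
  set P := fun z => (dslope H a z)⁻¹ with hPd
  have hQ := dslope_diff hP a
  have hbd : ∃ M, ∀ z, ‖dslope P a z‖ ≤ M := by
    have ht : Tendsto H (cocompact ℂ) (cocompact ℂ) := (hh.isClosedEmbedding).tendsto_cocompact
    have hev : ∀ᶠ z in cocompact ℂ, 1 ≤ ‖H z - H a‖ ∧ 1 ≤ ‖z - a‖ := by
      have t1 : ∀ b : ℂ, ∀ᶠ w in cocompact ℂ, 1 ≤ ‖w - b‖ := by
        intro b
        have := (isCompact_closedBall b 1).compl_mem_cocompact
        filter_upwards [this] with w hw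
        simp only [mem_compl_iff, Metric.mem_closedBall, not_le, dist_eq_norm] at hw
        exact hw.le
      exact (ht.eventually (t1 (H a))).and (t1 a)
    obtain ⟨S, hS, hS'⟩ := mem_cocompact.1 hev
    obtain ⟨M, hM⟩ := hS.exists_bound_of_continuousOn (f := dslope P a) hQ.continuous.continuousOn
    refine ⟨max M (1 + ‖P a‖), fun z => ?_⟩
    by_cases hz : z ∈ S
    · exact (hM z hz).trans (le_max_left _ _)
    · obtain ⟨b1, b2⟩ := hS' hz
      have hza : z ≠ a := by rintro rfl; simp at b2; linarith
      refine le_trans ?_ (le_max_right _ _)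
      rw [dslope_of_ne _ hza, slope_def_field, norm_div, div_le_iff₀ (by linarith)]
      have : ‖P z‖ ≤ ‖z - a‖ := by
        rw [hPd]; simp only
        rw [dslope_of_ne _ hza, slope_def_field, inv_div, norm_div]
        exact div_le_self (norm_nonneg _) b1
      have := norm_sub_le (P z) (P a)
      nlinarith [norm_nonneg (P a)]
  obtain ⟨M, hM⟩ := hbd
  have hconst : ∀ z, dslope P a z = dslope P a a := fun z =>
    hQ.apply_eq_apply_of_bounded (isBounded_iff_forall_norm_le.2 ⟨M, by rintro _ ⟨z, rfl⟩; exact hM z⟩) z a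
  set b := dslope P a a
  have hPz : ∀ z, P z = P a + b * (z - a) := by
    intro z
    have := sub_smul_dslope P a z
    rw [hconst, smul_eq_mul] at this
    linear_combination -this
  have hb : b = 0 := by
    by_contra hb
    have := hPz (a - P a / b)
    rw [show P a + b * (a - P a / b - a) = 0 by field_simp; ring] at this
    exact inv_ne_zero (hKn _) this
  have hKc : ∀ z, dslope H a z = dslope H a a := by
    intro z
    have := hPz z
    rw [hb, zero_mul, add_zero] at this
    exact inv_injective this
  have hHz : ∀ z, H z = H a + dslope H a a * (z - a) := by
    intro z
    have := sub_smul_dslope H a z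
    rw [hKc, smul_eq_mul] at this
    linear_combination -this
  have e0 := hHz 0
  have e1 := hHz 1
  rw [h0] at e0
  rw [h1] at e1
  have hc : dslope H a a = 1 := by linear_combination e0 - e1
  rw [hHz z, hc]
  rw [hc] at e0
  linear_combination -e0
end MRM

namespace MRM
open Set Filter Topology ComplexConjugate

lemma jac_identity {f φ : ℂ → ℂ} (hf : ContDiff ℝ (⊤ : ℕ∞) f) (hφ : ContDiff ℝ (⊤ : ℕ∞) φ) (z : ℂ) :
    wderivBar (fun z => wderiv f z * φ (f z)) z - wderiv (fun z => wderivBar f z * φ (f z)) z =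
      ((fderiv ℝ f z).det : ℂ) * wderivBar φ (f z) := by
  have hc : fderiv ℝ (fun z => φ (f z)) z = (fderiv ℝ φ (f z)) ∘L (fderiv ℝ f z) :=
    fderiv_comp z (smooth_diff hφ _) (smooth_diff hf _)
  have hcd : DifferentiableAt ℝ (fun z => φ (f z)) z := smooth_diff (hφ.comp hf) z
  rw [wdb_mul (smooth_diff (wderiv_contDiff hf) z) hcd, wd_mul (smooth_diff (wderivBar_contDiff hf) z) hcd, wderiv_comm hf]
  rw [wderivBar_eq (fun z => φ (f z)), wderiv_eq (fun z => φ (f z)), hc, clm_det, wderiv_eq f, wderivBar_eq f, wderivBar_eq φ]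
  set D := fderiv ℝ f z
  set E := fderiv ℝ φ (f z)
  have e1 : la (E ∘L D) = la E * la D + lb E * conj (lb D) := by
    rw [la]
    simp only [ContinuousLinearMap.comp_apply, clm_apply E, clm_one, clm_I, map_mul, map_add, map_sub, Complex.conj_I]
    have := Complex.I_sq
    linear_combination (-(la E * (la D - lb D)) + lb E * (conj (la D) - conj (lb D))) / 2 * this
  have e2 : lb (E ∘L D) = la E * lb D + lb E * conj (la D) := by
    rw [lb]
    simp only [ContinuousLinearMap.comp_apply, clm_apply E, clm_one, clm_I, map_mul, map_add, map_sub, Complex.conj_I]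
    have := Complex.I_sq
    linear_combination ((la E * (la D - lb D)) - lb E * (conj (la D) - conj (lb D))) / 2 * this
  rw [e1, e2]
  have n1 := Complex.mul_conj' (la D)
  have n2 := Complex.mul_conj' (lb D)
  push_cast
  linear_combination lb E * n1 - lb E * n2

structure WW (Ψ G1 G2 : ℂ → ℂ) : Prop where
  m1 : ∀ R : ℝ, MemLp G1 2 (volume.restrict (Metric.closedBall 0 R))
  m2 : ∀ R : ℝ, MemLp G2 2 (volume.restrict (Metric.closedBall 0 R))
  i1 : ∀ φ : ℂ → ℂ, ContDiff ℝ (⊤ : ℕ∞) φ → HasCompactSupport φ → ∫ t, Ψ t * wderiv φ t = -∫ t, G1 t * φ t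
  i2 : ∀ φ : ℂ → ℂ, ContDiff ℝ (⊤ : ℕ∞) φ → HasCompactSupport φ → ∫ t, Ψ t * wderivBar φ t = -∫ t, G2 t * φ t

lemma int_test {G φ : ℂ → ℂ} (hG : ∀ R : ℝ, MemLp G 2 (volume.restrict (Metric.closedBall 0 R))) (hφ : Continuous φ) (hc : HasCompactSupport φ) :
    Integrable (fun z => G z * φ z) := by
  obtain ⟨R, -, hR⟩ := exists_supp hc
  have h1 : IntegrableOn (fun z => G z * φ z) (Metric.closedBall 0 R) volume := (hG R).integrable_mul ((hφ.memLp_of_hasCompactSupport (p := 2) hc).restrict _)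
  refine h1.integrable_of_forall_notMem_eq_zero (fun z hz => ?_)
  rw [hR z (by simpa using hz), mul_zero]

lemma ww_of {Ψ g h : ℂ → ℂ} (hΨ : IsHomeomorph Ψ) (hw : HasWeakDerivsOn univ Ψ g h) :
    WW Ψ (fun z => (g z - Complex.I * h z) / 2) (fun z => (g z + Complex.I * h z) / 2) := by
  obtain ⟨lg, lh, hw⟩ := hw
  simp only [setIntegral_univ] at hw
  have mg : AEStronglyMeasurable g volume := meas_of_weak hΨ.continuous (d := 1) (fun e => zero_ne_one (hΨ.injective e))
    (fun φ a b => (hw φ a b (subset_univ _)).1)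
  have mh : AEStronglyMeasurable h volume := meas_of_weak hΨ.continuous (d := Complex.I) (fun e => Complex.I_ne_zero (hΨ.injective e).symm)
    (fun φ a b => (hw φ a b (subset_univ _)).2)
  have Lg : ∀ R : ℝ, MemLp g 2 (volume.restrict (Metric.closedBall 0 R)) := fun R =>
    (memLp_two_iff_integrable_sq_norm (mg.restrict)).2 (lg _ (subset_univ _) (isCompact_closedBall _ _))
  have Lh : ∀ R : ℝ, MemLp h 2 (volume.restrict (Metric.closedBall 0 R)) := fun R =>
    (memLp_two_iff_integrable_sq_norm (mh.restrict)).2 (lh _ (subset_univ _) (isCompact_closedBall _ _))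
  have hd : ∀ (φ : ℂ → ℂ) (d : ℂ), ContDiff ℝ (⊤ : ℕ∞) φ → HasCompactSupport φ → Integrable (fun t => Ψ t * fderiv ℝ φ t d) := by
    intro φ d a b
    have hc' : HasCompactSupport (fun z => fderiv ℝ φ z d) := (b.fderiv (𝕜 := ℝ)).comp_left (g := fun L : ℂ →L[ℝ] ℂ => L d) (by simp)
    exact (hΨ.continuous.mul (fderiv_apply_contDiff a d).continuous).integrable_of_hasCompactSupport hc'.mul_left
  refine ⟨fun R => ?_, fun R => ?_, fun φ a b => ?_, fun φ a b => ?_⟩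
  · have := ((Lg R).sub ((Lh R).const_mul Complex.I)).const_mul (1/2)
    refine this.ae_eq (Eventually.of_forall fun z => ?_)
    simp only [Pi.sub_apply]; ring
  · have := ((Lg R).add ((Lh R).const_mul Complex.I)).const_mul (1/2)
    refine this.ae_eq (Eventually.of_forall fun z => ?_)
    simp only [Pi.add_apply]; ring
  · have ig := int_test Lg a.continuous b
    have ih := int_test Lh a.continuous b
    have q1 : ∫ t, Ψ t * wderiv φ t = (1/2) * ((∫ t, Ψ t * fderiv ℝ φ t 1) - Complex.I * ∫ t, Ψ t * fderiv ℝ φ t Complex.I) := by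
      rw [← integral_const_mul, ← integral_sub (hd _ _ a b) ((hd _ _ a b).const_mul _), ← integral_const_mul]
      congr 1; ext t; unfold wderiv; ring
    have q2 : ∫ t, (g t - Complex.I * h t) / 2 * φ t = (1/2) * ((∫ t, g t * φ t) - Complex.I * ∫ t, h t * φ t) := by
      rw [← integral_const_mul, ← integral_sub ig (ih.const_mul _), ← integral_const_mul]
      congr 1; ext t; ring
    rw [q1, q2, (hw φ a b (subset_univ _)).1, (hw φ a b (subset_univ _)).2]; ring
  · have ig := int_test Lg a.continuous b
    have ih := int_test Lh a.continuous b
    have q1 : ∫ t, Ψ t * wderivBar φ t = (1/2) * ((∫ t, Ψ t * fderiv ℝ φ t 1) + Complex.I * ∫ t, Ψ t * fderiv ℝ φ t Complex.I) := by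
      rw [← integral_const_mul, ← integral_add (hd _ _ a b) ((hd _ _ a b).const_mul _), ← integral_const_mul]
      congr 1; ext t; unfold wderivBar; ring
    have q2 : ∫ t, (g t + Complex.I * h t) / 2 * φ t = (1/2) * ((∫ t, g t * φ t) + Complex.I * ∫ t, h t * φ t) := by
      rw [← integral_const_mul, ← integral_add ig (ih.const_mul _), ← integral_const_mul]
      congr 1; ext t; ring
    rw [q1, q2, (hw φ a b (subset_univ _)).1, (hw φ a b (subset_univ _)).2]; ring

lemma wdb_supp {φ : ℂ → ℂ} (b : HasCompactSupport φ) : HasCompactSupport (wderivBar φ) :=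
  (b.fderiv (𝕜 := ℝ)).comp_left (g := fun L : ℂ →L[ℝ] ℂ => (L 1 + Complex.I * L Complex.I) / 2) (by simp)
lemma wd_supp {φ : ℂ → ℂ} (b : HasCompactSupport φ) : HasCompactSupport (wderiv φ) :=
  (b.fderiv (𝕜 := ℝ)).comp_left (g := fun L : ℂ →L[ℝ] ℂ => (L 1 - Complex.I * L Complex.I) / 2) (by simp)

/-- pull back a test function -/
lemma pullback {k C : ℝ} {m f μ Ψ G1 G2 : ℂ → ℂ} (hk0 : 0 ≤ k) (hk1 : k < 1) (hf : Sol k C m f) (hΨ : Continuous Ψ) (hw : WW Ψ G1 G2)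
    (hB : ∀ᵐ z, G2 z = μ z * G1 z) {y : ℂ → ℂ} (hy : ∀ z, y (f z) = z) {φ : ℂ → ℂ} (hφ : ContDiff ℝ (⊤ : ℕ∞) φ) (hc : HasCompactSupport φ) :
    ∫ w, Ψ (y w) * wderivBar φ w = ∫ z, ((m z - μ z) * G1 z) * (wderiv f z * φ (f z)) := by
  have hcf : HasCompactSupport (fun z => φ (f z)) := hc.comp_isClosedEmbedding hf.homeo.isClosedEmbedding
  have s1 : ContDiff ℝ (⊤ : ℕ∞) (fun z => wderiv f z * φ (f z)) := (wderiv_contDiff hf.smooth).mul (hφ.comp hf.smooth)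
  have s2 : ContDiff ℝ (⊤ : ℕ∞) (fun z => wderivBar f z * φ (f z)) := (wderivBar_contDiff hf.smooth).mul (hφ.comp hf.smooth)
  have c1 : HasCompactSupport (fun z => wderiv f z * φ (f z)) := hcf.mul_left
  have c2 : HasCompactSupport (fun z => wderivBar f z * φ (f z)) := hcf.mul_left
  have hd : ∀ z, 0 ≤ (fderiv ℝ f z).det := by
    intro z
    have : ‖lb (fderiv ℝ f z)‖ ≤ k * ‖la (fderiv ℝ f z)‖ := by
      change ‖wderivBar f z‖ ≤ k * ‖wderiv f z‖
      rw [hf.eq, norm_mul]; gcongr; exact hf.bd z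
    exact (clm_dist hk0 hk1 this).1
  have cv := integral_image_eq_integral_abs_det_fderiv_smul volume MeasurableSet.univ (f := f) (f' := fderiv ℝ f)
      (fun x _ => (smooth_diff hf.smooth x).hasFDerivAt.hasFDerivWithinAt) hf.homeo.injective.injOn (fun w => Ψ (y w) * wderivBar φ w)
  rw [image_univ, hf.homeo.surjective.range_eq, setIntegral_univ, setIntegral_univ] at cv
  rw [cv]
  have e1 : ∀ z, |(fderiv ℝ f z).det| • (Ψ (y (f z)) * wderivBar φ (f z)) =
      Ψ z * wderivBar (fun z => wderiv f z * φ (f z)) z - Ψ z * wderiv (fun z => wderivBar f z * φ (f z)) z := by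
    intro z
    rw [← mul_sub, jac_identity hf.smooth hφ, abs_of_nonneg (hd z), hy, Complex.real_smul]; ring
  simp only [e1]
  have j1 : Integrable (fun z => Ψ z * wderivBar (fun z => wderiv f z * φ (f z)) z) :=
    (hΨ.mul (wderivBar_contDiff s1).continuous).integrable_of_hasCompactSupport (wdb_supp c1).mul_left
  have j2 : Integrable (fun z => Ψ z * wderiv (fun z => wderivBar f z * φ (f z)) z) :=
    (hΨ.mul (wderiv_contDiff s2).continuous).integrable_of_hasCompactSupport (wd_supp c2).mul_left
  rw [integral_sub j1 j2,
    hw.i2 _ s1 c1, hw.i1 _ s2 c2, neg_sub_neg, ← integral_sub (int_test hw.m1 s2.continuous c2) (int_test hw.m2 s1.continuous c1)]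
  apply integral_congr_ae
  filter_upwards [hB] with z hz
  rw [hz, hf.eq]; ring

theorem Lim.unique {k C : ℝ} {m f : ℕ → ℂ → ℂ} {μ Φ : ℂ → ℂ} (hl : Lim k C m f μ Φ) (hμ : Measurable μ) {Ψ g h : ℂ → ℂ}
    (hΨ : IsHomeomorph Ψ) (h0 : Ψ 0 = 0) (h1 : Ψ 1 = 1) (hw : HasWeakDerivsOn univ Ψ g h)
    (hB : ∀ᵐ z : ℂ, (g z + Complex.I * h z) / 2 = μ z * ((g z - Complex.I * h z) / 2)) : Ψ = Φ := by
  have hw := ww_of hΨ hw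
  set G1 : ℂ → ℂ := fun z => (g z - Complex.I * h z) / 2
  set G2 : ℂ → ℂ := fun z => (g z + Complex.I * h z) / 2
  let e : ∀ n, ℂ ≃ₜ ℂ := fun n => (hl.sol n).homeo.homeomorph
  have he : ∀ n z, e n z = f n z := fun _ _ => rfl
  let E : ℂ ≃ₜ ℂ := hl.homeo.homeomorph
  have hE : ∀ z, E z = Φ z := fun _ => rfl
  have hH : Continuous (fun w => Ψ (E.symm w)) := hΨ.continuous.comp E.symm.continuous
  have key : ∀ φ : ℂ → ℂ, ContDiff ℝ (⊤ : ℕ∞) φ → HasCompactSupport φ → ∫ t, Ψ (E.symm t) * wderivBar φ t = 0 := by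
    intro φ hφ hc
    obtain ⟨R1, -, hR1⟩ := exists_supp hc
    obtain ⟨R2, -, hR2⟩ := exists_supp (wdb_supp hc)
    obtain ⟨R, hR⟩ := wqs_proper C hl.C0 R1
    obtain ⟨R', hR'⟩ := wqs_proper C hl.C0 R2
    have t1 : Tendsto (fun n => ∫ w, Ψ ((e n).symm w) * wderivBar φ w) atTop (𝓝 (∫ t, Ψ (E.symm t) * wderivBar φ t)) := by
      obtain ⟨M, hM⟩ := (isCompact_closedBall (0:ℂ) R').exists_bound_of_continuousOn hΨ.continuous.continuousOn
      have hcc : Continuous (wderivBar φ) := (wderivBar_contDiff hφ).continuous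
      refine tendsto_integral_of_dominated_convergence (fun z => M * ‖wderivBar φ z‖) (fun n => ((hΨ.continuous.comp (e n).symm.continuous).mul hcc).aestronglyMeasurable)
        ((hcc.integrable_of_hasCompactSupport (wdb_supp hc)).norm.const_mul M) (fun n => Eventually.of_forall fun w => ?_) (Eventually.of_forall fun w => ?_)
      · rw [norm_mul]
        by_cases hw : ‖w‖ ≤ R2
        · gcongr
          apply hM
          rw [mem_closedBall_zero_iff]
          refine hR' _ (hl.sol n).nqs.wqs (hl.sol n).nqs.zero (hl.sol n).nqs.one _ ?_
          rwa [← he, (e n).apply_symm_apply]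
        · rw [hR2 w (not_le.1 hw)]; simp
      · refine Tendsto.mul_const _ ((hΨ.continuous.tendsto _).comp ?_)
        apply hl.glim
        intro n
        rw [← he, (e n).apply_symm_apply, ← hE, E.apply_symm_apply]
    have t2 : Tendsto (fun n => ∫ w, Ψ ((e n).symm w) * wderivBar φ w) atTop (𝓝 0) := by
      obtain ⟨M, hM0, hM⟩ := Sol.energy hl.k0 hl.k1 hl.C0.le R
      obtain ⟨B, hBd⟩ := hc.exists_bound_of_continuous hφ.continuous
      have hm := hl.mdiff hμ (hw.m1 R)
      have hcv : ∀ n, Continuous (fun z => wderiv (f n) z * φ (f n z)) := fun n =>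
        (wderiv_contDiff (hl.sol n).smooth).continuous.mul (hφ.continuous.comp (hl.sol n).smooth.continuous)
      have hi : ∀ F : ℂ → ℂ, Continuous F → IntegrableOn (fun z => ‖F z‖ ^ 2) (Metric.closedBall 0 R) volume := fun F hF =>
        (hF.norm.pow 2).continuousOn.integrableOn_compact (isCompact_closedBall _ _)
      have := cs_lim (ν := volume.restrict (Metric.closedBall 0 R)) (v := fun n z => wderiv (f n) z * φ (f n z)) (M := B ^ 2 * M) hm.1
        (fun n => (memLp_two_iff_integrable_sq_norm (hcv n).aestronglyMeasurable).2 (hi _ (hcv n))) (fun n => ?_) hm.2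
      · refine this.congr (fun n => ?_)
        rw [pullback hl.k0 hl.k1 (hl.sol n) hΨ.continuous hw hB (fun z => by rw [← he, (e n).symm_apply_apply]) hφ hc]
        apply integral_ball_of
        intro z hz
        rw [hR1, mul_zero, mul_zero]
        by_contra hcon
        exact absurd (hR _ (hl.sol n).nqs.wqs (hl.sol n).nqs.zero (hl.sol n).nqs.one z (not_lt.1 hcon)) (not_le.2 hz)
      · have hca := (wderiv_contDiff (hl.sol n).smooth).continuous
        calc _ ≤ ∫ z in Metric.closedBall 0 R, B ^ 2 * ‖wderiv (f n) z‖ ^ 2 := by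
              refine integral_mono (hi _ (hcv n)) ((hi _ hca).const_mul _) (fun z => ?_)
              simp only
              rw [norm_mul, mul_pow, mul_comm]
              gcongr
              exact hBd _
          _ ≤ _ := by
              rw [integral_const_mul]
              gcongr
              exact hM _ _ (hl.sol n)
    exact tendsto_nhds_unique t1 t2
  have hol := weyl hH key
  have hE0 : E.symm 0 = 0 := by rw [E.symm_apply_eq, hE]; exact hl.nqs.zero.symm
  have hE1 : E.symm 1 = 1 := by rw [E.symm_apply_eq, hE]; exact hl.nqs.one.symm
  have hid := entire_inj hol (hΨ.comp E.symm.isHomeomorph) (by simp [hE0, h0]) (by simp [hE1, h1])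
  ext z
  have := hid (Φ z)
  rwa [← hE, E.symm_apply_apply, hE] at this
end MRM

/-- **Measurable Riemann mapping theorem** (Morrey; Ahlfors–Bers).
For every measurable `μ : ℂ → ℂ` with `ess sup |μ| < 1` there is a unique
normalized homeomorphism `Φ : ℂ → ℂ` (fixing `0` and `1`) that has locally `L²`
distributional derivatives and satisfies the Beltrami equation
`∂Φ/∂z̄ = μ · ∂Φ/∂z` almost everywhere on `ℂ`. -/
theorem measurable_riemann_mapping
    (μ : ℂ → ℂ) (hμ : Measurable μ)
    (k : ℝ) (hk : k < 1) (hbound : ∀ᵐ z : ℂ, ‖μ z‖ ≤ k) :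
    ∃! Φ : ℂ → ℂ, IsHomeomorph Φ ∧ Φ 0 = 0 ∧ Φ 1 = 1 ∧
      ∃ g h : ℂ → ℂ, HasWeakDerivsOn Set.univ Φ g h ∧
        ∀ᵐ z : ℂ, (g z + Complex.I * h z) / 2 = μ z * ((g z - Complex.I * h z) / 2) := by
  have hk0 : 0 ≤ k := by
    obtain ⟨z, hz⟩ := hbound.exists
    exact (norm_nonneg _).trans hz
  obtain ⟨k', C, m, f, Φ, hl⟩ := MRM.exists_lim hμ hk0 hk hbound
  refine ⟨Φ, ⟨hl.homeo, hl.nqs.zero, hl.nqs.one, hl.exists_derivs hμ⟩, ?_⟩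
  rintro Ψ ⟨hΨ, h0, h1, g, h, hw, hB⟩
  exact hl.unique hμ hΨ h0 h1 hw hB
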